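/- arXiv:1202.1370 — 7 statements merged into one kernel-verified Lean document; each statement's English description precedes it below -/
import Mathlib

section
/- Let (B,‖·‖) be a separable real Banach space, s > 0, and ν_1, ν_2 ∈ M_s(B). Let X_1, Y_1, X_2, Y_2 be B-valued random variables with L(X_1), L(Y_1) ∈ M_s(ν_1) and L(X_2), L(Y_2) ∈ M_s(ν_2), and such that (X_1, Y_1) and (X_2, Y_2) are independent. Then ζ_s(X_1 + X_2, Y_1 + Y_2) ≤ ζ_s(X_1, Y_1) + ζ_s(X_2, Y_2). -/
open MeasureTheory ProbabilityTheory Filter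
open scoped ENNReal NNReal Topology

noncomputable section

/-- The Zolotarev class of test functions of order `s`. -/
def zolotarevClass (E : Type*) [NormedAddCommGroup E] [NormedSpace ℝ E] (s : ℝ) : Set (E → ℝ) :=
  {f | ContDiff ℝ (⌈s⌉₊ - 1 : ℕ) f ∧
    ∀ x y : E, ‖iteratedFDeriv ℝ (⌈s⌉₊ - 1) f x - iteratedFDeriv ℝ (⌈s⌉₊ - 1) f y‖
      ≤ ‖x - y‖ ^ (s - (⌈s⌉₊ - 1 : ℕ))}

/-- The Zolotarev distance of order `s`. -/
def zolotarevDist {E : Type*} [NormedAddCommGroup E] [NormedSpace ℝ E] [MeasurableSpace E]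
    (s : ℝ) (μ ν : Measure E) : ℝ≥0∞ :=
  ⨆ f ∈ zolotarevClass E s, ENNReal.ofReal |∫ x, f x ∂μ - ∫ x, f x ∂ν|

/-- `μ ∈ M_s(E)`: probability measures with finite absolute moment of order `s`. -/
def MemMs {E : Type*} [NormedAddCommGroup E] [NormedSpace ℝ E] [MeasurableSpace E]
    (s : ℝ) (μ : Measure E) : Prop :=
  IsProbabilityMeasure μ ∧ ∫⁻ x, ENNReal.ofReal (‖x‖ ^ s) ∂μ < ∞

/-- `μ ∈ M_s(ν)`: members of `M_s(E)` whose mixed moments up to order `m = ⌈s⌉ - 1` agree with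
those of `ν`. -/
def MemMsOf {E : Type*} [NormedAddCommGroup E] [NormedSpace ℝ E] [MeasurableSpace E]
    (s : ℝ) (ν μ : Measure E) : Prop :=
  MemMs s μ ∧ ∀ k : ℕ, 1 ≤ k → k ≤ ⌈s⌉₊ - 1 →
    ∀ f : ContinuousMultilinearMap ℝ (fun _ : Fin k => E) ℝ,
      ∫ x, f (fun _ => x) ∂μ = ∫ x, f (fun _ => x) ∂ν

/-- If the derivative of order `k + 1` has polynomial growth of order `b`, then the derivative of
order `k` has polynomial growth of order `b + 1`. -/
theorem exists_norm_iteratedFDeriv_le_of_succ {E : Type*} [NormedAddCommGroup E]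
    [NormedSpace ℝ E] {f : E → ℝ} {k : ℕ} (hf : ContDiff ℝ (k + 1 : ℕ) f) {b C : ℝ} (hb : 0 ≤ b)
    (hC : ∀ x, ‖iteratedFDeriv ℝ (k + 1) f x‖ ≤ C * (1 + ‖x‖) ^ b) :
    ∃ C', ∀ x, ‖iteratedFDeriv ℝ k f x‖ ≤ C' * (1 + ‖x‖) ^ (b + 1) := by
  have hC0 : 0 ≤ C := by simpa using (norm_nonneg _).trans (hC 0)
  refine ⟨‖iteratedFDeriv ℝ k f 0‖ + C, fun x => ?_⟩
  have hdiff : Differentiable ℝ (iteratedFDeriv ℝ k f) :=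
    hf.differentiable_iteratedFDeriv (by exact_mod_cast Nat.lt_succ_self k)
  have hmvt : ‖iteratedFDeriv ℝ k f x - iteratedFDeriv ℝ k f 0‖
      ≤ C * (1 + ‖x‖) ^ b * ‖x - 0‖ := by
    refine (convex_closedBall (0 : E) ‖x‖).norm_image_sub_le_of_norm_fderiv_le (𝕜 := ℝ)
      (fun y _ => hdiff y) (fun y hy => ?_) (by simp) (by simp)
    rw [norm_fderiv_iteratedFDeriv]
    have hy' : ‖y‖ ≤ ‖x‖ := by simpa using hy
    exact (hC y).trans (by gcongr)
  have hone : 1 ≤ (1 + ‖x‖) ^ (b + 1) :=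
    Real.one_le_rpow (by linarith [norm_nonneg x]) (by linarith)
  have hmul : (1 + ‖x‖) ^ b * ‖x‖ ≤ (1 + ‖x‖) ^ (b + 1) := by
    rw [Real.rpow_add_one (by positivity)]
    gcongr
    linarith
  have htri := norm_sub_norm_le (iteratedFDeriv ℝ k f x) (iteratedFDeriv ℝ k f 0)
  rw [sub_zero] at hmvt
  nlinarith [mul_le_mul_of_nonneg_left hmul hC0,
    mul_le_mul_of_nonneg_left hone (norm_nonneg (iteratedFDeriv ℝ k f 0))]

/-- If the derivative of order `m` has polynomial growth of order `a`, then the function has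
polynomial growth of order `a + m`. -/
theorem exists_abs_le_of_norm_iteratedFDeriv_le {E : Type*} [NormedAddCommGroup E]
    [NormedSpace ℝ E] {f : E → ℝ} {m : ℕ} (hf : ContDiff ℝ m f) {a C : ℝ} (ha : 0 ≤ a)
    (hC : ∀ x, ‖iteratedFDeriv ℝ m f x‖ ≤ C * (1 + ‖x‖) ^ a) :
    ∃ C', ∀ x, |f x| ≤ C' * (1 + ‖x‖) ^ (a + m) := by
  induction m generalizing a C with
  | zero => exact ⟨C, by simpa using hC⟩
  | succ k ih =>
    obtain ⟨C₁, hC₁⟩ := exists_norm_iteratedFDeriv_le_of_succ hf ha hC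
    obtain ⟨C₂, hC₂⟩ := ih (hf.of_le (by exact_mod_cast Nat.le_succ k)) (by linarith) hC₁
    refine ⟨C₂, fun x => (hC₂ x).trans_eq ?_⟩
    push_cast
    ring_nf

/-- Functions in the Zolotarev class of order `s` have polynomial growth of order `s`. -/
theorem exists_abs_le_of_mem_zolotarevClass {E : Type*} [NormedAddCommGroup E]
    [NormedSpace ℝ E] {s : ℝ} (hs : 0 < s) {f : E → ℝ} (hf : f ∈ zolotarevClass E s) :
    ∃ C, ∀ x, |f x| ≤ C * (1 + ‖x‖) ^ s := by
  obtain ⟨hdiff, hholder⟩ := hf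
  set m := ⌈s⌉₊ - 1 with hm
  have hms : (m : ℝ) ≤ s := by
    have hpos : 0 < ⌈s⌉₊ := Nat.ceil_pos.mpr hs
    have hlt := Nat.ceil_lt_add_one hs.le
    have hcast : (⌈s⌉₊ : ℝ) = m + 1 := by exact_mod_cast (by omega : ⌈s⌉₊ = m + 1)
    linarith
  have hα : 0 ≤ s - m := sub_nonneg.mpr hms
  obtain ⟨C, hC⟩ := exists_abs_le_of_norm_iteratedFDeriv_le hdiff hα
    (C := ‖iteratedFDeriv ℝ m f 0‖ + 1) fun x => by
      have htri := norm_sub_norm_le (iteratedFDeriv ℝ m f x) (iteratedFDeriv ℝ m f 0)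
      have hx := hholder x 0
      rw [sub_zero] at hx
      have hle : ‖x‖ ^ (s - m) ≤ (1 + ‖x‖) ^ (s - m) := by gcongr; linarith
      have hone : 1 ≤ (1 + ‖x‖) ^ (s - m) :=
        Real.one_le_rpow (by linarith [norm_nonneg x]) hα
      nlinarith [mul_le_mul_of_nonneg_left hone (norm_nonneg (iteratedFDeriv ℝ m f 0))]
  exact ⟨C, by simpa using hC⟩

/-- The Zolotarev class is invariant under translations. -/
theorem comp_add_right_mem_zolotarevClass {E : Type*} [NormedAddCommGroup E] [NormedSpace ℝ E]
    {s : ℝ} {f : E → ℝ} (hf : f ∈ zolotarevClass E s) (z : E) :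
    (fun x => f (x + z)) ∈ zolotarevClass E s := by
  refine ⟨hf.1.comp (contDiff_id.add contDiff_const), fun x y => ?_⟩
  simp only [iteratedFDeriv_comp_add_right]
  simpa using hf.2 (x + z) (y + z)

theorem MemMs.integrable_one_add_norm_rpow {E : Type*} [NormedAddCommGroup E] [NormedSpace ℝ E]
    [MeasurableSpace E] [BorelSpace E] {s : ℝ} (hs : 0 < s) {μ : Measure E} (hμ : MemMs s μ) :
    Integrable (fun x => (1 + ‖x‖) ^ s) μ := by
  have := hμ.1
  have hnorm : Integrable (fun x : E => ‖x‖ ^ s) μ := by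
    refine ⟨(measurable_norm.pow_const s).aestronglyMeasurable, ?_⟩
    rw [hasFiniteIntegral_iff_ofReal (ae_of_all _ fun x => by positivity)]
    exact hμ.2
  refine (((integrable_const (1 : ℝ)).add hnorm).const_mul (2 ^ s)).mono'
    ((measurable_norm.const_add 1).pow_const s).aestronglyMeasurable (ae_of_all _ fun x => ?_)
  rw [Real.norm_of_nonneg (by positivity)]
  simp only [Pi.add_apply]
  have hnn := Real.rpow_nonneg (norm_nonneg x) s
  rcases le_total ‖x‖ 1 with h | h
  · calc (1 + ‖x‖) ^ s ≤ 2 ^ s := by gcongr; linarith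
      _ ≤ 2 ^ s * (1 + ‖x‖ ^ s) := le_mul_of_one_le_right (by positivity) (by linarith)
  · calc (1 + ‖x‖) ^ s ≤ (2 * ‖x‖) ^ s := by gcongr; linarith
      _ = 2 ^ s * ‖x‖ ^ s := Real.mul_rpow (by norm_num) (norm_nonneg x)
      _ ≤ 2 ^ s * (1 + ‖x‖ ^ s) := by gcongr; linarith

section

variable {E : Type*} [NormedAddCommGroup E] [NormedSpace ℝ E] [MeasurableSpace E] [BorelSpace E]
  [SecondCountableTopology E]

theorem integrable_add_prod_of_mem_zolotarevClass {s : ℝ} (hs : 0 < s) {μ ρ : Measure E}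
    (hμ : MemMs s μ) (hρ : MemMs s ρ) {f : E → ℝ} (hf : f ∈ zolotarevClass E s) :
    Integrable (fun p : E × E => f (p.1 + p.2)) (μ.prod ρ) := by
  have := hμ.1
  have := hρ.1
  obtain ⟨C, hC⟩ := exists_abs_le_of_mem_zolotarevClass hs hf
  have hC0 : 0 ≤ C := by simpa using (abs_nonneg _).trans (hC 0)
  refine (((hμ.integrable_one_add_norm_rpow hs).mul_prod
    (hρ.integrable_one_add_norm_rpow hs)).const_mul C).mono'
    (hf.1.continuous.measurable.comp measurable_add).aestronglyMeasurable
    (ae_of_all _ fun p => (hC _).trans ?_)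
  rw [← Real.mul_rpow (by positivity) (by positivity)]
  gcongr
  nlinarith [norm_add_le p.1 p.2, mul_nonneg (norm_nonneg p.1) (norm_nonneg p.2)]

theorem integral_conv_of_mem_zolotarevClass {s : ℝ} (hs : 0 < s) {μ ρ : Measure E}
    (hμ : MemMs s μ) (hρ : MemMs s ρ) {f : E → ℝ} (hf : f ∈ zolotarevClass E s) :
    ∫ x, f x ∂(μ.conv ρ) = ∫ z, ∫ x, f (x + z) ∂μ ∂ρ := by
  have := hμ.1
  have := hρ.1
  rw [Measure.conv, integral_map measurable_add.aemeasurable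
    hf.1.continuous.measurable.aestronglyMeasurable]
  exact integral_prod_symm _ (integrable_add_prod_of_mem_zolotarevClass hs hμ hρ hf)

/-- Convolution with a fixed measure does not increase the Zolotarev distance. -/
theorem zolotarevDist_conv_right_le {s : ℝ} (hs : 0 < s) {μ ν ρ : Measure E}
    (hμ : MemMs s μ) (hν : MemMs s ν) (hρ : MemMs s ρ) :
    zolotarevDist s (μ.conv ρ) (ν.conv ρ) ≤ zolotarevDist s μ ν := by
  have := hμ.1
  have := hν.1
  have := hρ.1
  rcases eq_or_ne (zolotarevDist s μ ν) ∞ with htop | htop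
  · simp [htop]
  refine iSup₂_le fun f hf => ENNReal.ofReal_le_of_le_toReal ?_
  rw [integral_conv_of_mem_zolotarevClass hs hμ hρ hf,
    integral_conv_of_mem_zolotarevClass hs hν hρ hf, ← integral_sub
    (integrable_add_prod_of_mem_zolotarevClass hs hμ hρ hf).integral_prod_right
    (integrable_add_prod_of_mem_zolotarevClass hs hν hρ hf).integral_prod_right,
    ← Real.norm_eq_abs, ← mul_one (zolotarevDist s μ ν).toReal, ← probReal_univ (μ := ρ)]
  refine norm_integral_le_of_norm_le_const (ae_of_all _ fun z => ?_)
  refine (ENNReal.ofReal_le_iff_le_toReal htop).1 ?_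
  exact le_iSup₂_of_le (f := fun (g : E → ℝ) (_ : g ∈ zolotarevClass E s) =>
    ENNReal.ofReal |∫ x, g x ∂μ - ∫ x, g x ∂ν|)
    _ (comp_add_right_mem_zolotarevClass hf z) le_rfl

end

theorem zolotarevDist_triangle {E : Type*} [NormedAddCommGroup E] [NormedSpace ℝ E]
    [MeasurableSpace E] (s : ℝ) (μ ν ρ : Measure E) :
    zolotarevDist s μ ρ ≤ zolotarevDist s μ ν + zolotarevDist s ν ρ := by
  refine iSup₂_le fun f hf => ?_
  calc ENNReal.ofReal |∫ x, f x ∂μ - ∫ x, f x ∂ρ|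
      ≤ ENNReal.ofReal (|∫ x, f x ∂μ - ∫ x, f x ∂ν| + |∫ x, f x ∂ν - ∫ x, f x ∂ρ|) :=
        ENNReal.ofReal_le_ofReal (abs_sub_le _ _ _)
    _ = ENNReal.ofReal |∫ x, f x ∂μ - ∫ x, f x ∂ν|
        + ENNReal.ofReal |∫ x, f x ∂ν - ∫ x, f x ∂ρ| :=
        ENNReal.ofReal_add (abs_nonneg _) (abs_nonneg _)
    _ ≤ zolotarevDist s μ ν + zolotarevDist s ν ρ :=
        add_le_add (le_iSup₂_of_le f hf le_rfl) (le_iSup₂_of_le f hf le_rfl)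

theorem zolotarev_add_le_of_indep
    {Ω B : Type*} [MeasurableSpace Ω]
    [NormedAddCommGroup B] [NormedSpace ℝ B] [MeasurableSpace B] [BorelSpace B]
    [SecondCountableTopology B] [CompleteSpace B]
    (P : Measure Ω) [IsProbabilityMeasure P]
    (s : ℝ) (hs : 0 < s) (ν₁ ν₂ : Measure B) (hν₁ : MemMs s ν₁) (hν₂ : MemMs s ν₂)
    (X₁ Y₁ X₂ Y₂ : Ω → B)
    (hX₁ : Measurable X₁) (hY₁ : Measurable Y₁) (hX₂ : Measurable X₂) (hY₂ : Measurable Y₂)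
    (hX₁ν : MemMsOf s ν₁ (P.map X₁)) (hY₁ν : MemMsOf s ν₁ (P.map Y₁))
    (hX₂ν : MemMsOf s ν₂ (P.map X₂)) (hY₂ν : MemMsOf s ν₂ (P.map Y₂))
    (hindep : IndepFun (fun ω => (X₁ ω, Y₁ ω)) (fun ω => (X₂ ω, Y₂ ω)) P) :
    zolotarevDist s (P.map (fun ω => X₁ ω + X₂ ω)) (P.map (fun ω => Y₁ ω + Y₂ ω))
      ≤ zolotarevDist s (P.map X₁) (P.map Y₁) + zolotarevDist s (P.map X₂) (P.map Y₂) := by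
  have hX : IndepFun X₁ X₂ P := hindep.comp measurable_fst measurable_fst
  have hY : IndepFun Y₁ Y₂ P := hindep.comp measurable_snd measurable_snd
  have hmapX : P.map (fun ω => X₁ ω + X₂ ω) = (P.map X₁).conv (P.map X₂) :=
    hX.map_add_eq_map_conv_map hX₁ hX₂
  have hmapY : P.map (fun ω => Y₁ ω + Y₂ ω) = (P.map Y₁).conv (P.map Y₂) :=
    hY.map_add_eq_map_conv_map hY₁ hY₂
  have := hY₁ν.1.1
  have := hX₂ν.1.1
  have := hY₂ν.1.1
  rw [hmapX, hmapY]
  refine (zolotarevDist_triangle s _ ((P.map Y₁).conv (P.map X₂)) _).trans (add_le_add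
    (zolotarevDist_conv_right_le hs hX₁ν.1 hY₁ν.1 hX₂ν.1) ?_)
  rw [Measure.conv_comm (P.map Y₁), Measure.conv_comm (P.map Y₁)]
  exact zolotarevDist_conv_right_le hs hX₂ν.1 hY₂ν.1 hY₁ν.1

end
end

section
/- Let (B,‖·‖) be a separable real Banach space, s > 0, ν ∈ M_s(B), and X, Y be B-valued random variables with L(X), L(Y) ∈ M_s(ν). If s ≤ 1 then ζ_s(X, Y) = ℓ_s(X, Y). If s > 1 then ζ_s(X, Y) ≤ ( E[‖X‖^s]^{1 − 1/s} + E[‖Y‖^s]^{1 − 1/s} ) · ℓ_s(X, Y). -/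
open MeasureTheory ProbabilityTheory Filter
open scoped ENNReal NNReal Topology

noncomputable section

/-- The minimal (Wasserstein-type) `ℓ_p` distance: the infimum of
`E[‖X−Y‖^p]^{(1/p) ∧ 1}` over all couplings of `μ` and `ν`. -/
def minimalLp {E : Type*} [NormedAddCommGroup E] [NormedSpace ℝ E] [MeasurableSpace E]
    (p : ℝ) (μ ν : Measure E) : ℝ≥0∞ :=
  ⨅ π ∈ {π : Measure (E × E) |
      IsProbabilityMeasure π ∧ π.map Prod.fst = μ ∧ π.map Prod.snd = ν},
    (∫⁻ z : E × E, ENNReal.ofReal (‖z.1 - z.2‖ ^ p) ∂π) ^ (min (1/p) 1)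


section Taylor

variable {E F : Type*} [NormedAddCommGroup E] [NormedSpace ℝ E]
  [NormedAddCommGroup F] [NormedSpace ℝ F]

lemma iteratedFDeriv_succ_apply_eq_fderiv {n : ℕ} {f : E → F} {x : E}
    (hd : DifferentiableAt ℝ (iteratedFDeriv ℝ n f) x) (w : Fin (n + 1) → E) :
    iteratedFDeriv ℝ (n + 1) f x w =
      fderiv ℝ (fun y => iteratedFDeriv ℝ n f y (Fin.tail w)) x (w 0) := by
  rw [iteratedFDeriv_succ_apply_left,
    (hd.hasFDerivAt.continuousMultilinear_apply_const (Fin.tail w)).fderiv]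
  rfl

/-- The first two arguments of an iterated derivative of a `C^(n+2)` function may be exchanged. -/
lemma iteratedFDeriv_comp_swap_zero_one {n : ℕ} {f : E → F} (hf : ContDiff ℝ (n + 2 : ℕ) f)
    (x : E) (v : Fin (n + 2) → E) :
    iteratedFDeriv ℝ (n + 2) f x (v ∘ Equiv.swap 0 1) = iteratedFDeriv ℝ (n + 2) f x v := by
  have hC : ContDiff ℝ 2 (iteratedFDeriv ℝ n f) :=
    hf.iteratedFDeriv_right (m := 2) (i := n) (by norm_cast; omega)
  have key : ∀ w : Fin (n + 2) → E, iteratedFDeriv ℝ (n + 2) f x w =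
      fderiv ℝ (fderiv ℝ (iteratedFDeriv ℝ n f)) x (w 0) (w 1) (Fin.tail (Fin.tail w)) := by
    intro w
    have hd : DifferentiableAt ℝ (fderiv ℝ (iteratedFDeriv ℝ n f)) x :=
      (hC.fderiv_right (m := 1) (by norm_num)).differentiable (by norm_num) x
    have h1 := (hd.hasFDerivAt.clm_apply
      (hasFDerivAt_const (w 1) x)).continuousMultilinear_apply_const (Fin.tail (Fin.tail w))
    rw [iteratedFDeriv_succ_apply_eq_fderiv
      (hf.differentiable_iteratedFDeriv (by norm_cast; omega) x)]
    have h2 : (fun y => iteratedFDeriv ℝ (n + 1) f y (Fin.tail w)) =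
        fun y => fderiv ℝ (iteratedFDeriv ℝ n f) y (w 1) (Fin.tail (Fin.tail w)) := rfl
    rw [h2, h1.fderiv]
    simp
  have hsymm : IsSymmSndFDerivAt ℝ (iteratedFDeriv ℝ n f) x :=
    hC.contDiffAt.isSymmSndFDerivAt (by simp)
  rw [key, key]
  have ht : Fin.tail (Fin.tail (v ∘ Equiv.swap 0 1)) = Fin.tail (Fin.tail v) := by
    funext i
    simp only [Fin.tail, Function.comp]
    rw [Equiv.swap_apply_of_ne_of_ne]
    · exact Fin.succ_ne_zero _
    · rw [← Fin.succ_zero_eq_one]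
      exact fun h => Fin.succ_ne_zero _ (Fin.succ_injective _ h)
  rw [ht]
  simp only [Function.comp, Equiv.swap_apply_left, Equiv.swap_apply_right]
  rw [hsymm.eq]

/-- The `n`-th derivative of a `C^n` function is symmetric. -/
lemma ContDiff.iteratedFDeriv_comp_perm_of_nat {n : ℕ} {f : E → F} (hf : ContDiff ℝ n f)
    (σ : Equiv.Perm (Fin n)) (x : E) (v : Fin n → E) :
    iteratedFDeriv ℝ n f x (v ∘ σ) = iteratedFDeriv ℝ n f x v := by
  induction n generalizing x with
  | zero => rw [Subsingleton.elim σ 1]; rfl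
  | succ n ih =>
    have ih' := ih (hf.of_le (by norm_cast; omega))
    have hmem : σ ∈ Submonoid.closure
        (Set.range fun i : Fin n => Equiv.swap i.castSucc i.succ) := by
      rw [Equiv.Perm.mclosure_swap_castSucc_succ]; trivial
    induction hmem using Submonoid.closure_induction generalizing v with
    | one => rfl
    | mul σ τ _ _ hσ hτ =>
      have : v ∘ (σ * τ : Equiv.Perm _) = (v ∘ σ) ∘ τ := rfl
      rw [this, hτ, hσ]
    | mem σ hσ =>
      obtain ⟨i, rfl⟩ := hσ
      cases n with
      | zero => exact i.elim0
      | succ k =>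
        refine Fin.cases ?_ (fun j => ?_) i
        · exact iteratedFDeriv_comp_swap_zero_one hf x v
        · have hd : DifferentiableAt ℝ (iteratedFDeriv ℝ (k + 1) f) x :=
            hf.differentiable_iteratedFDeriv (by norm_cast; omega) x
          rw [iteratedFDeriv_succ_apply_eq_fderiv hd, iteratedFDeriv_succ_apply_eq_fderiv hd]
          have h0 : (v ∘ Equiv.swap j.succ.castSucc j.succ.succ) 0 = v 0 := by
            simp only [Function.comp]
            rw [Equiv.swap_apply_of_ne_of_ne]
            · exact fun h => by simpa using congrArg Fin.val h
            · exact fun h => by simpa using congrArg Fin.val h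
          have ht : Fin.tail (v ∘ Equiv.swap j.succ.castSucc j.succ.succ) =
              Fin.tail v ∘ Equiv.swap j.castSucc j.succ := by
            funext l
            simp only [Fin.tail, Function.comp]
            congr 1
            rw [(Fin.succ_injective _).map_swap]
            rfl
          rw [h0, ht]
          simp_rw [ih']

/-- The Taylor series of `f` at `0`, truncated after the terms of degree `m`. -/
def taylorSeriesUpTo (f : E → F) (m : ℕ) : FormalMultilinearSeries ℝ E F := fun k =>
  if k ≤ m then (k.factorial : ℝ)⁻¹ • iteratedFDeriv ℝ k f 0 else 0

lemma taylorSeriesUpTo_eq_zero (f : E → F) (m k : ℕ) (hk : m + 1 ≤ k) :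
    taylorSeriesUpTo f m k = 0 := if_neg (by omega)

lemma hasFiniteFPowerSeriesOnBall_taylorSeriesUpTo (f : E → F) (m : ℕ) :
    HasFiniteFPowerSeriesOnBall (taylorSeriesUpTo f m).sum (taylorSeriesUpTo f m) 0 (m + 1) ⊤ :=
  (taylorSeriesUpTo f m).hasFiniteFPowerSeriesOnBall_of_finite (taylorSeriesUpTo_eq_zero f m)

variable [CompleteSpace F]

lemma contDiff_taylorSeriesUpTo_sum (f : E → F) (m : ℕ) {n : WithTop ℕ∞} :
    ContDiff ℝ n (taylorSeriesUpTo f m).sum := by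
  have h := (hasFiniteFPowerSeriesOnBall_taylorSeriesUpTo f m).toHasFPowerSeriesOnBall.analyticOnNhd
  rw [Metric.eball_top] at h
  exact contDiffOn_univ.1 h.contDiffOn_of_completeSpace

lemma iteratedFDeriv_taylorSeriesUpTo_sum_zero {f : E → F} {m k : ℕ} (hf : ContDiff ℝ m f)
    (hk : k ≤ m) :
    iteratedFDeriv ℝ k (taylorSeriesUpTo f m).sum 0 = iteratedFDeriv ℝ k f 0 := by
  ext v
  rw [(hasFiniteFPowerSeriesOnBall_taylorSeriesUpTo
    f m).toHasFPowerSeriesOnBall.iteratedFDeriv_eq_sum_of_completeSpace v]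
  have hfk : ContDiff ℝ k f := hf.of_le (by exact_mod_cast hk)
  have : ∀ σ : Equiv.Perm (Fin k), taylorSeriesUpTo f m k (fun i => v (σ i)) =
      (k.factorial : ℝ)⁻¹ • iteratedFDeriv ℝ k f 0 v := by
    intro σ
    rw [taylorSeriesUpTo, if_pos hk, smul_apply]
    congr 1
    exact hfk.iteratedFDeriv_comp_perm_of_nat σ 0 v
  rw [Finset.sum_congr rfl fun σ _ => this σ, Finset.sum_const, Finset.card_univ,
    Fintype.card_perm, Fintype.card_fin, ← Nat.cast_smul_eq_nsmul ℝ, smul_smul,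
    mul_inv_cancel₀ (by positivity), one_smul]

lemma iteratedFDeriv_taylorSeriesUpTo_sum_eq (f : E → F) (m : ℕ) (x : E) :
    iteratedFDeriv ℝ m (taylorSeriesUpTo f m).sum x =
      iteratedFDeriv ℝ m (taylorSeriesUpTo f m).sum 0 := by
  have hzero : ∀ y, iteratedFDeriv ℝ (m + 1) (taylorSeriesUpTo f m).sum y = 0 := by
    intro y
    ext v
    have h := (hasFiniteFPowerSeriesOnBall_taylorSeriesUpTo f m).changeOrigin (y := y)
      ENNReal.coe_lt_top
    rw [zero_add] at h
    rw [h.toHasFPowerSeriesOnBall.iteratedFDeriv_eq_sum_of_completeSpace v]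
    simp [h.finite (m + 1) le_rfl]
  refine is_const_of_fderiv_eq_zero (𝕜 := ℝ) ?_ (fun y => ?_) x 0
  · exact (contDiff_taylorSeriesUpTo_sum f m (n := (m + 1 : ℕ))).differentiable_iteratedFDeriv
      (by norm_cast; omega)
  · rw [← norm_eq_zero, norm_fderiv_iteratedFDeriv, hzero, norm_zero]

omit [CompleteSpace F] in
lemma norm_iteratedFDeriv_le_rpow {g : E → F} {m : ℕ} {α : ℝ} (hα : 0 ≤ α)
    (hg : ContDiff ℝ m g) (h0 : ∀ k ≤ m, iteratedFDeriv ℝ k g 0 = 0)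
    (hm : ∀ x, ‖iteratedFDeriv ℝ m g x‖ ≤ ‖x‖ ^ α) (j k : ℕ) (hjk : k + j = m) (x : E) :
    ‖iteratedFDeriv ℝ k g x‖ ≤ ‖x‖ ^ (j + α) := by
  induction j generalizing k x with
  | zero => simp only [add_zero] at hjk; subst hjk; simpa using hm x
  | succ j ih =>
    have hdiff : Differentiable ℝ (iteratedFDeriv ℝ k g) :=
      hg.differentiable_iteratedFDeriv (by norm_cast; omega)
    have := (convex_closedBall (0 : E) ‖x‖).norm_image_sub_le_of_norm_fderiv_le (𝕜 := ℝ)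
      (f := iteratedFDeriv ℝ k g) (C := ‖x‖ ^ (j + α)) (fun y _ => hdiff y)
      (fun y hy => by
        rw [norm_fderiv_iteratedFDeriv]
        refine (ih (k + 1) (by omega) y).trans ?_
        exact Real.rpow_le_rpow (norm_nonneg _) (by simpa using hy) (by positivity))
      (x := 0) (y := x) (by simp) (by simp)
    rw [h0 k (by omega), sub_zero, sub_zero] at this
    refine this.trans (le_of_eq ?_)
    rw [Nat.cast_succ, add_right_comm, Real.rpow_add_one' (norm_nonneg _) (by positivity)]

omit [CompleteSpace F] in
lemma norm_sub_le_of_iteratedFDeriv {g : E → F} {m : ℕ} {α : ℝ} (hα : 0 ≤ α)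
    (hg : ContDiff ℝ (m + 1 : ℕ) g) (h0 : ∀ k ≤ m + 1, iteratedFDeriv ℝ k g 0 = 0)
    (hm : ∀ x, ‖iteratedFDeriv ℝ (m + 1) g x‖ ≤ ‖x‖ ^ α) (x y : E) :
    ‖g x - g y‖ ≤ ‖x - y‖ * (‖x‖ ^ (m + α) + ‖y‖ ^ (m + α)) := by
  have hdiff : Differentiable ℝ g := hg.differentiable (by norm_cast)
  have := (convex_closedBall (0 : E) (max ‖x‖ ‖y‖)).norm_image_sub_le_of_norm_fderiv_le (𝕜 := ℝ)
    (f := g) (C := max ‖x‖ ‖y‖ ^ (m + α)) (fun y _ => hdiff y)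
    (fun z hz => by
      rw [← norm_iteratedFDeriv_one]
      refine (norm_iteratedFDeriv_le_rpow hα hg h0 hm m 1 (by omega) z).trans ?_
      exact Real.rpow_le_rpow (norm_nonneg _) (by simpa using hz) (by positivity))
    (x := y) (y := x) (by simp) (by simp)
  refine this.trans ?_
  rw [mul_comm]
  gcongr
  rcases le_total ‖x‖ ‖y‖ with h | h
  · rw [max_eq_right h]; exact le_add_of_nonneg_left (by positivity)
  · rw [max_eq_left h]; exact le_add_of_nonneg_right (by positivity)

end Taylor

section UpperBounds

variable {E : Type*} [NormedAddCommGroup E] [NormedSpace ℝ E] [MeasurableSpace E]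

lemma ofReal_abs_integral_le_lintegral {α : Type*} [MeasurableSpace α] (μ : Measure α)
    (f : α → ℝ) : ENNReal.ofReal |∫ x, f x ∂μ| ≤ ∫⁻ x, ENNReal.ofReal |f x| ∂μ := by
  simpa only [Real.enorm_eq_ofReal_abs] using enorm_integral_le_lintegral_enorm (μ := μ) f

omit [NormedAddCommGroup E] [NormedSpace ℝ E] in
lemma ofReal_abs_integral_sub_integral_le {μ ν : Measure E} {π : Measure (E × E)}
    (h1 : π.map Prod.fst = μ) (h2 : π.map Prod.snd = ν) {f : E → ℝ}
    (hμ : Integrable f μ) (hν : Integrable f ν) :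
    ENNReal.ofReal |∫ x, f x ∂μ - ∫ x, f x ∂ν| ≤ ∫⁻ z, ENNReal.ofReal |f z.1 - f z.2| ∂π := by
  subst h1 h2
  rw [integral_map measurable_fst.aemeasurable hμ.1, integral_map measurable_snd.aemeasurable hν.1,
    ← integral_sub (f := fun z : E × E => f z.1) (g := fun z : E × E => f z.2)
      (hμ.comp_measurable measurable_fst) (hν.comp_measurable measurable_snd)]
  exact ofReal_abs_integral_le_lintegral π _

variable [BorelSpace E]

lemma MemMs.integrable_norm_rpow {s : ℝ} {μ : Measure E} (hμ : MemMs s μ) :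
    Integrable (fun x => ‖x‖ ^ s) μ := by
  refine ⟨(measurable_norm.pow_const s).aestronglyMeasurable, ?_⟩
  have : ∀ x : E, ‖(‖x‖ ^ s)‖ₑ = ENNReal.ofReal (‖x‖ ^ s) := fun x => by
    rw [Real.enorm_eq_ofReal (by positivity)]
  simpa only [HasFiniteIntegral, this] using hμ.2

lemma MemMs.integrable_of_le {s : ℝ} {μ : Measure E} (hμ : MemMs s μ) {f : E → ℝ}
    (hf : Continuous f) (C : ℝ) (hC : ∀ x, |f x| ≤ C * (1 + ‖x‖ ^ s)) : Integrable f μ := by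
  have := hμ.1
  exact (((integrable_const 1).add hμ.integrable_norm_rpow).const_mul C).mono'
    hf.measurable.aestronglyMeasurable (.of_forall hC)

lemma rpow_le_one_add_rpow {x a b : ℝ} (hx : 0 ≤ x) (ha : 0 ≤ a) (hab : a ≤ b) :
    x ^ a ≤ 1 + x ^ b := by
  rcases le_total x 1 with h | h
  · exact (Real.rpow_le_one hx h ha).trans (le_add_of_nonneg_right (by positivity))
  · exact (Real.rpow_le_rpow_of_exponent_le h hab).trans (by linarith)

lemma MemMs.integrable_multilinear {s : ℝ} {μ : Measure E} (hμ : MemMs s μ) {k : ℕ}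
    (hk : (k : ℝ) ≤ s) (f : ContinuousMultilinearMap ℝ (fun _ : Fin k => E) ℝ) :
    Integrable (fun x => f fun _ => x) μ := by
  refine hμ.integrable_of_le (f.cont.comp (by fun_prop)) ‖f‖ fun x => ?_
  refine (f.le_opNorm _).trans ?_
  gcongr
  rw [Finset.prod_const, Finset.card_univ, Fintype.card_fin, ← Real.rpow_natCast]
  exact rpow_le_one_add_rpow (norm_nonneg x) (by positivity) hk

lemma MemMsOf.integral_taylorSeriesUpTo_sum {s : ℝ} (hs : 0 < s) {ν μ : Measure E}
    (hμ : MemMsOf s ν μ) (hν : IsProbabilityMeasure ν) (f : E → ℝ) :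
    Integrable (taylorSeriesUpTo f (⌈s⌉₊ - 1)).sum μ ∧
      ∫ x, (taylorSeriesUpTo f (⌈s⌉₊ - 1)).sum x ∂μ =
        ∑ k ∈ Finset.range (⌈s⌉₊ - 1 + 1),
          ∫ x, taylorSeriesUpTo f (⌈s⌉₊ - 1) k (fun _ => x) ∂ν := by
  have hm : ((⌈s⌉₊ - 1 : ℕ) : ℝ) ≤ s := by
    have h1 : 1 ≤ ⌈s⌉₊ := Nat.ceil_pos.2 hs
    have := Nat.ceil_lt_add_one hs.le
    push_cast [Nat.cast_sub h1]
    linarith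
  set m := ⌈s⌉₊ - 1 with hm_def
  have hP : (taylorSeriesUpTo f m).sum = fun x =>
      ∑ k ∈ Finset.range (m + 1), taylorSeriesUpTo f m k fun _ => x := by
    funext x
    exact (taylorSeriesUpTo f m).sum_of_finite (taylorSeriesUpTo_eq_zero f m) x
  have hint : ∀ k ∈ Finset.range (m + 1),
      Integrable (fun x => taylorSeriesUpTo f m k fun _ => x) μ := by
    intro k hk
    refine hμ.1.integrable_multilinear (le_trans ?_ hm) _
    exact_mod_cast Nat.lt_succ_iff.1 (Finset.mem_range.1 hk)
  rw [hP]
  refine ⟨integrable_finsetSum _ hint, ?_⟩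
  rw [integral_finsetSum _ hint]
  refine Finset.sum_congr rfl fun k hk => ?_
  rcases Nat.eq_zero_or_pos k with rfl | hk0
  · have := hμ.1.1
    have hc : ∀ x : E, (fun _ : Fin 0 => x) = fun _ => 0 := fun x => Subsingleton.elim _ _
    simp [hc]
  · exact hμ.2 k hk0 (Nat.lt_succ_iff.1 (Finset.mem_range.1 hk)) _

omit [MeasurableSpace E] [BorelSpace E] in
lemma abs_sub_taylorSeriesUpTo_sum_le {s : ℝ} (hs : 1 < s) {f : E → ℝ}
    (hf : f ∈ zolotarevClass E s) (x y : E) :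
    |(f x - (taylorSeriesUpTo f (⌈s⌉₊ - 1)).sum x) -
      (f y - (taylorSeriesUpTo f (⌈s⌉₊ - 1)).sum y)| ≤
      ‖x - y‖ * (‖x‖ ^ (s - 1) + ‖y‖ ^ (s - 1)) := by
  obtain ⟨hfC, hfH⟩ := hf
  obtain ⟨m, hm⟩ : ∃ m, ⌈s⌉₊ - 1 = m + 1 := by
    have : 1 < ⌈s⌉₊ := Nat.lt_ceil.2 (by exact_mod_cast hs)
    exact ⟨⌈s⌉₊ - 2, by omega⟩
  have hms : ((m + 1 : ℕ) : ℝ) ≤ s := by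
    have := Nat.ceil_lt_add_one (zero_le_one.trans hs.le)
    have h2 : ⌈s⌉₊ = m + 2 := by omega
    rw [h2] at this
    push_cast at this ⊢
    linarith
  rw [hm] at hfC hfH ⊢
  have hPC : ContDiff ℝ (m + 1 : ℕ) (taylorSeriesUpTo f (m + 1)).sum :=
    contDiff_taylorSeriesUpTo_sum f (m + 1)
  have hsub : ∀ k ≤ m + 1, ∀ z,
      iteratedFDeriv ℝ k (fun z => f z - (taylorSeriesUpTo f (m + 1)).sum z) z =
        iteratedFDeriv ℝ k f z - iteratedFDeriv ℝ k (taylorSeriesUpTo f (m + 1)).sum z := by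
    intro k hk z
    have hk' : ((k : ℕ) : WithTop ℕ∞) ≤ (m + 1 : ℕ) := by exact_mod_cast hk
    exact iteratedFDeriv_sub_apply (hfC.of_le hk').contDiffAt (hPC.of_le hk').contDiffAt
  have := norm_sub_le_of_iteratedFDeriv (g := fun z => f z - (taylorSeriesUpTo f (m + 1)).sum z)
    (m := m) (α := s - (m + 1 : ℕ)) (sub_nonneg.2 hms) (hfC.sub hPC)
    (fun k hk => by
      rw [hsub k hk, iteratedFDeriv_taylorSeriesUpTo_sum_zero hfC hk, sub_self])
    (fun z => by
      rw [hsub _ le_rfl, iteratedFDeriv_taylorSeriesUpTo_sum_eq,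
        iteratedFDeriv_taylorSeriesUpTo_sum_zero hfC le_rfl]
      simpa using hfH z 0) x y
  have he : (m : ℝ) + (s - (m + 1 : ℕ)) = s - 1 := by push_cast; ring
  rw [he] at this
  simpa using this

lemma ceil_sub_one_eq_zero {s : ℝ} (hs1 : s ≤ 1) : ⌈s⌉₊ - 1 = 0 := by
  have : ⌈s⌉₊ ≤ 1 := Nat.ceil_le.2 (by exact_mod_cast hs1)
  omega

omit [MeasurableSpace E] [BorelSpace E] in
lemma mem_zolotarevClass_iff_of_le_one {s : ℝ} (hs1 : s ≤ 1) {f : E → ℝ} :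
    f ∈ zolotarevClass E s ↔ Continuous f ∧ ∀ x y, |f x - f y| ≤ ‖x - y‖ ^ s := by
  have key : ∀ x y, ‖iteratedFDeriv ℝ (⌈s⌉₊ - 1) f x - iteratedFDeriv ℝ (⌈s⌉₊ - 1) f y‖ =
      |f x - f y| := by
    intro x y
    rw [ceil_sub_one_eq_zero hs1]
    simp only [iteratedFDeriv_zero_eq_comp, Function.comp, ← map_sub,
      LinearIsometryEquiv.norm_map, Real.norm_eq_abs]
  simp only [zolotarevClass, Set.mem_ofPred_eq, key, ceil_sub_one_eq_zero hs1, Nat.cast_zero,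
    sub_zero, contDiff_zero]

lemma MemMs.integrable_of_mem_zolotarevClass {s : ℝ} (hs1 : s ≤ 1) {μ : Measure E}
    (hμ : MemMs s μ) {f : E → ℝ} (hf : f ∈ zolotarevClass E s) : Integrable f μ := by
  obtain ⟨hc, hf⟩ := (mem_zolotarevClass_iff_of_le_one hs1).1 hf
  refine hμ.integrable_of_le hc (1 + |f 0|) fun x => ?_
  have h1 := hf x 0
  rw [sub_zero] at h1
  have h2 : 0 ≤ ‖x‖ ^ s := by positivity
  have h3 := abs_add_le (f x - f 0) (f 0)
  rw [sub_add_cancel] at h3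
  nlinarith [abs_nonneg (f 0)]

lemma zolotarevDist_le_minimalLp_of_le_one {s : ℝ} (hs0 : 0 < s) (hs1 : s ≤ 1) {μ ν : Measure E}
    (hμ : MemMs s μ) (hν : MemMs s ν) : zolotarevDist s μ ν ≤ minimalLp s μ ν := by
  refine iSup₂_le fun f hf => le_iInf₂ fun π hπ => ?_
  rw [min_eq_right ((one_le_div hs0).2 hs1), ENNReal.rpow_one]
  refine (ofReal_abs_integral_sub_integral_le hπ.2.1 hπ.2.2
    (hμ.integrable_of_mem_zolotarevClass hs1 hf)
    (hν.integrable_of_mem_zolotarevClass hs1 hf)).trans ?_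
  exact lintegral_mono fun z =>
    ENNReal.ofReal_le_ofReal (((mem_zolotarevClass_iff_of_le_one hs1).1 hf).2 _ _)

variable [SecondCountableTopology E]

omit [NormedSpace ℝ E] in
lemma lintegral_norm_mul_rpow_le {s : ℝ} (hs : 1 < s) {π : Measure (E × E)} {h : E × E → E}
    (hh : Measurable h) :
    ∫⁻ z, ENNReal.ofReal ‖z.1 - z.2‖ * ENNReal.ofReal (‖h z‖ ^ (s - 1)) ∂π ≤
      (∫⁻ z, ENNReal.ofReal (‖z.1 - z.2‖ ^ s) ∂π) ^ (1 / s) *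
        (∫⁻ z, ENNReal.ofReal (‖h z‖ ^ s) ∂π) ^ (1 - 1 / s) := by
  have hs0 : 0 < s := zero_lt_one.trans hs
  have hs1 : 0 < s - 1 := sub_pos.2 hs
  have := ENNReal.lintegral_mul_le_Lp_mul_Lq π (Real.HolderConjugate.conjExponent hs)
    (f := fun z => ENNReal.ofReal ‖z.1 - z.2‖) (g := fun z => ENNReal.ofReal (‖h z‖ ^ (s - 1)))
    (by fun_prop) (by fun_prop)
  refine this.trans (le_of_eq ?_)
  have e1 : 1 / s.conjExponent = 1 - 1 / s := by
    rw [Real.conjExponent]; field_simp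
  have e2 : (s - 1) * s.conjExponent = s := by
    rw [Real.conjExponent]; field_simp
  rw [e1]
  congr 3
  · funext z
    rw [ENNReal.ofReal_rpow_of_nonneg (by positivity) hs0.le]
  · funext z
    rw [ENNReal.ofReal_rpow_of_nonneg (by positivity) (by rw [Real.conjExponent]; positivity),
      ← Real.rpow_mul (norm_nonneg _), e2]

lemma zolotarevDist_le_of_one_lt {s : ℝ} (hs : 1 < s) {ν₀ μ ν : Measure E}
    (hν₀ : IsProbabilityMeasure ν₀) (hμ : MemMsOf s ν₀ μ) (hν : MemMsOf s ν₀ ν) :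
    zolotarevDist s μ ν ≤
      ((∫⁻ x, ENNReal.ofReal (‖x‖ ^ s) ∂μ) ^ (1 - 1 / s) +
        (∫⁻ x, ENNReal.ofReal (‖x‖ ^ s) ∂ν) ^ (1 - 1 / s)) * minimalLp s μ ν := by
  have hs0 : 0 < s := zero_lt_one.trans hs
  have hexp : 0 ≤ 1 - 1 / s := sub_nonneg.2 ((div_le_one hs0).2 hs.le)
  have hμp := hμ.1.1
  have hνp := hν.1.1
  have hne : Nonempty {π : Measure (E × E) // π ∈ {π : Measure (E × E) |
      IsProbabilityMeasure π ∧ π.map Prod.fst = μ ∧ π.map Prod.snd = ν}} :=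
    ⟨μ.prod ν, inferInstance, by simp, by simp⟩
  rw [minimalLp, iInf_subtype', ENNReal.mul_iInf' (fun h _ => absurd h ?_) fun _ => hne]
  swap
  · exact (ENNReal.add_lt_top.2 ⟨ENNReal.rpow_lt_top_of_nonneg hexp hμ.1.2.ne,
      ENNReal.rpow_lt_top_of_nonneg hexp hν.1.2.ne⟩).ne
  refine iSup₂_le fun f hf => le_iInf fun ⟨π, hπ, h1, h2⟩ => ?_
  rw [min_eq_left ((div_le_one hs0).2 hs.le)]
  obtain ⟨hPμ, hPμ'⟩ := hμ.integral_taylorSeriesUpTo_sum hs0 hν₀ f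
  obtain ⟨hPν, hPν'⟩ := hν.integral_taylorSeriesUpTo_sum hs0 hν₀ f
  have hgle := abs_sub_taylorSeriesUpTo_sum_le hs hf
  have hPC : Continuous (taylorSeriesUpTo f (⌈s⌉₊ - 1)).sum :=
    contDiff_zero.1 (contDiff_taylorSeriesUpTo_sum f _)
  have hg0 : f 0 - (taylorSeriesUpTo f (⌈s⌉₊ - 1)).sum 0 = 0 := by
    have := congrArg (fun L => L 0)
      (iteratedFDeriv_taylorSeriesUpTo_sum_zero hf.1 (Nat.zero_le _))
    simp only [iteratedFDeriv_zero_apply] at this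
    rw [this, sub_self]
  set P := (taylorSeriesUpTo f (⌈s⌉₊ - 1)).sum with hP
  have hgC : Continuous fun x => f x - P x := hf.1.continuous.sub hPC
  have hgb : ∀ x, |f x - P x| ≤ 1 * (1 + ‖x‖ ^ s) := by
    intro x
    have := hgle x 0
    rw [hg0, sub_zero, sub_zero, norm_zero, Real.zero_rpow (sub_pos.2 hs).ne', add_zero,
      mul_comm, ← Real.rpow_add_one' (norm_nonneg x) (by simpa using hs0.ne'),
      sub_add_cancel] at this
    linarith
  have hgμ := hμ.1.integrable_of_le hgC 1 hgb
  have hgν := hν.1.integrable_of_le hgC 1 hgb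
  have hfeq : ∫ x, f x ∂μ - ∫ x, f x ∂ν = ∫ x, (f x - P x) ∂μ - ∫ x, (f x - P x) ∂ν := by
    have e : ∀ x, f x = (f x - P x) + P x := fun x => by ring
    have e1 : ∫ x, f x ∂μ = ∫ x, (f x - P x) ∂μ + ∫ x, P x ∂μ := by
      rw [← integral_add hgμ hPμ]; simp
    have e2 : ∫ x, f x ∂ν = ∫ x, (f x - P x) ∂ν + ∫ x, P x ∂ν := by
      rw [← integral_add hgν hPν]; simp
    rw [e1, e2, hPμ', hPν']
    ring
  rw [hfeq]
  refine (ofReal_abs_integral_sub_integral_le h1 h2 hgμ hgν).trans ?_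
  calc ∫⁻ z, ENNReal.ofReal |f z.1 - P z.1 - (f z.2 - P z.2)| ∂π
      ≤ ∫⁻ z, (ENNReal.ofReal ‖z.1 - z.2‖ * ENNReal.ofReal (‖z.1‖ ^ (s - 1)) +
          ENNReal.ofReal ‖z.1 - z.2‖ * ENNReal.ofReal (‖z.2‖ ^ (s - 1))) ∂π := by
        refine lintegral_mono fun z => ?_
        rw [← mul_add, ← ENNReal.ofReal_add (by positivity) (by positivity),
          ← ENNReal.ofReal_mul (by positivity)]
        exact ENNReal.ofReal_le_ofReal (hgle _ _)
    _ = ∫⁻ z, ENNReal.ofReal ‖z.1 - z.2‖ * ENNReal.ofReal (‖z.1‖ ^ (s - 1)) ∂π +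
          ∫⁻ z, ENNReal.ofReal ‖z.1 - z.2‖ * ENNReal.ofReal (‖z.2‖ ^ (s - 1)) ∂π :=
        lintegral_add_left (by fun_prop) _
    _ ≤ _ := by
        refine (add_le_add (lintegral_norm_mul_rpow_le hs measurable_fst)
          (lintegral_norm_mul_rpow_le hs measurable_snd)).trans (le_of_eq ?_)
        have i1 : ∫⁻ z, ENNReal.ofReal (‖z.1‖ ^ s) ∂π = ∫⁻ x, ENNReal.ofReal (‖x‖ ^ s) ∂μ := by
          rw [← h1, lintegral_map (by fun_prop) measurable_fst]
        have i2 : ∫⁻ z, ENNReal.ofReal (‖z.2‖ ^ s) ∂π = ∫⁻ x, ENNReal.ofReal (‖x‖ ^ s) ∂ν := by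
          rw [← h2, lintegral_map (by fun_prop) measurable_snd]
        rw [i1, i2]
        ring

end UpperBounds

section Duality

/-- Duality for the finite optimal transport problem. -/
lemma exists_coupling_of_forall_dual_le {S : Type*} [Fintype S] [DecidableEq S]
    (d : S → S → ℝ) {p q : S → ℝ} (hp : ∀ i, 0 ≤ p i) (hp1 : ∑ i, p i = 1) (hq : ∀ i, 0 ≤ q i)
    (hq1 : ∑ i, q i = 1) {c : ℝ}
    (h : ∀ φ ψ : S → ℝ, (∀ i j, φ i + ψ j ≤ d i j) → ∑ i, p i * φ i + ∑ j, q j * ψ j ≤ c) :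
    ∃ w : S → S → ℝ, (∀ i j, 0 ≤ w i j) ∧ (∀ i, ∑ j, w i j = p i) ∧ (∀ j, ∑ i, w i j = q j) ∧
      ∑ i, ∑ j, w i j * d i j ≤ c := by
  let A : (S × S → ℝ) →ₗ[ℝ] (S → ℝ) × (S → ℝ) × ℝ :=
    { toFun := fun w => (fun i => ∑ j, w (i, j), fun j => ∑ i, w (i, j),
        ∑ i, ∑ j, w (i, j) * d i j)
      map_add' := fun v w => by
        ext <;> simp [Finset.sum_add_distrib, add_mul]
      map_smul' := fun r w => by
        ext <;> simp [Finset.mul_sum, mul_assoc] }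
  let K : Set ((S → ℝ) × (S → ℝ) × ℝ) := A '' stdSimplex ℝ (S × S)
  let L : Set ((S → ℝ) × (S → ℝ) × ℝ) := {p} ×ˢ {q} ×ˢ Set.Iic c
  have hKconv : Convex ℝ K := (convex_stdSimplex ℝ _).linear_image A
  have hKcomp : IsCompact K := (isCompact_stdSimplex ℝ _).image A.continuous_of_finiteDimensional
  have hLconv : Convex ℝ L :=
    (convex_singleton p).prod ((convex_singleton q).prod (convex_Iic c))
  have hLclosed : IsClosed L := isClosed_singleton.prod (isClosed_singleton.prod isClosed_Iic)
  by_cases hdisj : Disjoint K L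
  swap
  · obtain ⟨_, ⟨w, hw, rfl⟩, hpw, hqw, hcw⟩ := Set.not_disjoint_iff.1 hdisj
    exact ⟨fun i j => w (i, j), fun i j => hw.1 _, fun i => congrFun hpw i,
      fun j => congrFun hqw j, hcw⟩
  exfalso
  obtain ⟨f, u, v, hfK, huv, hfL⟩ :=
    geometric_hahn_banach_compact_closed hKconv hKcomp hLconv hLclosed hdisj
  set φ : S → ℝ := fun i => f (Pi.single i 1, 0, 0) with hφ
  set ψ : S → ℝ := fun j => f (0, Pi.single j 1, 0) with hψ
  set e : ℝ := f (0, 0, 1) with he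
  have hf : ∀ (r t : S → ℝ) (a : ℝ), f (r, t, a) = ∑ i, r i * φ i + ∑ j, t j * ψ j + a * e := by
    intro r t a
    have hsing : ∀ i : S, (fun j => if i = j then (1 : ℝ) else 0) = Pi.single i 1 := fun i => by
      funext j
      simp [Pi.single_apply, eq_comm]
    have hr : f (r, 0, 0) = ∑ i, r i * φ i := by
      have := LinearMap.pi_apply_eq_sum_univ
        (f.toLinearMap ∘ₗ LinearMap.inl ℝ (S → ℝ) ((S → ℝ) × ℝ)) r
      simp only [LinearMap.comp_apply, LinearMap.inl_apply, smul_eq_mul] at this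
      refine this.trans (Finset.sum_congr rfl fun i _ => ?_)
      rw [hsing]
      rfl
    have ht : f (0, t, 0) = ∑ j, t j * ψ j := by
      have := LinearMap.pi_apply_eq_sum_univ
        (f.toLinearMap ∘ₗ LinearMap.inr ℝ (S → ℝ) ((S → ℝ) × ℝ) ∘ₗ LinearMap.inl ℝ (S → ℝ) ℝ) t
      simp only [LinearMap.comp_apply, LinearMap.inl_apply, LinearMap.inr_apply,
        smul_eq_mul] at this
      refine this.trans (Finset.sum_congr rfl fun i _ => ?_)
      rw [hsing]
      rfl
    have ha : f (0, 0, a) = a * e := by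
      rw [he, ← smul_eq_mul, ← map_smul]
      simp
    rw [← hr, ← ht, ← ha, ← map_add, ← map_add]
    simp
  have hKφ : ∀ i j, φ i + ψ j + d i j * e < u := by
    intro i j
    have hmem := hfK _ ⟨Pi.single (i, j) 1, single_mem_stdSimplex ℝ (i, j), rfl⟩
    have hA : A (Pi.single (i, j) 1) = (Pi.single i 1, Pi.single j 1, d i j) := by
      refine Prod.ext ?_ (Prod.ext ?_ ?_)
      · funext k
        by_cases hk : k = i
        · simp only [A, LinearMap.coe_mk, AddHom.coe_mk, Pi.single_apply, hk, Prod.mk.injEq,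
            true_and, Finset.sum_ite_eq', Finset.mem_univ, if_true]
        · simp [A, Pi.single_apply, hk]
      · funext k
        by_cases hk : k = j
        · simp only [A, LinearMap.coe_mk, AddHom.coe_mk, Pi.single_apply, hk, Prod.mk.injEq,
            and_true, Finset.sum_ite_eq', Finset.mem_univ, if_true]
        · simp [A, Pi.single_apply, hk]
      · simp [A, Pi.single_apply, Prod.ext_iff, ite_and]
    rw [hA, hf] at hmem
    simpa [Pi.single_apply] using hmem
  set T : ℝ := ∑ i, p i * φ i + ∑ j, q j * ψ j with hT
  have hLt : ∀ t ≤ c, u < T + t * e := by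
    intro t ht
    have := hfL (p, q, t) ⟨rfl, rfl, ht⟩
    rw [hf] at this
    exact huv.trans this
  have he0 : e ≤ 0 := by
    by_contra! hpos
    have h1 := hLt (min c ((u - T) / e)) (min_le_left _ _)
    have h2 : min c ((u - T) / e) * e ≤ (u - T) / e * e :=
      mul_le_mul_of_nonneg_right (min_le_right _ _) hpos.le
    rw [div_mul_cancel₀ _ hpos.ne'] at h2
    linarith
  rcases he0.eq_or_lt with he0 | he0
  · have hTu : T ≤ u := by
      have e1 : T = ∑ i, ∑ j, p i * q j * (φ i + ψ j) := by
        have h1 : ∀ i, ∑ j, p i * q j * (φ i + ψ j) = p i * φ i + p i * ∑ j, q j * ψ j := by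
          intro i
          rw [Finset.mul_sum]
          calc ∑ j, p i * q j * (φ i + ψ j)
              = ∑ j, (q j * (p i * φ i) + p i * (q j * ψ j)) :=
                Finset.sum_congr rfl fun j _ => by ring
            _ = _ := by rw [Finset.sum_add_distrib, ← Finset.sum_mul, hq1, one_mul]
        simp_rw [h1]
        rw [Finset.sum_add_distrib, ← Finset.sum_mul, hp1, one_mul]
      have e2 : u = ∑ i, ∑ j, p i * q j * u := by
        simp_rw [← Finset.sum_mul, ← Finset.mul_sum, hq1, mul_one, hp1, one_mul]
      rw [e1, e2]
      refine Finset.sum_le_sum fun i _ => Finset.sum_le_sum fun j _ => ?_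
      refine mul_le_mul_of_nonneg_left ?_ (mul_nonneg (hp i) (hq j))
      have := hKφ i j
      rw [he0, mul_zero, add_zero] at this
      exact this.le
    have := hLt c le_rfl
    rw [he0, mul_zero, add_zero] at this
    linarith
  · have hne : 0 < -e := neg_pos.2 he0
    have := h (fun i => (φ i - u) / (-e)) (fun j => ψ j / (-e)) fun i j => by
      rw [← add_div, div_le_iff₀ hne]
      linarith [hKφ i j]
    have e1 : ∑ i, p i * ((φ i - u) / (-e)) + ∑ j, q j * (ψ j / (-e)) = (T - u) / (-e) := by
      simp_rw [← mul_div_assoc]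
      rw [← Finset.sum_div, ← Finset.sum_div, ← add_div]
      congr 1
      simp_rw [mul_sub]
      rw [Finset.sum_sub_distrib, ← Finset.sum_mul, hp1, hT]
      ring
    rw [e1, div_le_iff₀ hne] at this
    linarith [hLt c le_rfl]

variable {E : Type*} [NormedAddCommGroup E]

lemma norm_sub_rpow_triangle {s : ℝ} (hs0 : 0 < s) (hs1 : s ≤ 1) (x y z : E) :
    ‖x - z‖ ^ s ≤ ‖x - y‖ ^ s + ‖y - z‖ ^ s :=
  (Real.rpow_le_rpow (norm_nonneg _) (norm_sub_le_norm_sub_add_norm_sub x y z) hs0.le).trans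
    (Real.rpow_add_le_add_rpow (norm_nonneg _) (norm_nonneg _) hs0.le hs1)

/-- Dual potentials of a finite transport problem for the cost `‖x - y‖ ^ s` are dominated by a
single test function. -/
lemma exists_mem_zolotarevClass_of_potentials [NormedSpace ℝ E] {s : ℝ} (hs0 : 0 < s)
    (hs1 : s ≤ 1) {S : Type*} [Fintype S] [Nonempty S] (a : S → E) (φ ψ : S → ℝ)
    (h : ∀ i j, φ i + ψ j ≤ ‖a i - a j‖ ^ s) :
    ∃ f ∈ zolotarevClass E s, (∀ i, φ i ≤ f (a i)) ∧ ∀ i, ψ i ≤ -f (a i) := by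
  set f : E → ℝ := fun x =>
    Finset.univ.inf' Finset.univ_nonempty fun j => ‖x - a j‖ ^ s - ψ j with hf
  have hle : ∀ x y, f x ≤ f y + ‖x - y‖ ^ s := by
    intro x y
    obtain ⟨j, -, hj⟩ := Finset.exists_mem_eq_inf' (Finset.univ_nonempty (α := S))
      fun j => ‖y - a j‖ ^ s - ψ j
    have h1 : f x ≤ ‖x - a j‖ ^ s - ψ j := Finset.inf'_le _ (Finset.mem_univ j)
    have h2 : f y = ‖y - a j‖ ^ s - ψ j := hj
    linarith [norm_sub_rpow_triangle hs0 hs1 x y (a j)]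
  refine ⟨f, (mem_zolotarevClass_iff_of_le_one hs1).2 ⟨?_, fun x y => ?_⟩, fun i => ?_,
    fun i => ?_⟩
  · exact Continuous.finset_inf'_apply _ fun j _ =>
      (Continuous.rpow_const (by fun_prop) fun _ => Or.inr hs0.le).sub continuous_const
  · have h1 := hle x y
    have h2 := hle y x
    rw [norm_sub_rev] at h2
    exact abs_le.2 ⟨by linarith, by linarith⟩
  · exact Finset.le_inf' _ _ fun j _ => by linarith [h i j]
  · have : f (a i) ≤ ‖a i - a i‖ ^ s - ψ i := Finset.inf'_le _ (Finset.mem_univ i)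
    rw [sub_self, norm_zero, Real.zero_rpow hs0.ne'] at this
    linarith

end Duality

section Discretization

/-- Weights coupling the discretizations of `μ` and `ν` along `t` lift to a coupling of `μ` and
`ν`. -/
lemma exists_coupling_of_fiber_weights {E S : Type*} [MeasurableSpace E] [Fintype S]
    [MeasurableSpace S] [DiscreteMeasurableSpace S] {t : E → S} (ht : Measurable t)
    (μ ν : Measure E) [IsProbabilityMeasure μ] [IsProbabilityMeasure ν] {w : S → S → ℝ}
    (hw : ∀ i j, 0 ≤ w i j) (hwμ : ∀ i, ∑ j, w i j = μ.real (t ⁻¹' {i}))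
    (hwν : ∀ j, ∑ i, w i j = ν.real (t ⁻¹' {j})) :
    ∃ π : Measure (E × E), IsProbabilityMeasure π ∧ π.map Prod.fst = μ ∧ π.map Prod.snd = ν ∧
      ∀ c : S → S → ℝ≥0∞,
        ∫⁻ z, c (t z.1) (t z.2) ∂π = ∑ i, ∑ j, ENNReal.ofReal (w i j) * c i j := by
  have hμ0 : ∀ i j, w i j ≠ 0 → μ (t ⁻¹' {i}) ≠ 0 := fun i j hij h0 => by
    have h1 := hwμ i
    rw [measureReal_def, h0, ENNReal.toReal_zero,
      Finset.sum_eq_zero_iff_of_nonneg fun j _ => hw i j] at h1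
    exact hij (h1 j (Finset.mem_univ j))
  have hν0 : ∀ i j, w i j ≠ 0 → ν (t ⁻¹' {j}) ≠ 0 := fun i j hij h0 => by
    have h1 := hwν j
    rw [measureReal_def, h0, ENNReal.toReal_zero,
      Finset.sum_eq_zero_iff_of_nonneg fun i _ => hw i j] at h1
    exact hij (h1 i (Finset.mem_univ i))
  set π : Measure (E × E) :=
    ∑ i, ∑ j, ENNReal.ofReal (w i j) • (μ[|t ← i]).prod (ν[|t ← j]) with hπ
  have hfst : π.map Prod.fst = μ := by
    ext A hA
    rw [Measure.map_apply measurable_fst hA, ← Set.prod_univ]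
    conv_rhs => rw [← sum_meas_smul_cond_fiber ht μ]
    simp only [hπ, Measure.finsetSum_apply, Measure.smul_apply, Measure.prod_prod, smul_eq_mul]
    refine Finset.sum_congr rfl fun i _ => ?_
    rw [← ofReal_measureReal (measure_ne_top μ _), ← hwμ i,
      ENNReal.ofReal_sum_of_nonneg fun j _ => hw i j, Finset.sum_mul]
    refine Finset.sum_congr rfl fun j _ => ?_
    rcases eq_or_ne (w i j) 0 with h0 | h0
    · simp [h0]
    · have := cond_isProbabilityMeasure (hν0 i j h0)
      rw [measure_univ, mul_one]
  have hsnd : π.map Prod.snd = ν := by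
    ext A hA
    rw [Measure.map_apply measurable_snd hA, ← Set.univ_prod]
    conv_rhs => rw [← sum_meas_smul_cond_fiber ht ν]
    simp only [hπ, Measure.finsetSum_apply, Measure.smul_apply, Measure.prod_prod, smul_eq_mul]
    rw [Finset.sum_comm]
    refine Finset.sum_congr rfl fun j _ => ?_
    rw [← ofReal_measureReal (measure_ne_top ν _), ← hwν j,
      ENNReal.ofReal_sum_of_nonneg fun i _ => hw i j, Finset.sum_mul]
    refine Finset.sum_congr rfl fun i _ => ?_
    rcases eq_or_ne (w i j) 0 with h0 | h0
    · simp [h0]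
    · have := cond_isProbabilityMeasure (hμ0 i j h0)
      rw [measure_univ, one_mul]
  refine ⟨π, ⟨?_⟩, hfst, hsnd, fun c => ?_⟩
  · rw [← Set.preimage_univ (f := Prod.fst), ← Measure.map_apply measurable_fst .univ, hfst,
      measure_univ]
  · rw [hπ]
    simp only [lintegral_finsetSum_measure, lintegral_smul_measure, smul_eq_mul]
    refine Finset.sum_congr rfl fun i _ => Finset.sum_congr rfl fun j _ => ?_
    rcases eq_or_ne (w i j) 0 with h0 | h0
    · simp [h0]
    have hμi := cond_isProbabilityMeasure (hμ0 i j h0)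
    have hνj := cond_isProbabilityMeasure (hν0 i j h0)
    congr 1
    have h1 : ∀ᵐ z ∂(μ[|t ← i]).prod (ν[|t ← j]), t z.1 = i :=
      Measure.quasiMeasurePreserving_fst.ae (ae_cond_mem (ht (measurableSet_singleton i)))
    have h2 : ∀ᵐ z ∂(μ[|t ← i]).prod (ν[|t ← j]), t z.2 = j :=
      Measure.quasiMeasurePreserving_snd.ae (ae_cond_mem (ht (measurableSet_singleton j)))
    rw [lintegral_congr_ae (g := fun _ => c i j) (by
      filter_upwards [h1, h2] with z hz1 hz2
      rw [hz1, hz2])]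
    simp

lemma integral_fiber_eq_sum {E S : Type*} [MeasurableSpace E] [Fintype S] [MeasurableSpace S]
    [DiscreteMeasurableSpace S] {t : E → S} (ht : Measurable t) (μ : Measure E)
    [IsFiniteMeasure μ] (g : S → ℝ) :
    ∫ x, g (t x) ∂μ = ∑ i, μ.real (t ⁻¹' {i}) * g i := by
  have hg : Measurable g := .of_discrete
  rw [← integral_map ht.aemeasurable hg.aestronglyMeasurable, integral_fintype .of_finite]
  refine Finset.sum_congr rfl fun i _ => ?_
  rw [map_measureReal_apply ht (measurableSet_singleton i), smul_eq_mul]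

variable {E : Type*} [NormedAddCommGroup E] [NormedSpace ℝ E] [MeasurableSpace E] [BorelSpace E]
  [SecondCountableTopology E]

omit [SecondCountableTopology E] in
lemma abs_integral_simpleFunc_sub_integral_le {s : ℝ} (hs1 : s ≤ 1) {μ : Measure E}
    (hμ : MemMs s μ) (T : SimpleFunc E E) {ε : ℝ} (hε : 0 ≤ ε)
    (hT : ∫⁻ x, ENNReal.ofReal (‖x - T x‖ ^ s) ∂μ ≤ ENNReal.ofReal ε)
    {f : E → ℝ} (hf : f ∈ zolotarevClass E s) :
    |∫ x, f (T x) ∂μ - ∫ x, f x ∂μ| ≤ ε := by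
  have := hμ.1
  have hfT : Integrable (fun x => f (T x)) μ := (T.map f).integrable_of_isFiniteMeasure
  rw [← integral_sub hfT (hμ.integrable_of_mem_zolotarevClass hs1 hf),
    ← ENNReal.ofReal_le_ofReal_iff hε]
  refine (ofReal_abs_integral_le_lintegral _ _).trans (le_trans (lintegral_mono fun x => ?_) hT)
  rw [abs_sub_comm]
  exact ENNReal.ofReal_le_ofReal (((mem_zolotarevClass_iff_of_le_one hs1).1 hf).2 _ _)

lemma minimalLp_le_of_simpleFunc {s : ℝ} (hs0 : 0 < s) (hs1 : s ≤ 1) {μ ν : Measure E}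
    (hμ : MemMs s μ) (hν : MemMs s ν) (T : SimpleFunc E E) {ε : ℝ} (hε : 0 ≤ ε)
    (hTμ : ∫⁻ x, ENNReal.ofReal (‖x - T x‖ ^ s) ∂μ ≤ ENNReal.ofReal ε)
    (hTν : ∫⁻ x, ENNReal.ofReal (‖x - T x‖ ^ s) ∂ν ≤ ENNReal.ofReal ε) {C : ℝ}
    (hC : ∀ f ∈ zolotarevClass E s, ∫ x, f x ∂μ - ∫ x, f x ∂ν ≤ C) :
    minimalLp s μ ν ≤ ENNReal.ofReal (C + 4 * ε) := by
  classical
  have := hμ.1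
  have := hν.1
  let S := {y // y ∈ T.range}
  let : MeasurableSpace S := ⊤
  have : DiscreteMeasurableSpace S := ⟨fun _ => trivial⟩
  let t : E → S := fun x => ⟨T x, T.mem_range_self x⟩
  have ht : Measurable t := measurable_to_countable' fun i => by
    have : t ⁻¹' {i} = T ⁻¹' {i.1} := by
      ext x
      exact Subtype.ext_iff
    rw [this]
    exact T.measurableSet_fiber _
  have : Nonempty S := ⟨t 0⟩
  let d : S → S → ℝ := fun i j => ‖i.1 - j.1‖ ^ s
  have hsum : ∀ (ρ : Measure E) [IsProbabilityMeasure ρ], ∑ i, ρ.real (t ⁻¹' {i}) = 1 := by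
    intro ρ _
    simpa using (integral_fiber_eq_sum ht ρ fun _ => (1 : ℝ)).symm
  obtain ⟨w, hw, hwμ, hwν, hwd⟩ := exists_coupling_of_forall_dual_le d
    (p := fun i => μ.real (t ⁻¹' {i})) (q := fun i => ν.real (t ⁻¹' {i})) (c := C + 2 * ε)
    (fun _ => measureReal_nonneg) (hsum μ) (fun _ => measureReal_nonneg) (hsum ν)
    fun φ ψ h => by
      obtain ⟨f, hf, hφ, hψ⟩ := exists_mem_zolotarevClass_of_potentials hs0 hs1
        (fun i : S => i.1) φ ψ h
      have h1 : ∑ i, μ.real (t ⁻¹' {i}) * φ i ≤ ∫ x, f (T x) ∂μ := by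
        rw [show ∫ x, f (T x) ∂μ = _ from integral_fiber_eq_sum ht μ fun i : S => f i.1]
        exact Finset.sum_le_sum fun i _ => mul_le_mul_of_nonneg_left (hφ i) measureReal_nonneg
      have h2 : ∑ i, ν.real (t ⁻¹' {i}) * ψ i ≤ -∫ x, f (T x) ∂ν := by
        rw [← integral_neg,
          show ∫ x, -f (T x) ∂ν = _ from integral_fiber_eq_sum ht ν fun i : S => -f i.1]
        exact Finset.sum_le_sum fun i _ => mul_le_mul_of_nonneg_left (hψ i) measureReal_nonneg
      have h3 := (abs_le.1 (abs_integral_simpleFunc_sub_integral_le hs1 hμ T hε hTμ hf)).2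
      have h4 := (abs_le.1 (abs_integral_simpleFunc_sub_integral_le hs1 hν T hε hTν hf)).1
      linarith [hC f hf]
  obtain ⟨π, hπ, hπμ, hπν, hπc⟩ := exists_coupling_of_fiber_weights ht μ ν hw hwμ hwν
  have hmin : min (1 / s) 1 = 1 := min_eq_right ((one_le_div hs0).2 hs1)
  refine (iInf₂_le π ⟨hπ, hπμ, hπν⟩).trans ?_
  rw [hmin, ENNReal.rpow_one]
  have hmeas : Measurable fun x => ENNReal.ofReal (‖x - T x‖ ^ s) :=
    (((measurable_id.sub T.measurable).norm).pow_const s).ennreal_ofReal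
  have hsumd : 0 ≤ ∑ i, ∑ j, w i j * d i j :=
    Finset.sum_nonneg fun i _ => Finset.sum_nonneg fun j _ =>
      mul_nonneg (hw i j) (Real.rpow_nonneg (norm_nonneg _) _)
  calc ∫⁻ z, ENNReal.ofReal (‖z.1 - z.2‖ ^ s) ∂π
      ≤ ∫⁻ z, (ENNReal.ofReal (‖z.1 - T z.1‖ ^ s) + ENNReal.ofReal (d (t z.1) (t z.2))
          + ENNReal.ofReal (‖z.2 - T z.2‖ ^ s)) ∂π := by
        refine lintegral_mono fun z => ?_
        have h0 : ∀ x : E, 0 ≤ ‖x‖ ^ s := fun x => Real.rpow_nonneg (norm_nonneg _) _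
        rw [← ENNReal.ofReal_add (h0 _) (h0 _), ← ENNReal.ofReal_add (add_nonneg (h0 _) (h0 _))
          (h0 _)]
        refine ENNReal.ofReal_le_ofReal ?_
        have h1 := norm_sub_rpow_triangle hs0 hs1 z.1 (T z.1) z.2
        have h2 := norm_sub_rpow_triangle hs0 hs1 (T z.1) (T z.2) z.2
        rw [norm_sub_rev (T z.2) z.2] at h2
        change _ ≤ _ + ‖T z.1 - T z.2‖ ^ s + _
        linarith
    _ = ∫⁻ x, ENNReal.ofReal (‖x - T x‖ ^ s) ∂μ
          + ∫⁻ z, ENNReal.ofReal (d (t z.1) (t z.2)) ∂π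
          + ∫⁻ x, ENNReal.ofReal (‖x - T x‖ ^ s) ∂ν := by
        have h1 : Measurable fun z : E × E => ENNReal.ofReal (‖z.1 - T z.1‖ ^ s) :=
          hmeas.comp measurable_fst
        have h2 : Measurable fun z : E × E => ENNReal.ofReal (‖z.2 - T z.2‖ ^ s) :=
          hmeas.comp measurable_snd
        rw [lintegral_add_right _ h2, lintegral_add_left h1]
        conv_rhs => rw [← hπν, lintegral_map hmeas measurable_snd]
        conv_rhs => enter [1, 1]; rw [← hπμ, lintegral_map hmeas measurable_fst]
    _ ≤ ENNReal.ofReal ε + ENNReal.ofReal (C + 2 * ε) + ENNReal.ofReal ε := by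
        gcongr
        rw [hπc fun i j => ENNReal.ofReal (d i j)]
        refine le_trans (le_of_eq ?_) (ENNReal.ofReal_le_ofReal hwd)
        rw [ENNReal.ofReal_sum_of_nonneg fun i _ => Finset.sum_nonneg fun j _ =>
          mul_nonneg (hw i j) (Real.rpow_nonneg (norm_nonneg _) _)]
        refine Finset.sum_congr rfl fun i _ => ?_
        rw [ENNReal.ofReal_sum_of_nonneg fun j _ =>
          mul_nonneg (hw i j) (Real.rpow_nonneg (norm_nonneg _) _)]
        exact Finset.sum_congr rfl fun j _ => (ENNReal.ofReal_mul (hw i j)).symm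
    _ = ENNReal.ofReal (C + 4 * ε) := by
        have hCε : 0 ≤ C + 2 * ε := hsumd.trans hwd
        rw [← ENNReal.ofReal_add hε hCε, ← ENNReal.ofReal_add (by positivity) hε]
        congr 1
        ring

lemma tendsto_lintegral_approxOn_sub {s : ℝ} (hs0 : 0 < s) {μ : Measure E} (hμ : MemMs s μ) :
    Tendsto (fun n => ∫⁻ x, ENNReal.ofReal (‖x - SimpleFunc.approxOn id measurable_id Set.univ
      (0 : E) trivial n x‖ ^ s) ∂μ) atTop (𝓝 0) := by
  have h := tendsto_lintegral_of_dominated_convergence (μ := μ)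
    (F := fun n x => ENNReal.ofReal (‖x - SimpleFunc.approxOn id measurable_id Set.univ
      (0 : E) trivial n x‖ ^ s)) (f := fun _ => 0)
    (fun x => ENNReal.ofReal (‖x‖ ^ s)) (fun n => ?_) (fun n => .of_forall fun x => ?_)
    hμ.2.ne (.of_forall fun x => ?_)
  · simpa using h
  · exact (((measurable_id.sub (SimpleFunc.measurable _)).norm).pow_const s).ennreal_ofReal
  · refine ENNReal.ofReal_le_ofReal (Real.rpow_le_rpow (norm_nonneg _) ?_ hs0.le)
    have := SimpleFunc.edist_approxOn_le measurable_id (s := Set.univ) (y₀ := (0 : E)) trivial x n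
    rw [edist_dist, edist_dist, ENNReal.ofReal_le_ofReal_iff dist_nonneg, dist_comm,
      dist_comm (0 : E), dist_eq_norm, dist_zero_right] at this
    exact this
  · have h1 := SimpleFunc.tendsto_approxOn measurable_id (s := Set.univ) (y₀ := (0 : E)) trivial
      (x := x) (by simp)
    have h2 : Continuous fun y : E => ENNReal.ofReal (‖x - y‖ ^ s) :=
      ENNReal.continuous_ofReal.comp
        ((continuous_const.sub continuous_id).norm.rpow_const fun _ => Or.inr hs0.le)
    simpa [Real.zero_rpow hs0.ne', Function.comp_def] using (h2.tendsto _).comp h1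

lemma minimalLp_le_zolotarevDist_of_le_one {s : ℝ} (hs0 : 0 < s) (hs1 : s ≤ 1)
    {μ ν : Measure E} (hμ : MemMs s μ) (hν : MemMs s ν) :
    minimalLp s μ ν ≤ zolotarevDist s μ ν := by
  refine ENNReal.le_of_forall_pos_le_add fun ε hε hfin => ?_
  have hε4 : 0 < (ε : ℝ) / 4 := by positivity
  have hpos : (0 : ℝ≥0∞) < ENNReal.ofReal (ε / 4) := ENNReal.ofReal_pos.2 hε4
  obtain ⟨n, hnμ, hnν⟩ :=
    (((tendsto_lintegral_approxOn_sub hs0 hμ).eventually (ge_mem_nhds hpos)).and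
      ((tendsto_lintegral_approxOn_sub hs0 hν).eventually (ge_mem_nhds hpos))).exists
  refine (minimalLp_le_of_simpleFunc hs0 hs1 hμ hν _ hε4.le hnμ hnν
    (C := (zolotarevDist s μ ν).toReal) fun f hf => ?_).trans (le_of_eq ?_)
  · refine (le_abs_self _).trans ((ENNReal.ofReal_le_iff_le_toReal hfin.ne).1 ?_)
    exact le_iSup₂ (f := fun f (_ : f ∈ zolotarevClass E s) =>
      ENNReal.ofReal |∫ x, f x ∂μ - ∫ x, f x ∂ν|) f hf
  · rw [mul_div_cancel₀ _ (by norm_num : (4 : ℝ) ≠ 0),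
      ENNReal.ofReal_add ENNReal.toReal_nonneg ε.coe_nonneg, ENNReal.ofReal_toReal hfin.ne,
      ENNReal.ofReal_coe_nnreal]

end Discretization

theorem zolotarev_le_minimalLp
    {Ω B : Type*} [MeasurableSpace Ω]
    [NormedAddCommGroup B] [NormedSpace ℝ B] [MeasurableSpace B] [BorelSpace B]
    [SecondCountableTopology B] [CompleteSpace B]
    (P : Measure Ω) [IsProbabilityMeasure P]
    (s : ℝ) (hs : 0 < s) (ν : Measure B) (hν : MemMs s ν)
    (X Y : Ω → B) (hX : Measurable X) (hY : Measurable Y)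
    (hXν : MemMsOf s ν (P.map X)) (hYν : MemMsOf s ν (P.map Y)) :
    (s ≤ 1 →
      zolotarevDist s (P.map X) (P.map Y) = minimalLp s (P.map X) (P.map Y)) ∧
    (1 < s →
      zolotarevDist s (P.map X) (P.map Y)
        ≤ ENNReal.ofReal ((∫ ω, ‖X ω‖ ^ s ∂P) ^ (1 - 1/s) + (∫ ω, ‖Y ω‖ ^ s ∂P) ^ (1 - 1/s))
          * minimalLp s (P.map X) (P.map Y)) := by
  constructor
  · intro hs1
    exact le_antisymm (zolotarevDist_le_minimalLp_of_le_one hs hs1 hXν.1 hYν.1)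
      (minimalLp_le_zolotarevDist_of_le_one hs hs1 hXν.1 hYν.1)
  · intro hs1
    refine (zolotarevDist_le_of_one_lt hs1 hν.1 hXν hYν).trans (le_of_eq ?_)
    have hexp : 0 ≤ 1 - 1 / s := sub_nonneg.2 ((div_le_one hs).2 hs1.le)
    have h0 : ∀ x : B, 0 ≤ ‖x‖ ^ s := fun x => Real.rpow_nonneg (norm_nonneg _) _
    have hmom : ∀ Z : Ω → B, Measurable Z → MemMs s (P.map Z) →
        (∫⁻ x, ENNReal.ofReal (‖x‖ ^ s) ∂(P.map Z)) ^ (1 - 1 / s)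
          = ENNReal.ofReal ((∫ ω, ‖Z ω‖ ^ s ∂P) ^ (1 - 1 / s)) := by
      intro Z hZ hmem
      have hint := hmem.integrable_norm_rpow
      rw [← ENNReal.ofReal_rpow_of_nonneg (integral_nonneg fun ω => h0 _) hexp,
        ← integral_map (f := fun x : B => ‖x‖ ^ s) hZ.aemeasurable hint.aestronglyMeasurable,
        ofReal_integral_eq_lintegral_ofReal hint (.of_forall h0)]
    rw [hmom X hX hXν.1, hmom Y hY hYν.1, ENNReal.ofReal_add
      (Real.rpow_nonneg (integral_nonneg fun ω => h0 _) _)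
      (Real.rpow_nonneg (integral_nonneg fun ω => h0 _) _)]

end
end

section
/- Let X = (X(t))_{t∈[0,1]} and Y = (Y(t))_{t∈[0,1]} be random variables in C[0,1] with the uniform norm, s > 0, with ζ_s(X, Y) < ∞. Then for every k ≥ 1 and all 0 ≤ t_1 ≤ … ≤ t_k ≤ 1, the finite-dimensional marginals satisfy ζ_s((X(t_1), …, X(t_k)), (Y(t_1), …, Y(t_k))) ≤ k^{s/2} · ζ_s(X, Y), where on the left ζ_s is the Zolotarev distance on ℝ^k with the Euclidean norm. -/
open MeasureTheory ProbabilityTheory Filter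
open scoped ENNReal NNReal Topology unitInterval

noncomputable section

/-- The space `C[0,1]` of continuous functions on the unit interval with the uniform norm. -/
abbrev C01 := C(unitInterval, ℝ)

instance : MeasurableSpace C01 := borel _
instance : BorelSpace C01 := ⟨rfl⟩

/-- `C_r[0,1]`: continuous functions on `[0,1]` that are piecewise linear with respect to a
decomposition of `[0,1]` into intervals of length at least `r`. -/
def PiecewiseLinear (r : ℝ) (f : C01) : Prop :=
  ∃ (ℓ : ℕ) (t : ℕ → ℝ), 0 < ℓ ∧ t 0 = 0 ∧ t ℓ = 1 ∧
    (∀ i < ℓ, t i < t (i + 1)) ∧ (∀ i < ℓ, r ≤ t (i + 1) - t i) ∧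
    (∀ i < ℓ, ∃ a c : ℝ, ∀ x : unitInterval,
      t i ≤ (x : ℝ) → (x : ℝ) ≤ t (i + 1) → f x = a * (x : ℝ) + c)

/-- Convergence in distribution (weak convergence of the laws), tested against bounded
continuous functions. -/
def TendstoInDistribution {Ω E : Type*} [MeasurableSpace Ω] [TopologicalSpace E]
    (P : Measure Ω) (X : ℕ → Ω → E) (Y : Ω → E) : Prop :=
  ∀ f : BoundedContinuousFunction E ℝ,
    Tendsto (fun n => ∫ ω, f (X n ω) ∂P) atTop (𝓝 (∫ ω, f (Y ω) ∂P))

/-- Composing a test function of order `s` with a continuous linear map of norm at most `K` and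
dividing by `K ^ s` gives a test function of order `s`. -/
theorem zolotarevClass_smul_comp {E F : Type*} [NormedAddCommGroup E] [NormedSpace ℝ E]
    [NormedAddCommGroup F] [NormedSpace ℝ F] {s : ℝ} (hs : 0 < s) {K : ℝ} (hK : 0 < K)
    (L : E →L[ℝ] F) (hL : ∀ x, ‖L x‖ ≤ K * ‖x‖) {f : F → ℝ} (hf : f ∈ zolotarevClass F s) :
    (K ^ s)⁻¹ • (f ∘ L) ∈ zolotarevClass E s := by
  obtain ⟨hc, hd⟩ := hf
  set m := ⌈s⌉₊ - 1
  have hms : (m : ℝ) ≤ s := by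
    have h1 : 0 < ⌈s⌉₊ := Nat.ceil_pos.mpr hs
    exact (Nat.lt_ceil.mp (by omega)).le
  have hcL : ContDiff ℝ (m : ℕ) (f ∘ L) := hc.comp L.contDiff
  refine ⟨hcL.const_smul (K ^ s)⁻¹, fun x y => ?_⟩
  have hLK : ‖L‖ ≤ K := L.opNorm_le_bound hK.le hL
  have hDx : ∀ z, iteratedFDeriv ℝ m ((K ^ s)⁻¹ • (f ∘ L)) z =
      (K ^ s)⁻¹ • (iteratedFDeriv ℝ m f (L z)).compContinuousLinearMap fun _ => L := fun z => by
    rw [iteratedFDeriv_const_smul_apply hcL.contDiffAt,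
      L.iteratedFDeriv_comp_right hc z le_rfl]
  have hsub : iteratedFDeriv ℝ m ((K ^ s)⁻¹ • (f ∘ L)) x -
      iteratedFDeriv ℝ m ((K ^ s)⁻¹ • (f ∘ L)) y =
      (K ^ s)⁻¹ • (iteratedFDeriv ℝ m f (L x) -
        iteratedFDeriv ℝ m f (L y)).compContinuousLinearMap fun _ => L := by
    rw [hDx, hDx, ← smul_sub]
    rfl
  have hKs : 0 < K ^ s := Real.rpow_pos_of_pos hK s
  rw [hsub, norm_smul, Real.norm_of_nonneg (inv_nonneg.mpr hKs.le), inv_mul_le_iff₀ hKs]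
  calc _ ≤ ‖iteratedFDeriv ℝ m f (L x) - iteratedFDeriv ℝ m f (L y)‖ * ∏ _i : Fin m, ‖L‖ :=
        ContinuousMultilinearMap.norm_compContinuousLinearMap_le _ _
    _ ≤ (K * ‖x - y‖) ^ (s - m) * K ^ m := by
        rw [Finset.prod_const, Finset.card_univ, Fintype.card_fin]
        gcongr
        refine (hd _ _).trans ?_
        rw [← map_sub]
        exact Real.rpow_le_rpow (norm_nonneg _) (hL _) (sub_nonneg.mpr hms)
    _ = K ^ s * ‖x - y‖ ^ (s - m) := by
        rw [Real.mul_rpow hK.le (norm_nonneg _), mul_right_comm, ← Real.rpow_natCast K m,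
          ← Real.rpow_add hK, sub_add_cancel]

/-- The Zolotarev distance of order `s` grows at most by the factor `K ^ s` under a continuous
linear map of norm at most `K`. -/
theorem zolotarevDist_map_le {E F : Type*} [NormedAddCommGroup E] [NormedSpace ℝ E]
    [MeasurableSpace E] [OpensMeasurableSpace E] [NormedAddCommGroup F] [NormedSpace ℝ F]
    [MeasurableSpace F] [BorelSpace F] [SecondCountableTopology F] {s : ℝ} (hs : 0 < s) {K : ℝ}
    (hK : 0 < K) (L : E →L[ℝ] F) (hL : ∀ x, ‖L x‖ ≤ K * ‖x‖) (μ ν : Measure E) :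
    zolotarevDist s (μ.map L) (ν.map L) ≤ ENNReal.ofReal (K ^ s) * zolotarevDist s μ ν := by
  refine iSup₂_le fun f hf => ?_
  have hKs : 0 < K ^ s := Real.rpow_pos_of_pos hK s
  have hLm : Measurable L := L.continuous.measurable
  have hmap : ∀ ρ : Measure E, ∫ x, f x ∂(ρ.map L) =
      K ^ s * ∫ x, ((K ^ s)⁻¹ • (f ∘ L)) x ∂ρ := fun ρ => by
    rw [integral_map hLm.aemeasurable hf.1.continuous.aestronglyMeasurable]
    simp only [Pi.smul_apply, Function.comp_apply, smul_eq_mul]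
    rw [integral_const_mul, mul_inv_cancel_left₀ hKs.ne']
  rw [hmap, hmap, ← mul_sub, abs_mul, abs_of_pos hKs, ENNReal.ofReal_mul hKs.le]
  gcongr
  exact le_iSup₂_of_le _ (zolotarevClass_smul_comp hs hK L hL hf) le_rfl

/-- Evaluation of a continuous function on `[0,1]` at finitely many points, as a continuous linear
map into Euclidean space. -/
def evalEuclidean {k : ℕ} (t : Fin k → unitInterval) : C01 →L[ℝ] EuclideanSpace ℝ (Fin k) :=
  (EuclideanSpace.equiv (Fin k) ℝ).symm.toContinuousLinearMap.comp
    (ContinuousLinearMap.pi fun i => ContinuousMap.evalCLM ℝ (t i))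

theorem norm_evalEuclidean_le {k : ℕ} (t : Fin k → unitInterval) (f : C01) :
    ‖evalEuclidean t f‖ ≤ √k * ‖f‖ := by
  rw [EuclideanSpace.norm_eq, ← Real.sqrt_sq (norm_nonneg f), ← Real.sqrt_mul (Nat.cast_nonneg k)]
  refine Real.sqrt_le_sqrt ?_
  calc ∑ i, ‖evalEuclidean t f i‖ ^ 2 ≤ ∑ _i : Fin k, ‖f‖ ^ 2 := by
        gcongr with i
        exact f.norm_coe_le_norm (t i)
    _ = k * ‖f‖ ^ 2 := by simp

theorem zolotarev_fdd_le
    {Ω : Type*} [MeasurableSpace Ω] (P : Measure Ω) [IsProbabilityMeasure P]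
    (s : ℝ) (hs : 0 < s)
    (X Y : Ω → C01) (hX : Measurable X) (hY : Measurable Y)
    (hfin : zolotarevDist s (P.map X) (P.map Y) < ∞)
    (k : ℕ) (hk : 1 ≤ k) (t : Fin k → unitInterval) (ht : Monotone t) :
    zolotarevDist s
      (P.map (fun ω => (WithLp.equiv 2 (Fin k → ℝ)).symm (fun i => X ω (t i))))
      (P.map (fun ω => (WithLp.equiv 2 (Fin k → ℝ)).symm (fun i => Y ω (t i))))
      ≤ ENNReal.ofReal ((k : ℝ) ^ (s / 2)) * zolotarevDist s (P.map X) (P.map Y) := by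
  have hL : Measurable (evalEuclidean t) := (evalEuclidean t).continuous.measurable
  have hk0 : (0 : ℝ) < k := by exact_mod_cast hk
  have h := zolotarevDist_map_le hs (Real.sqrt_pos.mpr hk0) (evalEuclidean t)
    (norm_evalEuclidean_le t) (P.map X) (P.map Y)
  rw [Measure.map_map hL hX, Measure.map_map hL hY, Real.sqrt_eq_rpow,
    ← Real.rpow_mul hk0.le, one_div_mul_eq_div] at h
  exact h

end
end

section
/- Let X_n (n ≥ 1) and X be random variables in C[0,1] with the uniform norm and s > 0, and suppose ζ_s(X_n, X) → 0 as n → ∞. Then: (i) all finite-dimensional marginal distributions of X_n converge weakly to those of X; (ii) for every t ∈ [0,1], X_n(t) converges in distribution to X(t) and E[|X_n(t)|^s] → E[|X(t)|^s]; (iii) for every random variable Z with values in [0,1] independent of (X_n)_{n≥1} and of X, X_n(Z) converges in distribution to X(Z) and E[|X_n(Z)|^s] → E[|X(Z)|^s]; (iv) the law of X is the only possible accumulation point of (L(X_n))_{n≥1} in the weak topology. -/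
open MeasureTheory ProbabilityTheory Filter
open scoped ENNReal NNReal Topology unitInterval

noncomputable section

/-- Scalar functions with `m` derivatives, the last of which is `α`-Hölder. -/
def ScalarHolder (α : ℝ) : ℕ → (ℝ → ℝ) → Prop
  | 0, φ => ∃ C : ℝ, ∀ x y, |φ x - φ y| ≤ C * |x - y| ^ α
  | m + 1, φ => ∃ φ' : ℝ → ℝ, (∀ x, HasDerivAt φ (φ' x) x) ∧ ScalarHolder α m φ'

/-- `C^m` functions between normed spaces whose `m`-th derivative is `α`-Hölder. -/
def HolderDeriv {E F : Type*} [NormedAddCommGroup E] [NormedSpace ℝ E]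
    [NormedAddCommGroup F] [NormedSpace ℝ F] (m : ℕ) (α : ℝ) (f : E → F) : Prop :=
  ContDiff ℝ m f ∧ ∃ C : ℝ, ∀ x y,
    ‖iteratedFDeriv ℝ m f x - iteratedFDeriv ℝ m f y‖ ≤ C * ‖x - y‖ ^ α

namespace ScalarHolder

variable {α : ℝ} {m : ℕ} {φ : ℝ → ℝ}

lemma const_mul (h : ScalarHolder α m φ) (c : ℝ) : ScalarHolder α m (fun x => c * φ x) := by
  induction m generalizing φ with
  | zero =>
    obtain ⟨C, hC⟩ := h
    refine ⟨|c| * C, fun x y => ?_⟩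
    rw [← mul_sub, abs_mul, mul_assoc]
    exact mul_le_mul_of_nonneg_left (hC x y) (abs_nonneg c)
  | succ m ih =>
    obtain ⟨φ', hd, h'⟩ := h
    exact ⟨fun x => c * φ' x, fun x => (hd x).const_mul c, ih h'⟩

lemma continuous (hα : 0 < α) (h : ScalarHolder α m φ) : Continuous φ := by
  cases m with
  | zero =>
    obtain ⟨C, hC⟩ := h
    refine continuous_iff_continuousAt.2 fun x => ?_
    rw [ContinuousAt, tendsto_iff_norm_sub_tendsto_zero]
    refine squeeze_zero (fun _ => norm_nonneg _) (fun y => hC y x) ?_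
    have : Continuous fun y : ℝ => C * |y - x| ^ α :=
      continuous_const.mul
        ((continuous_abs.comp (continuous_id.sub continuous_const)).rpow_const
          fun _ => Or.inr hα.le)
    simpa [hα.ne'] using this.tendsto x
  | succ m =>
    obtain ⟨φ', hd, -⟩ := h
    exact continuous_iff_continuousAt.2 fun x => (hd x).continuousAt

lemma of_bounded_lipschitz (hα : 0 < α) (hα1 : α ≤ 1) (hb : ∀ x y, |φ x - φ y| ≤ 2)
    (hl : ∀ x y, |φ x - φ y| ≤ |x - y|) : ScalarHolder α 0 φ := by
  refine ⟨2, fun x y => ?_⟩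
  rcases le_total |x - y| 1 with h | h
  · have h1 : |x - y| ^ (1 : ℝ) ≤ |x - y| ^ α :=
      Real.rpow_le_rpow_of_exponent_ge' (abs_nonneg _) h hα.le hα1
    rw [Real.rpow_one] at h1
    linarith [hl x y, abs_nonneg (x - y)]
  · have h1 : (1 : ℝ) ≤ |x - y| ^ α := Real.one_le_rpow h hα.le
    linarith [hb x y]

lemma cos_sin (hα : 0 < α) (hα1 : α ≤ 1) (m : ℕ) :
    ScalarHolder α m Real.cos ∧ ScalarHolder α m Real.sin := by
  induction m with
  | zero =>
    refine ⟨of_bounded_lipschitz hα hα1 (fun x y => ?_) fun x y => ?_,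
      of_bounded_lipschitz hα hα1 (fun x y => ?_) fun x y => ?_⟩
    · rw [abs_le]
      constructor <;>
      linarith [Real.cos_le_one x, Real.neg_one_le_cos x, Real.cos_le_one y,
        Real.neg_one_le_cos y]
    · exact Real.abs_cos_sub_cos_le x y
    · rw [abs_le]
      constructor <;>
      linarith [Real.sin_le_one x, Real.neg_one_le_sin x, Real.sin_le_one y,
        Real.neg_one_le_sin y]
    · exact Real.abs_sin_sub_sin_le x y
  | succ m ih =>
    refine ⟨⟨fun x => (-1) * Real.sin x, fun x => ?_, ih.2.const_mul _⟩,
      ⟨Real.cos, Real.hasDerivAt_sin, ih.1⟩⟩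
    simpa using Real.hasDerivAt_cos x

end ScalarHolder

lemma abs_abs_rpow_sub_abs_rpow_le {α : ℝ} (hα : 0 < α) (hα1 : α ≤ 1) (x y : ℝ) :
    |(|x| ^ α - |y| ^ α)| ≤ |x - y| ^ α := by
  have key : ∀ a b : ℝ, |a| ^ α ≤ |b| ^ α + |a - b| ^ α := fun a b =>
    calc |a| ^ α ≤ (|b| + |a - b|) ^ α := by
          refine Real.rpow_le_rpow (abs_nonneg _) ?_ hα.le
          have := abs_add_le b (a - b)
          simpa using this
      _ ≤ _ := Real.rpow_add_le_add_rpow (abs_nonneg _) (abs_nonneg _) hα.le hα1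
  rw [abs_le]
  constructor
  · have := key y x
    rw [abs_sub_comm y x] at this
    linarith
  · linarith [key x y]

lemma mul_abs_rpow_sub_one_of_nonneg {s x : ℝ} (hs : 0 < s) (hx : 0 ≤ x) :
    x * |x| ^ (s - 1) = |x| ^ s := by
  rcases hx.eq_or_lt with rfl | h
  · simp [hs.ne']
  · rw [abs_of_pos h, Real.rpow_sub_one h.ne']
    field_simp

lemma mul_abs_rpow_sub_one_of_nonpos {s x : ℝ} (hs : 0 < s) (hx : x ≤ 0) :
    x * |x| ^ (s - 1) = -|x| ^ s := by
  have := mul_abs_rpow_sub_one_of_nonneg hs (neg_nonneg.2 hx)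
  rw [abs_neg] at this
  linarith

lemma abs_mul_abs_rpow_sub_le {α : ℝ} (hα : 0 < α) (hα1 : α ≤ 1) (x y : ℝ) :
    |x * |x| ^ (α - 1) - y * |y| ^ (α - 1)| ≤ 2 * |x - y| ^ α := by
  have h0 : 0 ≤ |x - y| ^ α := Real.rpow_nonneg (abs_nonneg _) _
  have hd := abs_le.1 (abs_abs_rpow_sub_abs_rpow_le hα hα1 x y)
  have hx0 : 0 ≤ |x| ^ α := Real.rpow_nonneg (abs_nonneg _) _
  have hy0 : 0 ≤ |y| ^ α := Real.rpow_nonneg (abs_nonneg _) _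
  have hmono : |x| ≤ |x - y| → |y| ≤ |x - y| →
      |x| ^ α ≤ |x - y| ^ α ∧ |y| ^ α ≤ |x - y| ^ α := fun h1 h2 =>
    ⟨Real.rpow_le_rpow (abs_nonneg _) h1 hα.le, Real.rpow_le_rpow (abs_nonneg _) h2 hα.le⟩
  rw [abs_le]
  rcases le_total 0 x with hx | hx <;> rcases le_total 0 y with hy | hy
  · rw [mul_abs_rpow_sub_one_of_nonneg hα hx, mul_abs_rpow_sub_one_of_nonneg hα hy]
    constructor <;> linarith
  · rw [mul_abs_rpow_sub_one_of_nonneg hα hx, mul_abs_rpow_sub_one_of_nonpos hα hy]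
    obtain ⟨h1, h2⟩ := hmono
      (by rw [abs_of_nonneg hx, abs_of_nonneg (by linarith : 0 ≤ x - y)]; linarith)
      (by rw [abs_of_nonpos hy, abs_of_nonneg (by linarith : 0 ≤ x - y)]; linarith)
    constructor <;> linarith
  · rw [mul_abs_rpow_sub_one_of_nonpos hα hx, mul_abs_rpow_sub_one_of_nonneg hα hy]
    obtain ⟨h1, h2⟩ := hmono
      (by rw [abs_of_nonpos hx, abs_of_nonpos (by linarith : x - y ≤ 0)]; linarith)
      (by rw [abs_of_nonneg hy, abs_of_nonpos (by linarith : x - y ≤ 0)]; linarith)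
    constructor <;> linarith
  · rw [mul_abs_rpow_sub_one_of_nonpos hα hx, mul_abs_rpow_sub_one_of_nonpos hα hy]
    constructor <;> linarith

lemma hasDerivAt_mul_abs_rpow {s : ℝ} (hs : 1 < s) (x : ℝ) :
    HasDerivAt (fun x : ℝ => x * |x| ^ (s - 1)) (s * |x| ^ (s - 1)) x := by
  rcases eq_or_ne x 0 with rfl | hx
  · rw [hasDerivAt_iff_tendsto_slope_zero]
    have hc : Continuous fun t : ℝ => |t| ^ (s - 1) :=
      continuous_abs.rpow_const fun _ => Or.inr (by linarith)
    have h0 : Tendsto (fun t : ℝ => |t| ^ (s - 1)) (𝓝[≠] 0) (𝓝 (s * |0| ^ (s - 1))) := by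
      have := (hc.tendsto 0).mono_left (nhdsWithin_le_nhds (s := {0}ᶜ))
      simpa [(by linarith : s - 1 ≠ 0)] using this
    refine h0.congr' ?_
    filter_upwards [self_mem_nhdsWithin] with t ht
    have ht : t ≠ 0 := ht
    simp [ht]
  · have h1 := (hasDerivAt_abs hx).rpow_const (p := s - 1) (Or.inl (abs_ne_zero.2 hx))
    refine ((hasDerivAt_id x).mul h1).congr_deriv ?_
    have hsx : x * (SignType.sign x : ℝ) = |x| := by
      rw [mul_comm]; exact sign_mul_self x
    have h2 : |x| ^ (s - 1) = |x| ^ (s - 1 - 1) * |x| := by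
      rw [Real.rpow_sub_one (abs_ne_zero.2 hx) (s - 1)]
      field_simp
    rw [id, show x * ((SignType.sign x : ℝ) * (s - 1) * |x| ^ (s - 1 - 1))
      = (s - 1) * (|x| ^ (s - 1 - 1) * (x * (SignType.sign x : ℝ))) by ring, hsx, ← h2]
    ring

lemma ScalarHolder.abs_rpow (m : ℕ) {α : ℝ} (hα : 0 < α) (hα1 : α ≤ 1) :
    ScalarHolder α m (fun x => |x| ^ (m + α)) ∧
      ScalarHolder α m (fun x => x * |x| ^ (m + α - 1)) := by
  induction m with
  | zero =>
    simp only [Nat.cast_zero, zero_add]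
    exact ⟨⟨1, fun x y => by simpa using abs_abs_rpow_sub_abs_rpow_le hα hα1 x y⟩,
      ⟨2, fun x y => abs_mul_abs_rpow_sub_le hα hα1 x y⟩⟩
  | succ m ih =>
    have hs : 1 < ((m + 1 : ℕ) : ℝ) + α := by push_cast; linarith [Nat.cast_nonneg (α := ℝ) m]
    have e : (m : ℝ) + α = ((m + 1 : ℕ) : ℝ) + α - 1 := by push_cast; ring
    rw [e] at ih
    refine ⟨⟨_, fun x => ?_, ih.2.const_mul (((m + 1 : ℕ) : ℝ) + α)⟩,
      ⟨_, fun x => hasDerivAt_mul_abs_rpow hs x, ih.1.const_mul _⟩⟩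
    have := hasDerivAt_abs_rpow x hs
    convert this using 1
    rw [show ((m + 1 : ℕ) : ℝ) + α - 1 - 1 = ((m + 1 : ℕ) : ℝ) + α - 2 by ring]
    ring

namespace HolderDeriv

variable {E F G : Type*} [NormedAddCommGroup E] [NormedSpace ℝ E] [NormedAddCommGroup F]
  [NormedSpace ℝ F] [NormedAddCommGroup G] [NormedSpace ℝ G] {m : ℕ} {α : ℝ}

lemma clm_comp {f : E → F} (hf : HolderDeriv m α f) (g : F →L[ℝ] G) :
    HolderDeriv m α (g ∘ f) := by
  obtain ⟨hd, C, hC⟩ := hf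
  refine ⟨g.contDiff.comp hd, ‖g‖ * C, fun x y => ?_⟩
  rw [g.iteratedFDeriv_comp_left hd.contDiffAt le_rfl,
    g.iteratedFDeriv_comp_left hd.contDiffAt le_rfl]
  have : g.compContinuousMultilinearMap (iteratedFDeriv ℝ m f x)
      - g.compContinuousMultilinearMap (iteratedFDeriv ℝ m f y)
      = g.compContinuousMultilinearMap
        (iteratedFDeriv ℝ m f x - iteratedFDeriv ℝ m f y) := by
    ext v; simp
  rw [this, mul_assoc]
  exact (g.norm_compContinuousMultilinearMap_le _).trans
    (mul_le_mul_of_nonneg_left (hC x y) (norm_nonneg _))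

lemma comp_clm {f : F → G} (hf : HolderDeriv m α f) (hα : 0 < α) (g : E →L[ℝ] F) :
    HolderDeriv m α (f ∘ g) := by
  obtain ⟨hd, C, hC⟩ := hf
  refine ⟨hd.comp g.contDiff, max C 0 * ‖g‖ ^ α * ‖g‖ ^ m, fun x y => ?_⟩
  rw [g.iteratedFDeriv_comp_right hd x le_rfl, g.iteratedFDeriv_comp_right hd y le_rfl]
  have : (iteratedFDeriv ℝ m f (g x)).compContinuousLinearMap (fun _ => g)
      - (iteratedFDeriv ℝ m f (g y)).compContinuousLinearMap (fun _ => g)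
      = (iteratedFDeriv ℝ m f (g x) - iteratedFDeriv ℝ m f (g y)).compContinuousLinearMap
        (fun _ => g) := by
    ext v; simp
  rw [this]
  refine (ContinuousMultilinearMap.norm_compContinuousLinearMap_le _ _).trans ?_
  rw [Finset.prod_const, Finset.card_univ, Fintype.card_fin]
  have h1 : ‖g x - g y‖ ^ α ≤ ‖g‖ ^ α * ‖x - y‖ ^ α := by
    rw [← Real.mul_rpow (norm_nonneg _) (norm_nonneg _), ← map_sub]
    exact Real.rpow_le_rpow (norm_nonneg _) (g.le_opNorm _) hα.le
  calc ‖iteratedFDeriv ℝ m f (g x) - iteratedFDeriv ℝ m f (g y)‖ * ‖g‖ ^ m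
      ≤ (max C 0 * (‖g‖ ^ α * ‖x - y‖ ^ α)) * ‖g‖ ^ m := by
        refine mul_le_mul_of_nonneg_right ((hC _ _).trans ?_) (by positivity)
        exact mul_le_mul (le_max_left _ _) h1 (by positivity) (le_max_right _ _)
    _ = _ := by ring

lemma of_hasFDerivAt {f : E → F} {f' : E → E →L[ℝ] F} (hd : ∀ x, HasFDerivAt f (f' x) x)
    (h' : HolderDeriv m α f') : HolderDeriv (m + 1) α f := by
  obtain ⟨hc, C, hC⟩ := h'
  refine ⟨?_, C, fun x y => ?_⟩
  · exact_mod_cast contDiff_succ_iff_hasFDerivAt.2 ⟨f', hc, hd⟩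
  · have e : (fun y => fderiv ℝ f y) = f' := funext fun x => (hd x).fderiv
    rw [iteratedFDeriv_succ_eq_comp_right, iteratedFDeriv_succ_eq_comp_right, e]
    refine le_trans (le_of_eq ?_) (hC x y)
    exact ((continuousMultilinearCurryRightEquiv' ℝ m E F).symm.toLinearIsometry.map_sub
      _ _ ▸ (continuousMultilinearCurryRightEquiv' ℝ m E F).symm.norm_map _)

lemma of_norm_sub_le {f : E → F} (hf : Continuous f) {C : ℝ}
    (hC : ∀ x y, ‖f x - f y‖ ≤ C * ‖x - y‖ ^ α) : HolderDeriv 0 α f := by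
  refine ⟨contDiff_zero.2 hf, C, fun x y => ?_⟩
  rw [iteratedFDeriv_zero_eq_comp (𝕜 := ℝ), Function.comp_apply, Function.comp_apply, ← map_sub,
    LinearIsometryEquiv.norm_map]
  exact hC x y

end HolderDeriv

section Postcomp

variable {K : Type*} [TopologicalSpace K] [CompactSpace K]

lemma hasFDerivAt_postcomp {φ φ' : C(ℝ, ℝ)} (hd : ∀ x, HasDerivAt φ (φ' x) x) (x : C(K, ℝ)) :
    HasFDerivAt (fun y : C(K, ℝ) => φ.comp y)
      (ContinuousLinearMap.mul ℝ C(K, ℝ) (φ'.comp x)) x := by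
  rw [hasFDerivAt_iff_isLittleO_nhds_zero, Asymptotics.isLittleO_iff]
  intro ε hε
  have hcont := (φ'.continuous_postcomp (X := K)).tendsto x
  obtain ⟨δ, hδ, hball⟩ := Metric.tendsto_nhds_nhds.1 hcont ε hε
  filter_upwards [Metric.ball_mem_nhds (0 : C(K, ℝ)) hδ] with h hh
  rw [mem_ball_zero_iff] at hh
  rw [ContinuousMap.norm_le _ (by positivity)]
  intro t
  have hht : |h t| ≤ ‖h‖ := h.norm_coe_le_norm t
  have hder : ∀ u ∈ Set.uIcc (x t) (x t + h t),
      HasDerivWithinAt (fun u => φ u - φ' (x t) * u) (φ' u - φ' (x t))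
        (Set.uIcc (x t) (x t + h t)) u := fun u _ => by
    have h1 := ((hd u).sub ((hasDerivAt_id u).const_mul (φ' (x t)))).hasDerivWithinAt
      (s := Set.uIcc (x t) (x t + h t))
    rw [mul_one] at h1
    exact h1
  have hbd : ∀ u ∈ Set.uIcc (x t) (x t + h t), ‖φ' u - φ' (x t)‖ ≤ ε := fun u hu => by
    have hu' : |u - x t| ≤ |h t| := by
      simpa using Set.abs_sub_left_of_mem_uIcc hu
    have hlt : dist (x + ContinuousMap.const K (u - x t)) x < δ := by
      rw [dist_eq_norm, add_sub_cancel_left]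
      refine lt_of_le_of_lt ?_ hh
      rw [ContinuousMap.norm_le _ (norm_nonneg _)]
      intro _
      exact hu'.trans hht
    have h1 := (hball hlt).le
    rw [dist_eq_norm, ContinuousMap.norm_le _ hε.le] at h1
    simpa using h1 t
  have := Convex.norm_image_sub_le_of_norm_hasDerivWithin_le hder hbd (convex_uIcc _ _)
    Set.left_mem_uIcc Set.right_mem_uIcc
  calc ‖(φ.comp (x + h) - φ.comp x
          - ContinuousLinearMap.mul ℝ C(K, ℝ) (φ'.comp x) h) t‖
      = ‖φ (x t + h t) - φ' (x t) * (x t + h t) - (φ (x t) - φ' (x t) * x t)‖ := by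
        simp only [ContinuousMap.sub_apply, ContinuousMap.comp_apply, ContinuousMap.add_apply,
          ContinuousLinearMap.mul_apply', ContinuousMap.mul_apply]
        congr 1; ring
    _ ≤ ε * ‖x t + h t - x t‖ := this
    _ ≤ ε * ‖h‖ := by
        rw [add_sub_cancel_left]
        exact mul_le_mul_of_nonneg_left hht hε.le

lemma ScalarHolder.postcomp {α : ℝ} (hα : 0 < α) {m : ℕ} {φ : C(ℝ, ℝ)}
    (h : ScalarHolder α m φ) : HolderDeriv m α (fun x : C(K, ℝ) => φ.comp x) := by
  induction m generalizing φ with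
  | zero =>
    obtain ⟨C, hC⟩ := h
    refine HolderDeriv.of_norm_sub_le (C := max C 0) φ.continuous_postcomp fun x y => ?_
    rw [ContinuousMap.norm_le _ (by positivity)]
    intro t
    refine (hC (x t) (y t)).trans ?_
    refine mul_le_mul (le_max_left _ _) ?_ (Real.rpow_nonneg (abs_nonneg _) _) (le_max_right _ _)
    exact Real.rpow_le_rpow (abs_nonneg _) ((x - y).norm_coe_le_norm t) hα.le
  | succ m ih =>
    obtain ⟨φ', hd, h'⟩ := h
    let ψ : C(ℝ, ℝ) := ⟨φ', h'.continuous hα⟩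
    let M : C(K, ℝ) →L[ℝ] C(K, ℝ) →L[ℝ] C(K, ℝ) := ContinuousLinearMap.mul ℝ C(K, ℝ)
    have hM : HolderDeriv m α (M ∘ fun x : C(K, ℝ) => ψ.comp x) := 
      HolderDeriv.clm_comp (G := C(K, ℝ) →L[ℝ] C(K, ℝ)) (ih (φ := ψ) h') M
    exact HolderDeriv.of_hasFDerivAt (fun x => hasFDerivAt_postcomp (φ' := ψ) hd x) hM

end Postcomp

lemma HolderDeriv.exists_smul_mem_zolotarevClass {E : Type*} [NormedAddCommGroup E]
    [NormedSpace ℝ E] {s : ℝ} {f : E → ℝ}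
    (hf : HolderDeriv (⌈s⌉₊ - 1) (s - (⌈s⌉₊ - 1 : ℕ)) f) :
    ∃ c : ℝ, 0 < c ∧ (fun x => c * f x) ∈ zolotarevClass E s := by
  obtain ⟨hd, C, hC⟩ := hf
  have hp : 0 < max C 1 := lt_of_lt_of_le one_pos (le_max_right _ _)
  refine ⟨(max C 1)⁻¹, inv_pos.2 hp, contDiff_const.mul hd, fun x y => ?_⟩
  have e : ∀ z, iteratedFDeriv ℝ (⌈s⌉₊ - 1) (fun x => (max C 1)⁻¹ * f x) z
      = (max C 1)⁻¹ • iteratedFDeriv ℝ (⌈s⌉₊ - 1) f z := fun z =>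
    iteratedFDeriv_const_smul_apply (a := (max C 1)⁻¹) (x := z) hd.contDiffAt
  rw [e, e, ← smul_sub, norm_smul, norm_inv, Real.norm_of_nonneg hp.le, inv_mul_le_iff₀ hp]
  exact (hC x y).trans (mul_le_mul_of_nonneg_right (le_max_left _ _)
    (Real.rpow_nonneg (norm_nonneg _) _))

lemma tendsto_integral_of_zolotarevDist {E : Type*} [NormedAddCommGroup E] [NormedSpace ℝ E]
    [MeasurableSpace E] {s : ℝ} {μ : ℕ → Measure E} {ν : Measure E}
    (h : Tendsto (fun n => zolotarevDist s (μ n) ν) atTop (𝓝 0)) {f : E → ℝ}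
    (hf : HolderDeriv (⌈s⌉₊ - 1) (s - (⌈s⌉₊ - 1 : ℕ)) f) :
    Tendsto (fun n => ∫ x, f x ∂(μ n)) atTop (𝓝 (∫ x, f x ∂ν)) := by
  obtain ⟨c, hc, hmem⟩ := hf.exists_smul_mem_zolotarevClass
  have h1 : Tendsto (fun n => ENNReal.ofReal |∫ x, c * f x ∂(μ n) - ∫ x, c * f x ∂ν|) atTop
      (𝓝 0) :=
    tendsto_of_tendsto_of_tendsto_of_le_of_le tendsto_const_nhds h (fun _ => zero_le)
      fun n => le_iSup₂ (f := fun (g : E → ℝ) (_ : g ∈ zolotarevClass E s) =>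
        ENNReal.ofReal |∫ x, g x ∂(μ n) - ∫ x, g x ∂ν|) _ hmem
  have h2 := (ENNReal.tendsto_toReal ENNReal.zero_ne_top).comp h1
  simp only [Function.comp_def, ENNReal.toReal_ofReal (abs_nonneg _), ENNReal.toReal_zero] at h2
  simp only [integral_const_mul, ← mul_sub, abs_mul, abs_of_pos hc] at h2
  have h3 := h2.const_mul c⁻¹
  simp only [mul_zero, inv_mul_cancel_left₀ hc.ne'] at h3
  exact tendsto_iff_norm_sub_tendsto_zero.2 h3

lemma zolotarev_exponent_mem {s : ℝ} (hs : 0 < s) :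
    0 < s - (⌈s⌉₊ - 1 : ℕ) ∧ s - (⌈s⌉₊ - 1 : ℕ) ≤ 1 := by
  have h1 : 1 ≤ ⌈s⌉₊ := Nat.one_le_ceil_iff.2 hs
  have h2 := Nat.le_ceil s
  have h3 := Nat.ceil_lt_add_one hs.le
  rw [Nat.cast_sub h1, Nat.cast_one]
  constructor <;> linarith

lemma tendsto_integral_comp_of_scalarHolder {E : Type*} [NormedAddCommGroup E] [NormedSpace ℝ E]
    [MeasurableSpace E] {s : ℝ} (hs : 0 < s) {μ : ℕ → Measure E} {ν : Measure E}
    (h : Tendsto (fun n => zolotarevDist s (μ n) ν) atTop (𝓝 0)) (L : StrongDual ℝ E)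
    {φ : ℝ → ℝ} (hφ : ScalarHolder (s - (⌈s⌉₊ - 1 : ℕ)) (⌈s⌉₊ - 1) φ) :
    Tendsto (fun n => ∫ x, φ (L x) ∂(μ n)) atTop (𝓝 (∫ x, φ (L x) ∂ν)) := by
  have hα := (zolotarev_exponent_mem hs).1
  let T : ℝ →L[ℝ] C(Unit, ℝ) := Algebra.linearMap ℝ C(Unit, ℝ) |>.toContinuousLinearMap
  have hT : ∀ a, T a () = a := fun a => by simp [T]
  have := (((ScalarHolder.postcomp (K := Unit) hα (φ := ⟨φ, hφ.continuous hα⟩) hφ).clm_comp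
    (ContinuousMap.evalCLM ℝ ())).comp_clm hα (T ∘L L))
  have e : ((ContinuousMap.evalCLM ℝ () ∘
      fun x : C(Unit, ℝ) => (⟨φ, hφ.continuous hα⟩ : C(ℝ, ℝ)).comp x) ∘ (T ∘L L))
      = fun x => φ (L x) := by
    funext x
    change φ (T (L x) ()) = _
    rw [hT]
  exact tendsto_integral_of_zolotarevDist h (e ▸ this)

lemma charFunDual_eq_integral_cos_add_integral_sin {E : Type*} [NormedAddCommGroup E]
    [NormedSpace ℝ E] [MeasurableSpace E] [OpensMeasurableSpace E] (μ : Measure E)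
    [IsFiniteMeasure μ] (L : StrongDual ℝ E) :
    charFunDual μ L
      = ((∫ x, Real.cos (L x) ∂μ : ℝ) : ℂ) + ((∫ x, Real.sin (L x) ∂μ : ℝ) : ℂ) * Complex.I := by
  have hc : Integrable (fun x => Real.cos (L x)) μ :=
    Integrable.of_bound (C := 1)
      (Real.continuous_cos.measurable.comp L.continuous.measurable).aestronglyMeasurable
      (.of_forall fun x => Real.abs_cos_le_one _)
  have hs : Integrable (fun x => Real.sin (L x)) μ :=
    Integrable.of_bound (C := 1)
      (Real.continuous_sin.measurable.comp L.continuous.measurable).aestronglyMeasurable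
      (.of_forall fun x => Real.abs_sin_le_one _)
  rw [charFunDual_apply, ← integral_complex_ofReal, ← integral_complex_ofReal, ← integral_mul_const,
    ← integral_add hc.ofReal (hs.ofReal.mul_const _)]
  refine integral_congr_ae (.of_forall fun x => ?_)
  simp [Complex.exp_mul_I]

lemma tendsto_charFunDual_of_zolotarevDist {E : Type*} [NormedAddCommGroup E] [NormedSpace ℝ E]
    [MeasurableSpace E] [OpensMeasurableSpace E] {s : ℝ} (hs : 0 < s) {μ : ℕ → Measure E}
    {ν : Measure E} [∀ n, IsFiniteMeasure (μ n)] [IsFiniteMeasure ν]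
    (h : Tendsto (fun n => zolotarevDist s (μ n) ν) atTop (𝓝 0)) (L : StrongDual ℝ E) :
    Tendsto (fun n => charFunDual (μ n) L) atTop (𝓝 (charFunDual ν L)) := by
  obtain ⟨hα, hα1⟩ := zolotarev_exponent_mem hs
  obtain ⟨hc, hsn⟩ := ScalarHolder.cos_sin hα hα1 (⌈s⌉₊ - 1)
  simp only [charFunDual_eq_integral_cos_add_integral_sin]
  exact ((Complex.continuous_ofReal.tendsto _).comp
    (tendsto_integral_comp_of_scalarHolder hs h L hc)).add
    (((Complex.continuous_ofReal.tendsto _).comp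
      (tendsto_integral_comp_of_scalarHolder hs h L hsn)).mul_const _)

lemma tendstoInDistribution_clm_of_zolotarevDist {Ω E G : Type*} [MeasurableSpace Ω]
    {P : Measure Ω} [IsProbabilityMeasure P] [NormedAddCommGroup E] [NormedSpace ℝ E]
    [MeasurableSpace E] [BorelSpace E] [NormedAddCommGroup G] [InnerProductSpace ℝ G]
    [FiniteDimensional ℝ G] {s : ℝ} (hs : 0 < s) {X : ℕ → Ω → E} {Y : Ω → E}
    (hX : ∀ n, Measurable (X n)) (hY : Measurable Y)
    (h : Tendsto (fun n => zolotarevDist s (P.map (X n)) (P.map Y)) atTop (𝓝 0))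
    (T : E →L[ℝ] G) :
    _root_.TendstoInDistribution P (fun n ω => T (X n ω)) (fun ω => T (Y ω)) := by
  borelize G
  have hprob : ∀ Z : Ω → E, Measurable Z → IsProbabilityMeasure ((P.map Z).map T) :=
    fun Z hZ => by
      rw [Measure.map_map T.continuous.measurable hZ]
      exact Measure.isProbabilityMeasure_map (T.continuous.measurable.comp hZ).aemeasurable
  have hprobX : ∀ n, IsProbabilityMeasure (P.map (X n)) := fun n =>
    Measure.isProbabilityMeasure_map (hX n).aemeasurable
  have hprobY : IsProbabilityMeasure (P.map Y) := Measure.isProbabilityMeasure_map hY.aemeasurable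
  let μ : ℕ → ProbabilityMeasure G := fun n => ⟨(P.map (X n)).map T, hprob _ (hX n)⟩
  let ν : ProbabilityMeasure G := ⟨(P.map Y).map T, hprob _ hY⟩
  have hμν : Tendsto μ atTop (𝓝 ν) := by
    refine ProbabilityMeasure.tendsto_of_tendsto_charFun fun t => ?_
    simp only [charFun_eq_charFunDual_toDualMap, μ, ν, ProbabilityMeasure.coe_mk, charFunDual_map]
    exact tendsto_charFunDual_of_zolotarevDist hs h _
  intro f
  have hf := ProbabilityMeasure.tendsto_iff_forall_integral_tendsto.1 hμν f
  have e : ∀ Z : Ω → E, Measurable Z → ∫ x, f x ∂((P.map Z).map T) = ∫ ω, f (T (Z ω)) ∂P :=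
    fun Z hZ => by
      rw [Measure.map_map T.continuous.measurable hZ,
        integral_map (T.continuous.measurable.comp hZ).aemeasurable
          f.continuous.measurable.aestronglyMeasurable]
      rfl
  simpa only [μ, ν, ProbabilityMeasure.coe_mk, e _ hY, e _ (hX _)] using hf

lemma TendstoInDistribution.comp_continuous {Ω E F : Type*} [MeasurableSpace Ω]
    [TopologicalSpace E] [TopologicalSpace F] {P : Measure Ω} {X : ℕ → Ω → E} {Y : Ω → E}
    (h : _root_.TendstoInDistribution P X Y) {g : E → F} (hg : Continuous g) :
    _root_.TendstoInDistribution P (fun n ω => g (X n ω)) (fun ω => g (Y ω)) :=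
  fun f => h (f.compContinuous ⟨g, hg⟩)

lemma tendstoInDistribution_marginals {Ω : Type*} [MeasurableSpace Ω]
    {P : Measure Ω} [IsProbabilityMeasure P] {s : ℝ} (hs : 0 < s) {X : ℕ → Ω → C01} {Y : Ω → C01}
    (hX : ∀ n, Measurable (X n)) (hY : Measurable Y)
    (h : Tendsto (fun n => zolotarevDist s (P.map (X n)) (P.map Y)) atTop (𝓝 0))
    (k : ℕ) (t : Fin k → unitInterval) :
    _root_.TendstoInDistribution P (fun n ω => fun i => X n ω (t i))
      (fun ω => fun i => Y ω (t i)) := by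
  let T : C01 →L[ℝ] EuclideanSpace ℝ (Fin k) :=
    (EuclideanSpace.equiv (Fin k) ℝ).symm.toContinuousLinearMap ∘L
      ContinuousLinearMap.pi fun i => ContinuousMap.evalCLM ℝ (t i)
  exact (tendstoInDistribution_clm_of_zolotarevDist hs hX hY h T).comp_continuous
    (EuclideanSpace.equiv (Fin k) ℝ).continuous

lemma continuous_swap_eval : Continuous fun p : unitInterval × C01 => p.2 p.1 := by
  fun_prop

lemma integral_eval_independent {Ω : Type*} [MeasurableSpace Ω]
    {P : Measure Ω} [IsProbabilityMeasure P] {X : Ω → C01} (hX : Measurable X)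
    {Z : Ω → unitInterval} (hZ : Measurable Z) (hind : IndepFun Z X P)
    {g : ℝ → ℝ} (hg : Continuous g) :
    ∫ ω, g (X ω (Z ω)) ∂P = ∫ p, g (p.2 p.1) ∂((P.map Z).prod (P.map X)) := by
  rw [← (indepFun_iff_map_prod_eq_prod_map_map hZ.aemeasurable hX.aemeasurable).1 hind,
    integral_map (f := fun p : unitInterval × C01 => g (p.2 p.1)) (hZ.prodMk hX).aemeasurable
      (hg.comp continuous_swap_eval).measurable.aestronglyMeasurable]

/-- Fubini for evaluation at a random time; when the integrand is not integrable both sides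
vanish. -/
lemma integral_prod_eval_of_nonneg {ρ : Measure unitInterval} [IsProbabilityMeasure ρ]
    {μ : Measure C01} [IsProbabilityMeasure μ] {g : ℝ → ℝ} (hg : Continuous g)
    (hg0 : ∀ x, 0 ≤ g x) :
    ∫ p, g (p.2 p.1) ∂(ρ.prod μ) = ∫ x, ∫ z, g (x z) ∂ρ ∂μ := by
  have hm : AEStronglyMeasurable (fun p : unitInterval × C01 => g (p.2 p.1)) (ρ.prod μ) :=
    (hg.comp continuous_swap_eval).measurable.aestronglyMeasurable
  by_cases hi : Integrable (fun p : unitInterval × C01 => g (p.2 p.1)) (ρ.prod μ)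
  · exact integral_prod_symm _ hi
  · rw [integral_undef hi, integral_undef]
    refine fun h => hi ((integrable_prod_iff' hm).2 ⟨.of_forall fun x => ?_, ?_⟩)
    · exact (hg.comp x.continuous).integrable_of_hasCompactSupport
        (HasCompactSupport.of_compactSpace _)
    · simpa only [Real.norm_of_nonneg (hg0 _)] using h

/-- Integration against a finite measure, as a continuous linear functional on `C(K, ℝ)`. -/
def ContinuousMap.integralCLM {K : Type*} [TopologicalSpace K] [CompactSpace K]
    [MeasurableSpace K] [BorelSpace K] (ρ : Measure K) [IsFiniteMeasure ρ] : C(K, ℝ) →L[ℝ] ℝ :=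
  LinearMap.mkContinuous
    { toFun := fun f => ∫ z, f z ∂ρ
      map_add' := fun f g => integral_add
        (f.continuous.integrable_of_hasCompactSupport (.of_compactSpace _))
        (g.continuous.integrable_of_hasCompactSupport (.of_compactSpace _))
      map_smul' := fun c f => integral_const_mul c _ }
    (ρ.real Set.univ) fun f => by
      rw [mul_comm]
      exact norm_integral_le_of_norm_le_const (.of_forall fun z => f.norm_coe_le_norm z)

lemma tendsto_integral_abs_rpow_eval {s : ℝ} (hs : 0 < s) {μ : ℕ → Measure C01}
    {ν : Measure C01} (h : Tendsto (fun n => zolotarevDist s (μ n) ν) atTop (𝓝 0))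
    (ρ : Measure unitInterval) [IsFiniteMeasure ρ] :
    Tendsto (fun n => ∫ x, ∫ z, |x z| ^ s ∂ρ ∂(μ n)) atTop (𝓝 (∫ x, ∫ z, |x z| ^ s ∂ρ ∂ν)) := by
  obtain ⟨hα, hα1⟩ := zolotarev_exponent_mem hs
  have hφ := (ScalarHolder.abs_rpow (⌈s⌉₊ - 1) hα hα1).1
  rw [add_sub_cancel] at hφ
  exact tendsto_integral_of_zolotarevDist h
    ((ScalarHolder.postcomp (K := unitInterval) hα (φ := ⟨_, hφ.continuous hα⟩) hφ).clm_comp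
      (ContinuousMap.integralCLM ρ))

lemma tendstoInDistribution_eval_independent {Ω : Type*} [MeasurableSpace Ω]
    {P : Measure Ω} [IsProbabilityMeasure P] {X : ℕ → Ω → C01} {Y : Ω → C01}
    (hX : ∀ n, Measurable (X n)) (hY : Measurable Y)
    (hXY : ∀ t : unitInterval, _root_.TendstoInDistribution P (fun n ω => X n ω t) (fun ω => Y ω t))
    {Z : Ω → unitInterval} (hZ : Measurable Z) (hindX : ∀ n, IndepFun Z (X n) P)
    (hindY : IndepFun Z Y P) :
    _root_.TendstoInDistribution P (fun n ω => X n ω (Z ω)) (fun ω => Y ω (Z ω)) := by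
  intro f
  have hρ : IsProbabilityMeasure (P.map Z) := Measure.isProbabilityMeasure_map hZ.aemeasurable
  have key : ∀ W : Ω → C01, Measurable W → IndepFun Z W P →
      ∫ ω, f (W ω (Z ω)) ∂P = ∫ z, ∫ ω, f (W ω z) ∂P ∂(P.map Z) := fun W hW hind => by
    have hμ : IsProbabilityMeasure (P.map W) := Measure.isProbabilityMeasure_map hW.aemeasurable
    rw [integral_eval_independent hW hZ hind f.continuous, integral_prod]
    · refine integral_congr_ae (.of_forall fun z => ?_)
      exact integral_map hW.aemeasurable
        (f.continuous.comp (continuous_eval_const (F := C01) z)).measurable.aestronglyMeasurable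
    · exact Integrable.of_bound (C := ‖f‖)
        (f.continuous.comp continuous_swap_eval).measurable.aestronglyMeasurable
        (.of_forall fun p => f.norm_coe_le_norm _)
  simp only [key _ (hX _) (hindX _), key _ hY hindY]
  refine tendsto_integral_of_dominated_convergence (fun _ => ‖f‖) (fun n => ?_)
    (integrable_const _) (fun n => .of_forall fun z => ?_) (.of_forall fun z => hXY z f)
  · have hm : Measurable fun p : unitInterval × Ω => f (X n p.2 p.1) :=
      (f.continuous.comp continuous_swap_eval).measurable.comp
        (measurable_fst.prodMk ((hX n).comp measurable_snd))
    exact hm.stronglyMeasurable.integral_prod_right'.aestronglyMeasurable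
  · simpa using norm_integral_le_of_norm_le_const (μ := P)
      (.of_forall fun ω => f.norm_coe_le_norm (X n ω z))

lemma eq_of_tendsto_integral_of_zolotarevDist {E : Type*} [NormedAddCommGroup E]
    [NormedSpace ℝ E] [CompleteSpace E] [SecondCountableTopology E] [MeasurableSpace E]
    [BorelSpace E] {s : ℝ} (hs : 0 < s) {μ : ℕ → Measure E} {ν ν' : Measure E}
    [∀ n, IsFiniteMeasure (μ n)] [IsFiniteMeasure ν] [IsFiniteMeasure ν']
    (h : Tendsto (fun n => zolotarevDist s (μ n) ν) atTop (𝓝 0))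
    (h' : ∀ f : BoundedContinuousFunction E ℝ,
      Tendsto (fun n => ∫ x, f x ∂(μ n)) atTop (𝓝 (∫ x, f x ∂ν'))) :
    ν' = ν := by
  refine Measure.ext_of_charFunDual (funext fun L => ?_)
  refine tendsto_nhds_unique ?_ (tendsto_charFunDual_of_zolotarevDist hs h L)
  simp only [charFunDual_eq_integral_cos_add_integral_sin]
  have hc := h' (.ofNormedAddCommGroup (fun x => Real.cos (L x))
    (Real.continuous_cos.comp L.continuous) 1 fun x => Real.abs_cos_le_one _)
  have hsn := h' (.ofNormedAddCommGroup (fun x => Real.sin (L x))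
    (Real.continuous_sin.comp L.continuous) 1 fun x => Real.abs_sin_le_one _)
  exact ((Complex.continuous_ofReal.tendsto _).comp hc).add
    (((Complex.continuous_ofReal.tendsto _).comp hsn).mul_const _)

theorem zolotarev_convergence_consequences
    {Ω : Type*} [MeasurableSpace Ω] (P : Measure Ω) [IsProbabilityMeasure P]
    (s : ℝ) (hs : 0 < s)
    (X : ℕ → Ω → C01) (Y : Ω → C01)
    (hX : ∀ n, Measurable (X n)) (hY : Measurable Y)
    (h : Tendsto (fun n => zolotarevDist s (P.map (X n)) (P.map Y)) atTop (𝓝 0)) :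
    -- (i) convergence of all finite-dimensional marginal distributions
    (∀ (k : ℕ) (t : Fin k → unitInterval),
      TendstoInDistribution P (fun n ω => fun i => X n ω (t i)) (fun ω => fun i => Y ω (t i))) ∧
    -- (ii) one-dimensional convergence together with convergence of absolute moments
    (∀ t : unitInterval,
      TendstoInDistribution P (fun n ω => X n ω t) (fun ω => Y ω t) ∧
      Tendsto (fun n => ∫ ω, |X n ω t| ^ s ∂P) atTop (𝓝 (∫ ω, |Y ω t| ^ s ∂P))) ∧
    -- (iii) evaluation at an independent random time
    (∀ Z : Ω → unitInterval, Measurable Z →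
      IndepFun Z (fun ω => ((fun n => X n ω), Y ω)) P →
      TendstoInDistribution P (fun n ω => X n ω (Z ω)) (fun ω => Y ω (Z ω)) ∧
      Tendsto (fun n => ∫ ω, |X n ω (Z ω)| ^ s ∂P) atTop (𝓝 (∫ ω, |Y ω (Z ω)| ^ s ∂P))) ∧
    -- (iv) the law of `Y` is the only weak accumulation point of the laws of the `X n`
    (∀ μ : Measure C01, IsProbabilityMeasure μ →
      ∀ φ : ℕ → ℕ, StrictMono φ →
      (∀ f : BoundedContinuousFunction C01 ℝ,
        Tendsto (fun n => ∫ x, f x ∂(P.map (X (φ n)))) atTop (𝓝 (∫ x, f x ∂μ))) →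
      μ = P.map Y) := by
  have hpX : ∀ n, IsProbabilityMeasure (P.map (X n)) := fun n =>
    Measure.isProbabilityMeasure_map (hX n).aemeasurable
  have hpY : IsProbabilityMeasure (P.map Y) := Measure.isProbabilityMeasure_map hY.aemeasurable
  have hcont : Continuous fun x : ℝ => |x| ^ s := continuous_abs.rpow_const fun _ => Or.inr hs.le
  have hmarg := tendstoInDistribution_marginals hs hX hY h
  have heval : ∀ t : unitInterval,
      _root_.TendstoInDistribution P (fun n ω => X n ω t) (fun ω => Y ω t) := fun t =>
    (hmarg 1 fun _ => t).comp_continuous (continuous_apply 0)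
  refine ⟨hmarg, fun t => ⟨heval t, ?_⟩, fun Z hZ hind => ?_, fun μ hμ φ hφ hconv => ?_⟩
  · have e : ∀ W : Ω → C01, Measurable W →
        ∫ x, ∫ z, |x z| ^ s ∂(Measure.dirac t) ∂(P.map W) = ∫ ω, |W ω t| ^ s ∂P := fun W hW => by
      simp only [integral_dirac]
      exact integral_map hW.aemeasurable
        (hcont.comp (continuous_eval_const (F := C01) t)).measurable.aestronglyMeasurable
    simpa only [e _ hY, e _ (hX _)] using
      tendsto_integral_abs_rpow_eval hs h (Measure.dirac t)
  · have hindX : ∀ n, IndepFun Z (X n) P := fun n =>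
      hind.comp measurable_id ((measurable_pi_apply n).comp measurable_fst)
    have hindY : IndepFun Z Y P := hind.comp measurable_id measurable_snd
    refine ⟨tendstoInDistribution_eval_independent hX hY heval hZ hindX hindY, ?_⟩
    have hρ : IsProbabilityMeasure (P.map Z) := Measure.isProbabilityMeasure_map hZ.aemeasurable
    have e : ∀ W : Ω → C01, Measurable W → IndepFun Z W P →
        ∫ ω, |W ω (Z ω)| ^ s ∂P = ∫ x, ∫ z, |x z| ^ s ∂(P.map Z) ∂(P.map W) :=
      fun W hW hW' => by
        have : IsProbabilityMeasure (P.map W) := Measure.isProbabilityMeasure_map hW.aemeasurable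
        rw [integral_eval_independent hW hZ hW' hcont]
        exact integral_prod_eval_of_nonneg hcont fun x => Real.rpow_nonneg (abs_nonneg x) s
    simp only [e _ hY hindY, e _ (hX _) (hindX _)]
    exact tendsto_integral_abs_rpow_eval hs h (P.map Z)
  · exact eq_of_tendsto_integral_of_zolotarevDist hs (h.comp hφ.tendsto_atTop) hconv

end
end

section
/- Let s > 0 and let (μ_n)_{n≥0} be a sequence of probability measures on C[0,1] (with the uniform norm) that is a Cauchy sequence with respect to the Zolotarev metric ζ_s. Then there exists a probability measure μ on the product space ℝ^{[0,1]} (with the product σ-algebra) such that all finite-dimensional marginal distributions of μ_n converge weakly to the corresponding finite-dimensional marginals of μ. -/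
open MeasureTheory ProbabilityTheory Filter
open scoped ENNReal NNReal Topology unitInterval

noncomputable section

/-- A smooth function on the line all of whose derivatives are bounded by one. -/
structure HasUnitDerivs (h : ℝ → ℝ) : Prop where
  contDiff : ∀ n : ℕ, ContDiff ℝ n h
  abs_iteratedDeriv_le : ∀ (n : ℕ) (x : ℝ), |iteratedDeriv n h x| ≤ 1

namespace HasUnitDerivs

lemma cos : HasUnitDerivs Real.cos :=
  ⟨fun _ => Real.contDiff_cos, Real.abs_iteratedDeriv_cos_le_one⟩

lemma sin : HasUnitDerivs Real.sin :=
  ⟨fun _ => Real.contDiff_sin, Real.abs_iteratedDeriv_sin_le_one⟩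

variable {h : ℝ → ℝ}

lemma abs_iteratedDeriv_sub_le (hh : HasUnitDerivs h) (n : ℕ) (a b : ℝ) :
    |iteratedDeriv n h a - iteratedDeriv n h b| ≤ |a - b| := by
  have hL : LipschitzWith 1 (iteratedDeriv n h) := by
    refine lipschitzWith_of_nnnorm_deriv_le
      ((hh.contDiff (n + 1)).differentiable_iteratedDeriv n (by exact_mod_cast n.lt_succ_self))
      fun x => ?_
    rw [← iteratedDeriv_succ, ← NNReal.coe_le_coe]
    simpa using hh.abs_iteratedDeriv_le (n + 1) x
  simpa [Real.dist_eq] using hL.dist_le_mul a b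

lemma abs_iteratedDeriv_sub_le_rpow (hh : HasUnitDerivs h) (n : ℕ) {α : ℝ}
    (h0 : 0 ≤ α) (h1 : α ≤ 1) (a b : ℝ) :
    |iteratedDeriv n h a - iteratedDeriv n h b| ≤ 2 * |a - b| ^ α := by
  rcases le_total |a - b| 1 with hab | hab
  · have : |a - b| ≤ |a - b| ^ α := by
      simpa using Real.rpow_le_rpow_of_exponent_ge_of_imp (abs_nonneg (a - b)) hab h1 (by simp)
    have := hh.abs_iteratedDeriv_sub_le n a b
    linarith [abs_nonneg (a - b)]
  · have := Real.one_le_rpow hab h0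
    have := abs_sub (iteratedDeriv n h a) (iteratedDeriv n h b)
    linarith [hh.abs_iteratedDeriv_le n a, hh.abs_iteratedDeriv_le n b]

lemma norm_iteratedFDeriv_comp_sub_le (hh : HasUnitDerivs h) {F : Type*}
    [NormedAddCommGroup F] [NormedSpace ℝ F]
    (n : ℕ) {α : ℝ} (h0 : 0 ≤ α) (h1 : α ≤ 1) {R : ℝ} (L : F →L[ℝ] ℝ) (hL : ‖L‖ ≤ R) (x y : F) :
    ‖iteratedFDeriv ℝ n (h ∘ L) x - iteratedFDeriv ℝ n (h ∘ L) y‖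
      ≤ 2 * R ^ n * R ^ α * ‖x - y‖ ^ α := by
  have hR : 0 ≤ R := (norm_nonneg L).trans hL
  rw [L.iteratedFDeriv_comp_right (hh.contDiff n) x le_rfl,
    L.iteratedFDeriv_comp_right (hh.contDiff n) y le_rfl]
  have hsub : (iteratedFDeriv ℝ n h (L x)).compContinuousLinearMap (fun _ => L)
      - (iteratedFDeriv ℝ n h (L y)).compContinuousLinearMap (fun _ => L)
      = (iteratedFDeriv ℝ n h (L x) - iteratedFDeriv ℝ n h (L y)).compContinuousLinearMap
        (fun _ => L) := by ext; simp
  rw [hsub]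
  refine (ContinuousMultilinearMap.norm_compContinuousLinearMap_le _ _).trans ?_
  rw [iteratedFDeriv_eq_equiv_comp, Function.comp_apply, Function.comp_apply, ← map_sub,
    LinearIsometryEquiv.norm_map, Real.norm_eq_abs, Finset.prod_const, Finset.card_univ,
    Fintype.card_fin]
  have hLxy : |L x - L y| ≤ R * ‖x - y‖ := by
    rw [← map_sub, ← Real.norm_eq_abs]
    exact L.le_of_opNorm_le hL _
  calc |iteratedDeriv n h (L x) - iteratedDeriv n h (L y)| * ‖L‖ ^ n
      ≤ (2 * (R * ‖x - y‖) ^ α) * R ^ n := by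
        gcongr
        refine (hh.abs_iteratedDeriv_sub_le_rpow n h0 h1 _ _).trans ?_
        gcongr
    _ = 2 * R ^ n * R ^ α * ‖x - y‖ ^ α := by
        rw [Real.mul_rpow hR (norm_nonneg _)]; ring

lemma smul_comp_mem_zolotarevClass (hh : HasUnitDerivs h) {F : Type*}
    [NormedAddCommGroup F] [NormedSpace ℝ F]
    {s : ℝ} (hs : 0 < s) {R : ℝ} (hR : 0 < R) (L : F →L[ℝ] ℝ) (hL : ‖L‖ ≤ R) :
    (2 * R ^ (⌈s⌉₊ - 1) * R ^ (s - (⌈s⌉₊ - 1 : ℕ)))⁻¹ • (h ∘ L) ∈ zolotarevClass F s := by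
  have hc : 1 ≤ ⌈s⌉₊ := Nat.one_le_ceil_iff.2 hs
  have hcast : ((⌈s⌉₊ - 1 : ℕ) : ℝ) = ⌈s⌉₊ - 1 := by push_cast [Nat.cast_sub hc]; ring
  have h0 : 0 ≤ s - (⌈s⌉₊ - 1 : ℕ) := by
    rw [hcast]; linarith [Nat.ceil_lt_add_one hs.le]
  have h1 : s - (⌈s⌉₊ - 1 : ℕ) ≤ 1 := by
    rw [hcast]; linarith [Nat.le_ceil s]
  have hcd : ContDiff ℝ (⌈s⌉₊ - 1 : ℕ) (h ∘ L) := (hh.contDiff _).comp L.contDiff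
  refine ⟨contDiff_const.smul hcd, fun x y => ?_⟩
  have hC : 0 < 2 * R ^ (⌈s⌉₊ - 1) * R ^ (s - (⌈s⌉₊ - 1 : ℕ)) := by positivity
  rw [iteratedFDeriv_const_smul_apply hcd.contDiffAt,
    iteratedFDeriv_const_smul_apply hcd.contDiffAt, ← smul_sub, norm_smul, norm_inv,
    Real.norm_of_nonneg hC.le, inv_mul_le_iff₀ hC]
  exact hh.norm_iteratedFDeriv_comp_sub_le _ h0 h1 L hL x y

lemma abs_integral_comp_sub_le (hh : HasUnitDerivs h) {F : Type*}
    [NormedAddCommGroup F] [NormedSpace ℝ F]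
    [MeasurableSpace F] {s : ℝ} (hs : 0 < s) {R : ℝ} (hR : 0 < R) (L : F →L[ℝ] ℝ) (hL : ‖L‖ ≤ R)
    {μ ν : Measure F} {ε : ℝ} (hε : 0 < ε) (hμν : zolotarevDist s μ ν < ENNReal.ofReal ε) :
    |∫ x, h (L x) ∂μ - ∫ x, h (L x) ∂ν|
      ≤ 2 * R ^ (⌈s⌉₊ - 1) * R ^ (s - (⌈s⌉₊ - 1 : ℕ)) * ε := by
  have hC : 0 < 2 * R ^ (⌈s⌉₊ - 1) * R ^ (s - (⌈s⌉₊ - 1 : ℕ)) := by positivity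
  have hle := (le_iSup₂ (f := fun (f : F → ℝ) (_ : f ∈ zolotarevClass F s) =>
    ENNReal.ofReal |∫ x, f x ∂μ - ∫ x, f x ∂ν|) _
    (hh.smul_comp_mem_zolotarevClass hs hR L hL)).trans hμν.le
  rw [ENNReal.ofReal_le_ofReal_iff hε.le] at hle
  simp only [Pi.smul_apply, Function.comp_apply, integral_smul] at hle
  rw [← smul_sub, smul_eq_mul, abs_mul, abs_inv, abs_of_pos hC, inv_mul_le_iff₀ hC] at hle
  exact hle

end HasUnitDerivs

section Levy

variable {F E : Type*} [NormedAddCommGroup F] [NormedSpace ℝ F] [MeasurableSpace F] [BorelSpace F]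
  [NormedAddCommGroup E] [InnerProductSpace ℝ E] [MeasurableSpace E] [BorelSpace E]

lemma charFun_map_continuousLinearMap [SecondCountableTopology E]
    (μ : Measure F) [IsFiniteMeasure μ] (A : F →L[ℝ] E) (z : E) :
    charFun (μ.map A) z
      = (∫ x, Real.cos (((innerSL ℝ z).comp A) x) ∂μ : ℝ)
        + (∫ x, Real.sin (((innerSL ℝ z).comp A) x) ∂μ : ℝ) * Complex.I := by
  have hL := ((innerSL ℝ z).comp A).continuous
  rw [charFun_apply, integral_map (by fun_prop) (by fun_prop), ← integral_complex_ofReal,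
    ← integral_complex_ofReal, ← integral_mul_const, ← integral_add]
  · refine integral_congr_ae (ae_of_all _ fun x => ?_)
    simp only [Complex.exp_mul_I, Complex.ofReal_cos, Complex.ofReal_sin,
      ContinuousLinearMap.comp_apply, innerSL_apply_apply, real_inner_comm]
  · exact (Integrable.of_bound (C := 1)
      (Real.continuous_cos.comp hL).measurable.aestronglyMeasurable
      (ae_of_all _ fun x => Real.abs_cos_le_one _)).ofReal
  · exact ((Integrable.of_bound (C := 1)
      (Real.continuous_sin.comp hL).measurable.aestronglyMeasurable
      (ae_of_all _ fun x => Real.abs_sin_le_one _)).ofReal).mul_const _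

variable {s : ℝ} {μ : ℕ → Measure F} [∀ n, IsProbabilityMeasure (μ n)]

lemma uniformCauchySeqOn_charFun_map [SecondCountableTopology E]
    (hs : 0 < s)
    (hcauchy : ∀ ε : ℝ≥0∞, 0 < ε → ∃ N : ℕ, ∀ p ≥ N, ∀ q ≥ N, zolotarevDist s (μ p) (μ q) < ε)
    (A : F →L[ℝ] E) (r : ℝ) :
    UniformCauchySeqOn (fun n => charFun ((μ n).map A)) atTop (Metric.ball 0 r) := by
  rw [Metric.uniformCauchySeqOn_iff]
  intro ε hε
  set R : ℝ := |r| * ‖A‖ + 1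
  have hR : 0 < R := by positivity
  set C : ℝ := 2 * R ^ (⌈s⌉₊ - 1) * R ^ (s - (⌈s⌉₊ - 1 : ℕ)) with hC_def
  have hC : 0 < C := by positivity
  have hδ : 0 < ε / (4 * C) := by positivity
  obtain ⟨N, hN⟩ := hcauchy (ENNReal.ofReal (ε / (4 * C))) (by simpa using hδ)
  refine ⟨N, fun p hp q hq z hz => ?_⟩
  have hL : ‖(innerSL ℝ z).comp A‖ ≤ R := by
    refine ((innerSL ℝ z).opNorm_comp_le A).trans ?_
    rw [innerSL_apply_norm]
    have : ‖z‖ ≤ |r| := (mem_ball_zero_iff.1 hz).le.trans (le_abs_self r)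
    have := mul_le_mul_of_nonneg_right this (norm_nonneg A)
    simp only [R]; linarith
  have h1 := HasUnitDerivs.cos.abs_integral_comp_sub_le hs hR _ hL hδ (hN p hp q hq)
  have h2 := HasUnitDerivs.sin.abs_integral_comp_sub_le hs hR _ hL hδ (hN p hp q hq)
  have hCδ : C * (ε / (4 * C)) = ε / 4 := by field_simp
  rw [← hC_def, hCδ] at h1 h2
  rw [dist_eq_norm, charFun_map_continuousLinearMap, charFun_map_continuousLinearMap,
    add_sub_add_comm, ← sub_mul, ← Complex.ofReal_sub, ← Complex.ofReal_sub]
  refine (norm_add_le _ _).trans_lt ?_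
  rw [norm_mul, Complex.norm_I, mul_one, Complex.norm_real, Complex.norm_real,
    Real.norm_eq_abs, Real.norm_eq_abs]
  linarith

lemma exists_tendsto_map_continuousLinearMap [FiniteDimensional ℝ E]
    (hs : 0 < s)
    (hcauchy : ∀ ε : ℝ≥0∞, 0 < ε → ∃ N : ℕ, ∀ p ≥ N, ∀ q ≥ N, zolotarevDist s (μ p) (μ q) < ε)
    (A : F →L[ℝ] E) :
    ∃ Q : ProbabilityMeasure E, ∀ f : BoundedContinuousFunction E ℝ,
      Tendsto (fun n => ∫ x, f (A x) ∂(μ n)) atTop (𝓝 (∫ x, f x ∂(Q : Measure E))) := by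
  have hA : Measurable A := A.continuous.measurable
  let m : ℕ → ProbabilityMeasure E := fun n =>
    ⟨(μ n).map A, Measure.isProbabilityMeasure_map hA.aemeasurable⟩
  have hmU (r : ℝ) : UniformCauchySeqOn (fun n => charFun (m n : Measure E)) atTop
      (Metric.ball 0 r) := uniformCauchySeqOn_charFun_map hs hcauchy A r
  have hlim (z : E) : ∃ w : ℂ, Tendsto (fun n => charFun (m n : Measure E) z) atTop (𝓝 w) :=
    cauchySeq_tendsto_of_complete ((hmU (‖z‖ + 1)).cauchySeq (by simp))
  choose φ hφ using hlim
  have hcont : ContinuousAt φ 0 := by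
    have hunif := (hmU 1).tendstoUniformlyOn_of_tendsto fun z _ => hφ z
    refine (hunif.continuousOn (Frequently.of_forall fun n => ?_)).continuousAt
      (Metric.ball_mem_nhds 0 one_pos)
    exact continuous_charFun.continuousOn
  have htight : IsTightMeasureSet (Set.range fun n => (m n : Measure E)) :=
    isTightMeasureSet_of_tendsto_charFun hcont hφ
  have hcomp : IsCompact (closure (Set.range m)) := by
    refine isCompact_closure_of_isTightMeasureSet ?_
    convert htight using 1
    ext; simp
  obtain ⟨Q, -, hQ⟩ := hcomp.ultrafilter_le_nhds ((hyperfilter ℕ).map m) (by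
    rw [Ultrafilter.coe_map, le_principal_iff]
    exact mem_of_superset (range_mem_map) subset_closure)
  have hQ' : Tendsto m (hyperfilter ℕ) (𝓝 Q) := hQ
  have hchar (z : E) : φ z = charFun (Q : Measure E) z := by
    refine tendsto_nhds_unique ((hφ z).mono_left Nat.hyperfilter_le_atTop) ?_
    rw [ProbabilityMeasure.tendsto_iff_forall_integral_rclike_tendsto ℂ] at hQ'
    simp_rw [charFun_eq_integral_innerProbChar]
    exact hQ' (BoundedContinuousFunction.innerProbChar z)
  have hmQ : Tendsto m atTop (𝓝 Q) :=
    ProbabilityMeasure.tendsto_of_tendsto_charFun fun z => hchar z ▸ hφ z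
  refine ⟨Q, fun f => ?_⟩
  have := ProbabilityMeasure.tendsto_iff_forall_integral_tendsto.1 hmQ f
  refine this.congr fun n => ?_
  exact integral_map hA.aemeasurable f.continuous.aestronglyMeasurable

end Levy

lemma measurable_real_tan : Measurable Real.tan := by
  have : Real.tan = fun x => Real.sin x / Real.cos x := funext Real.tan_eq_sin_div_cos
  rw [this]
  fun_prop

/-- If all finite-dimensional distributions of a sequence of random functions converge weakly and
the arctangents of the random functions take values in a compact space, then the limits are the
finite-dimensional distributions of a single probability measure. -/
lemma exists_measure_of_tendsto_fdd {ι Ω Y : Type*} [MeasurableSpace Ω]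
    [TopologicalSpace Y] [CompactSpace Y] [T2Space Y] [MeasurableSpace Y] [BorelSpace Y]
    (μ : ℕ → Measure Ω) [∀ n, IsProbabilityMeasure (μ n)] (X : ι → Ω → ℝ)
    {g : Ω → Y} (hg : Measurable g) {e : ι → Y → ℝ}
    (he : ∀ i, Continuous (e i)) (hge : ∀ i x, e i (g x) = Real.arctan (X i x))
    (hfdd : ∀ (k : ℕ) (t : Fin k → ι), ∃ Q : ProbabilityMeasure (Fin k → ℝ),
      ∀ f : BoundedContinuousFunction (Fin k → ℝ) ℝ,
        Tendsto (fun n => ∫ x, f (fun i => X (t i) x) ∂(μ n)) atTop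
          (𝓝 (∫ x, f x ∂(Q : Measure (Fin k → ℝ))))) :
    ∃ ν : Measure (ι → ℝ), IsProbabilityMeasure ν ∧
      ∀ (k : ℕ) (t : Fin k → ι), ∀ f : BoundedContinuousFunction (Fin k → ℝ) ℝ,
        Tendsto (fun n => ∫ x, f (fun i => X (t i) x) ∂(μ n)) atTop
          (𝓝 (∫ x, f x ∂(ν.map (fun w : ι → ℝ => fun i => w (t i))))) := by
  let m : ℕ → ProbabilityMeasure Y := fun n =>
    ⟨(μ n).map g, Measure.isProbabilityMeasure_map hg.aemeasurable⟩
  obtain ⟨P, -, hP⟩ := (isCompact_univ (X := ProbabilityMeasure Y)).ultrafilter_le_nhds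
    ((hyperfilter ℕ).map m) (by simp)
  have hP' : Tendsto m (hyperfilter ℕ) (𝓝 P) := hP
  have hetan : Measurable fun (y : Y) (i : ι) => Real.tan (e i y) :=
    measurable_pi_lambda _ fun i => measurable_real_tan.comp (he i).measurable
  refine ⟨(P : Measure Y).map fun y i => Real.tan (e i y),
    Measure.isProbabilityMeasure_map hetan.aemeasurable, fun k t f => ?_⟩
  obtain ⟨Q, hQ⟩ := hfdd k t
  have hee : Continuous fun (y : Y) (i : Fin k) => e (t i) y := continuous_pi fun i => he (t i)
  have hat : Continuous fun (w : Fin k → ℝ) (i : Fin k) => Real.arctan (w i) := by fun_prop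
  have htan : Measurable fun (w : Fin k → ℝ) (i : Fin k) => Real.tan (w i) :=
    measurable_pi_lambda _ fun i => measurable_real_tan.comp (measurable_pi_apply i)
  have hmap : (P : Measure Y).map (fun y (i : Fin k) => e (t i) y)
      = (Q : Measure (Fin k → ℝ)).map (fun w i => Real.arctan (w i)) := by
    have := Measure.isProbabilityMeasure_map (μ := (P : Measure Y)) hee.measurable.aemeasurable
    have := Measure.isProbabilityMeasure_map (μ := (Q : Measure _)) hat.measurable.aemeasurable
    refine ext_of_forall_integral_eq_of_IsFiniteMeasure fun f => ?_
    rw [integral_map hee.measurable.aemeasurable f.continuous.aestronglyMeasurable,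
      integral_map hat.measurable.aemeasurable f.continuous.aestronglyMeasurable]
    have h1 := ProbabilityMeasure.tendsto_iff_forall_integral_tendsto.1 hP'
      (f.compContinuous ⟨_, hee⟩)
    have h2 := (hQ (f.compContinuous ⟨_, hat⟩)).mono_left Nat.hyperfilter_le_atTop
    refine tendsto_nhds_unique h1 (h2.congr fun n => ?_)
    have h3 : ∫ y, (f.compContinuous ⟨_, hee⟩) y ∂(μ n).map g
        = ∫ x, (f.compContinuous ⟨_, hee⟩) (g x) ∂(μ n) :=
      integral_map hg.aemeasurable
        (f.compContinuous ⟨_, hee⟩).continuous.measurable.aestronglyMeasurable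
    refine Eq.trans ?_ h3.symm
    simp [hge]
  have hQ_eq : ((P : Measure Y).map fun y i => Real.tan (e i y)).map
      (fun w : ι → ℝ => fun i => w (t i)) = (Q : Measure (Fin k → ℝ)) := by
    rw [Measure.map_map (by fun_prop) hetan]
    calc _ = ((P : Measure Y).map (fun y (i : Fin k) => e (t i) y)).map
          (fun w i => Real.tan (w i)) := by
          rw [Measure.map_map htan hee.measurable]; rfl
      _ = (Q : Measure (Fin k → ℝ)) := by
          rw [hmap, Measure.map_map htan hat.measurable]
          convert Measure.map_id
          ext w i
          simp [Real.tan_arctan]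
  rw [hQ_eq]
  exact hQ f

theorem zolotarev_cauchy_implies_fdd_limit
    (s : ℝ) (hs : 0 < s)
    (μ : ℕ → Measure C01) (hμ : ∀ n, IsProbabilityMeasure (μ n))
    (hcauchy : ∀ ε : ℝ≥0∞, 0 < ε → ∃ N : ℕ, ∀ p ≥ N, ∀ q ≥ N,
      zolotarevDist s (μ p) (μ q) < ε) :
    ∃ ν : Measure (unitInterval → ℝ), IsProbabilityMeasure ν ∧
      ∀ (k : ℕ) (t : Fin k → unitInterval),
        ∀ f : BoundedContinuousFunction (Fin k → ℝ) ℝ,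
          Tendsto (fun n => ∫ x, f x ∂((μ n).map (fun g : C01 => fun i => g (t i))))
            atTop (𝓝 (∫ x, f x ∂(ν.map (fun g : unitInterval → ℝ => fun i => g (t i))))) := by
  have hfdd (k : ℕ) (t : Fin k → unitInterval) : ∃ Q : ProbabilityMeasure (Fin k → ℝ),
      ∀ f : BoundedContinuousFunction (Fin k → ℝ) ℝ,
        Tendsto (fun n => ∫ x : C01, f (fun i => x (t i)) ∂(μ n)) atTop
          (𝓝 (∫ x, f x ∂(Q : Measure (Fin k → ℝ)))) := by
    let A : C01 →L[ℝ] EuclideanSpace ℝ (Fin k) :=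
      ((EuclideanSpace.equiv (Fin k) ℝ).symm : (Fin k → ℝ) →L[ℝ] EuclideanSpace ℝ (Fin k)).comp
        (ContinuousLinearMap.pi fun i => ContinuousMap.evalCLM ℝ (t i))
    obtain ⟨Q, hQ⟩ := exists_tendsto_map_continuousLinearMap hs hcauchy A
    have hcont : Continuous (EuclideanSpace.equiv (Fin k) ℝ) :=
      (EuclideanSpace.equiv (Fin k) ℝ).continuous
    refine ⟨Q.map hcont.measurable.aemeasurable, fun f => ?_⟩
    rw [ProbabilityMeasure.toMeasure_map,
      integral_map hcont.measurable.aemeasurable f.continuous.aestronglyMeasurable]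
    exact hQ (f.compContinuous ⟨_, hcont⟩)
  have hX (i : unitInterval) : Continuous fun x : C01 => x i := continuous_eval_const i
  let g : C01 → unitInterval → Set.Icc (-(Real.pi / 2)) (Real.pi / 2) := fun x i =>
    ⟨Real.arctan (x i), (Real.neg_pi_div_two_lt_arctan _).le, (Real.arctan_lt_pi_div_two _).le⟩
  have hg : Continuous g :=
    continuous_pi fun i => (Real.continuous_arctan.comp (hX i)).subtype_mk _
  let mY : MeasurableSpace (unitInterval → Set.Icc (-(Real.pi / 2)) (Real.pi / 2)) := borel _
  have hY : @BorelSpace _ _ mY := @BorelSpace.mk _ _ mY rfl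
  obtain ⟨ν, hν, hlim⟩ := @exists_measure_of_tendsto_fdd unitInterval C01 _ _ _ _ _ mY hY μ hμ
    (fun i x => x i) g (@Continuous.measurable _ _ _ _ _ _ mY hY _ hg)
    (fun i y => (y i : ℝ)) (fun i => continuous_subtype_val.comp (continuous_apply i))
    (fun _ _ => rfl) hfdd
  refine ⟨ν, hν, fun k t f => (hlim k t f).congr fun n => ?_⟩
  exact (integral_map (continuous_pi fun i => hX (t i)).measurable.aemeasurable
    f.continuous.aestronglyMeasurable).symm

end
end

section
/- For an even integer p ≥ 4 and x, y ∈ C[0,1], let L_p(x) = ( ∫_0^1 x(t)^p dt )^{1/p} and ψ_{p,y}(x) = L_p( (1 + (x − y)^2)^{1/2} ). Then L_p is infinitely Fréchet differentiable on C[0,1] \ {0} and ψ_{p,y} is infinitely Fréchet differentiable on C[0,1] for every y ∈ C[0,1]; moreover, for each k ∈ {1,2,3} there exists a constant C > 0 (independent of p, x, y) such that ‖D^k L_p(x)‖ ≤ C p^{k−1} L_p(x)^{1−k} for all even p ≥ 4 and all x ∈ C[0,1] \ {0}, and ‖D^k ψ_{p,y}(x)‖ ≤ C p^{k−1} for all even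 p ≥ 4 and all x, y ∈ C[0,1]. -/
open MeasureTheory Filter
open scoped ENNReal Topology unitInterval

noncomputable section

/-- `L_p(x) = (∫_0^1 x(t)^p dt)^{1/p}`. -/
def Lp01 (p : ℕ) (x : C01) : ℝ :=
  (∫ t : unitInterval, (x t) ^ p) ^ ((1 : ℝ) / p)

/-- `ψ_{p,y}(x) = L_p((1 + (x − y)^2)^{1/2})`. -/
def psi01 (p : ℕ) (y x : C01) : ℝ :=
  (∫ t : unitInterval, (Real.sqrt (1 + (x t - y t) ^ 2)) ^ p) ^ ((1 : ℝ) / p)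

theorem hasFDerivAt_polynomial_aeval {A : Type*} [NormedCommRing A] [NormedAlgebra ℝ A]
    (P : Polynomial ℝ) (x : A) :
    HasFDerivAt (fun y : A ↦ Polynomial.aeval y P)
      (ContinuousLinearMap.mul ℝ A (Polynomial.aeval x (Polynomial.derivative P))) x := by
  induction P using Polynomial.induction_on' with
  | add P Q hP hQ =>
    simp only [map_add]
    exact hP.add hQ
  | monomial n a =>
    simp only [Polynomial.aeval_monomial, Polynomial.derivative_monomial]
    refine ((hasFDerivAt_pow (𝕜 := ℝ) n (x := x)).const_mul (algebraMap ℝ A a)).congr_fderiv ?_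
    ext h
    simp [mul_assoc, Algebra.smul_def]

theorem contDiff_polynomial_aeval {A : Type*} [NormedCommRing A] [NormedAlgebra ℝ A]
    (P : Polynomial ℝ) {n : WithTop ℕ∞} : ContDiff ℝ n (fun y : A ↦ Polynomial.aeval y P) := by
  simp only [Polynomial.aeval_eq_sum_range]
  exact ContDiff.sum fun i _ ↦ (contDiff_id.pow i).const_smul _

theorem iteratedFDeriv_clm_polynomial_aeval {A : Type*} [NormedCommRing A] [NormedAlgebra ℝ A]
    (L : A →L[ℝ] ℝ) (P : Polynomial ℝ) (k : ℕ) (x : A) (m : Fin k → A) :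
    iteratedFDeriv ℝ k (fun y : A ↦ L (Polynomial.aeval y P)) x m =
      L (Polynomial.aeval x (Polynomial.derivative^[k] P) * ∏ i, m i) := by
  induction k generalizing x with
  | zero => simp
  | succ k ih =>
    have hdiff : DifferentiableAt ℝ
        (iteratedFDeriv ℝ k (fun y : A ↦ L (Polynomial.aeval y P))) x :=
      (L.contDiff.comp (contDiff_polynomial_aeval P (n := ⊤))).differentiable_iteratedFDeriv
        (by exact_mod_cast WithTop.coe_lt_top _) x
    have h1 := (ContinuousMultilinearMap.apply ℝ (fun _ : Fin k ↦ A) ℝ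
      (Fin.tail m)).hasFDerivAt.comp x hdiff.hasFDerivAt
    have h2 := L.hasFDerivAt.comp x
      ((hasFDerivAt_polynomial_aeval (Polynomial.derivative^[k] P) x).mul_const
        (∏ i, Fin.tail m i))
    have h3 : (ContinuousMultilinearMap.apply ℝ (fun _ : Fin k ↦ A) ℝ (Fin.tail m)) ∘
        (iteratedFDeriv ℝ k (fun y : A ↦ L (Polynomial.aeval y P))) =
        L ∘ fun y ↦ Polynomial.aeval y (Polynomial.derivative^[k] P) * ∏ i, Fin.tail m i := by
      ext y
      simp [ih]
    rw [h3] at h1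
    have h4 := DFunLike.congr_fun (h1.unique h2) (m 0)
    rw [iteratedFDeriv_succ_apply_left]
    simp only [ContinuousLinearMap.comp_apply, ContinuousMultilinearMap.apply_apply] at h4
    rw [h4, Function.iterate_succ_apply', Fin.prod_univ_succ]
    simp only [Fin.tail, smul_apply, ContinuousLinearMap.mul_apply',
      smul_eq_mul]
    congr 1
    ring

instance : (volume : Measure unitInterval).IsOpenPosMeasure where
  open_pos U hU hne := by
    obtain ⟨a, b, hab, h⟩ := hU.exists_Ioo_subset hne
    refine (lt_of_lt_of_le ?_ (measure_mono h)).ne'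
    rw [unitInterval.volume_Ioo]
    simpa using hab

theorem abs_descPochhammer_eval_le {r : ℝ} (h0 : 0 ≤ r) (h1 : r ≤ 1) {i : ℕ} (hi : 1 ≤ i)
    (hi3 : i ≤ 3) : |(descPochhammer ℝ i).eval r| ≤ 2 * r := by
  have e1 : |r - 1| ≤ 1 := by rw [abs_le]; constructor <;> linarith
  have e2 : |r - 2| ≤ 2 := by rw [abs_le]; constructor <;> linarith
  interval_cases i
  · simp [abs_of_nonneg h0]; linarith
  · simp [descPochhammer_succ_right, abs_mul, abs_of_nonneg h0]; nlinarith
  · simp [descPochhammer_succ_right, abs_mul, abs_of_nonneg h0]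
    nlinarith [mul_le_mul e1 e2 (abs_nonneg _) zero_le_one]

theorem norm_iteratedFDeriv_rpow_sub_one_le {r : ℝ} (h0 : 0 ≤ r) (h1 : r ≤ 1) {i : ℕ}
    (hi : i ≤ 3) : ‖iteratedFDeriv ℝ i (fun u : ℝ ↦ u ^ r - 1) 1‖ ≤ 2 * r := by
  rw [norm_iteratedFDeriv_eq_norm_iteratedDeriv]
  rcases i with _ | i
  · simpa using h0
  · have : iteratedDeriv (i + 1) (fun u : ℝ ↦ u ^ r - 1) = iteratedDeriv (i + 1) (· ^ r) := by
      rw [iteratedDeriv_succ', iteratedDeriv_succ']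
      congr 1
      ext u
      simp
    rw [this, iteratedDeriv_eq_iterate, Real.iter_deriv_rpow_const]
    simpa using abs_descPochhammer_eval_le h0 h1 (by omega) hi

theorem C01.integrable (f : C01) : Integrable (fun t ↦ f t) :=
  f.continuous.integrable_of_hasCompactSupport (HasCompactSupport.of_compactSpace _)

/-- Integration over the unit interval as a continuous linear form on `C[0,1]`. -/
def integralCLM01 : C01 →L[ℝ] ℝ :=
  LinearMap.mkContinuous
    { toFun := fun f ↦ ∫ t, f t
      map_add' := fun f g ↦ integral_add f.integrable g.integrable
      map_smul' := fun c f ↦ integral_const_mul c f } 1 fun f ↦ by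
    simpa using norm_integral_le_of_norm_le_const (μ := (volume : Measure unitInterval))
      (Eventually.of_forall f.norm_coe_le_norm)

theorem integralCLM01_apply (f : C01) : integralCLM01 f = ∫ t, f t := rfl

theorem integral_eval_eq (P : Polynomial ℝ) (x : C01) :
    ∫ t, P.eval (x t) = integralCLM01 (Polynomial.aeval x P) := by
  simp [integralCLM01_apply, Polynomial.aeval_continuousMap_apply]

theorem contDiff_integral_eval (P : Polynomial ℝ) {n : WithTop ℕ∞} :
    ContDiff ℝ n (fun x : C01 ↦ ∫ t, P.eval (x t)) := by
  simp only [integral_eval_eq]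
  exact integralCLM01.contDiff.comp (contDiff_polynomial_aeval P)

theorem norm_iteratedFDeriv_integral_eval_le (P : Polynomial ℝ) (k : ℕ) (x b : C01)
    (hb : ∀ t, |(Polynomial.derivative^[k] P).eval (x t)| ≤ b t) :
    ‖iteratedFDeriv ℝ k (fun y : C01 ↦ ∫ t, P.eval (y t)) x‖ ≤ ∫ t, b t := by
  have hb0 : 0 ≤ ∫ t, b t := integral_nonneg fun t ↦ (abs_nonneg _).trans (hb t)
  refine ContinuousMultilinearMap.opNorm_le_bound hb0 fun m ↦ ?_
  simp only [integral_eval_eq]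
  rw [iteratedFDeriv_clm_polynomial_aeval, integralCLM01_apply, ← integral_mul_const]
  refine norm_integral_le_of_norm_le (b.integrable.mul_const _) (Eventually.of_forall fun t ↦ ?_)
  rw [ContinuousMap.mul_apply, norm_mul, Polynomial.aeval_continuousMap_apply,
    ContinuousMap.coe_prod, Finset.prod_apply, norm_prod]
  exact mul_le_mul (hb t) (Finset.prod_le_prod (fun _ _ ↦ norm_nonneg _)
    fun i _ ↦ (m i).norm_coe_le_norm t) (by positivity) ((abs_nonneg _).trans (hb t))

theorem integral_pow_le_rpow {p k : ℕ} (hp : p ≠ 0) (hk : k ≤ p) (s : C01) (hs : ∀ t, 0 ≤ s t) :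
    ∫ t, s t ^ k ≤ (∫ t, s t ^ p) ^ ((k : ℝ) / p) := by
  have hp' : (0 : ℝ) < p := by positivity
  have hk' : (k : ℝ) ≤ p := by exact_mod_cast hk
  have hr0 : 0 ≤ (k : ℝ) / p := by positivity
  have hpow : ∀ t, (s t ^ p) ^ ((k : ℝ) / p) = s t ^ k := fun t ↦ by
    rw [← Real.rpow_natCast_mul (hs t), mul_div_cancel₀ _ hp'.ne', Real.rpow_natCast]
  have h := (Real.concaveOn_rpow hr0 ((div_le_one hp').2 hk')).le_map_integral
    (μ := (volume : Measure unitInterval)) (f := fun t ↦ s t ^ p)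
    (Real.continuous_rpow_const hr0).continuousOn isClosed_Ici
    (Eventually.of_forall fun t ↦ pow_nonneg (hs t) p) (C01.integrable (s ^ p))
    (by simp only [Function.comp_def, hpow]; exact C01.integrable (s ^ k))
  simpa only [hpow] using h

theorem norm_iteratedFDeriv_rpow_integral_eval_le {p k : ℕ} (hp : 4 ≤ p) (hk : 1 ≤ k)
    (hk3 : k ≤ 3) (P : Polynomial ℝ) (x s : C01) (hs : ∀ t, 0 ≤ s t)
    (hP : ∀ t, P.eval (x t) = s t ^ p)
    (hD : ∀ j, 1 ≤ j → j ≤ 3 → ∀ t,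
      |(Polynomial.derivative^[j] P).eval (x t)| ≤ (2 * p) ^ j * s t ^ (p - j))
    (hpos : 0 < ∫ t, P.eval (x t)) :
    ‖iteratedFDeriv ℝ k (fun y : C01 ↦ (∫ t, P.eval (y t)) ^ ((1 : ℝ) / p)) x‖ ≤
      96 * (p : ℝ) ^ (k - 1) * ((∫ t, P.eval (x t)) ^ ((1 : ℝ) / p)) ^ ((1 : ℝ) - k) := by
  set F : C01 → ℝ := fun y ↦ ∫ t, P.eval (y t) with hFdef
  set r : ℝ := 1 / p with hr
  have hp0 : (0 : ℝ) < p := by positivity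
  have hr0 : 0 ≤ r := by positivity
  have hr1 : r ≤ 1 := by
    rw [hr, div_le_one hp0]
    exact_mod_cast (by omega : 1 ≤ p)
  change 0 < F x at hpos
  change ‖iteratedFDeriv ℝ k (fun y ↦ F y ^ r) x‖ ≤
    96 * (p : ℝ) ^ (k - 1) * (F x ^ r) ^ ((1 : ℝ) - k)
  set A : ℝ := F x with hA
  have hF : ∀ {n : WithTop ℕ∞}, ContDiff ℝ n F := contDiff_integral_eval P
  set f : C01 → ℝ := A⁻¹ • F with hf
  have hfc : ∀ {n : WithTop ℕ∞}, ContDiff ℝ n f := contDiff_const.smul hF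
  set h : ℝ → ℝ := fun u ↦ u ^ r - 1 with hh
  have hhc : ContDiffOn ℝ 3 h (Set.Ioi 0) := fun u hu ↦
    ((contDiffAt_id.rpow_const_of_ne (ne_of_gt hu)).sub contDiffAt_const).contDiffWithinAt
  have hfx : f x = 1 := inv_mul_cancel₀ hpos.ne'
  set S : Set C01 := {y | 0 < f y} with hS
  have hSo : IsOpen S := isOpen_lt continuous_const (hfc (n := 0)).continuous
  have hxS : x ∈ S := by simp [hS, hfx]
  have hcomp : ‖iteratedFDeriv ℝ k (h ∘ f) x‖ ≤ k.factorial * (2 * r) * (2 * p * A ^ (-r)) ^ k := by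
    rw [← iteratedFDerivWithin_of_isOpen k hSo hxS]
    refine norm_iteratedFDerivWithin_comp_le hhc hfc.contDiffOn (by exact_mod_cast hk3)
      isOpen_Ioi.uniqueDiffOn hSo.uniqueDiffOn (fun y hy ↦ hy) hxS ?_ ?_
    · intro i hi
      rw [hfx, iteratedFDerivWithin_of_isOpen i isOpen_Ioi (by simp)]
      exact norm_iteratedFDeriv_rpow_sub_one_le hr0 hr1 (hi.trans hk3)
    · intro i hi hik
      have hFi := norm_iteratedFDeriv_integral_eval_le P i x (((2 * p : ℝ) ^ i) • s ^ (p - i))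
        (hD i hi (hik.trans hk3))
      have hJ := integral_pow_le_rpow (p := p) (by omega) (Nat.sub_le p i) s hs
      simp only [← hP] at hJ
      change _ ≤ ∫ t, (2 * p : ℝ) ^ i * s t ^ (p - i) at hFi
      rw [integral_const_mul] at hFi
      rw [iteratedFDerivWithin_of_isOpen i hSo hxS, hf,
        iteratedFDeriv_const_smul_apply hF.contDiffAt, norm_smul, Real.norm_eq_abs,
        abs_of_pos (inv_pos.2 hpos), mul_pow, ← Real.rpow_mul_natCast hpos.le]
      have he : A ^ (((p - i : ℕ) : ℝ) / p) = A * A ^ (-r * i) := by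
        rw [Nat.cast_sub (by omega), ← Real.rpow_one_add' hpos.le, hr]
        · congr 1
          field_simp
          ring
        · have : (i : ℝ) < p := by exact_mod_cast (by omega : i < p)
          rw [hr, show (1 : ℝ) + -(1 / p) * i = (p - i) / p by field_simp; ring]
          exact div_ne_zero (by linarith) hp0.ne'
      rw [inv_mul_le_iff₀ hpos]
      calc _ ≤ _ := hFi
        _ ≤ (2 * p : ℝ) ^ i * (A * A ^ (-r * i)) := by
          rw [← he]
          gcongr
        _ = _ := by ring
  have heq : (fun y ↦ F y ^ r) =ᶠ[𝓝 x] A ^ r • (h ∘ f) + fun _ ↦ A ^ r := by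
    filter_upwards [hSo.mem_nhds hxS] with y hy
    have : F y = A * f y := by simp [hf, mul_inv_cancel_left₀ hpos.ne']
    simp only [Pi.add_apply, Pi.smul_apply, Function.comp_apply, hh, smul_eq_mul]
    rw [this, Real.mul_rpow hpos.le (le_of_lt hy)]
    ring
  have hcc : ContDiffAt ℝ k (h ∘ f) x :=
    ((hfc.contDiffAt.rpow_const_of_ne (by simp [hfx])).sub contDiffAt_const)
  have hcs : ContDiffAt ℝ k (A ^ r • (h ∘ f)) x := contDiffAt_const.smul hcc
  rw [(heq.iteratedFDeriv ℝ k).self_of_nhds, iteratedFDeriv_add_apply hcs contDiffAt_const,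
    iteratedFDeriv_const_of_ne (by omega), Pi.zero_apply, add_zero,
    iteratedFDeriv_const_smul_apply hcc, norm_smul, Real.norm_eq_abs,
    abs_of_pos (Real.rpow_pos_of_pos hpos r)]
  have hfac : (k.factorial : ℝ) * 2 ^ (k + 1) ≤ 96 := by
    interval_cases k <;> norm_num [Nat.factorial]
  have hpk : r * (p : ℝ) ^ k = (p : ℝ) ^ (k - 1) := by
    obtain ⟨j, rfl⟩ : ∃ j, k = j + 1 := ⟨k - 1, by omega⟩
    rw [hr, pow_succ]
    field_simp
    simp
  have hApow : A ^ r * (A ^ (-r)) ^ k = (A ^ r) ^ ((1 : ℝ) - k) := by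
    rw [Real.rpow_sub (Real.rpow_pos_of_pos hpos r), Real.rpow_neg hpos.le, Real.rpow_one,
      Real.rpow_natCast, inv_pow, div_eq_mul_inv]
  calc A ^ r * _ ≤ A ^ r * (k.factorial * (2 * r) * (2 * p * A ^ (-r)) ^ k) := by gcongr
    _ = (k.factorial * 2 ^ (k + 1)) * (r * (p : ℝ) ^ k) * (A ^ r * (A ^ (-r)) ^ k) := by ring
    _ ≤ _ := by
      rw [hpk, hApow]
      gcongr

theorem abs_iterate_derivative_X_pow_eval_le (p j : ℕ) (u : ℝ) :
    |(Polynomial.derivative^[j] (Polynomial.X ^ p : Polynomial ℝ)).eval u| ≤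
      (2 * p) ^ j * |u| ^ (p - j) := by
  rw [Polynomial.iterate_derivative_X_pow_eq_natCast_mul]
  simp only [Polynomial.eval_mul, Polynomial.eval_natCast, Polynomial.eval_pow, Polynomial.eval_X,
    abs_mul, abs_pow, Nat.abs_cast]
  gcongr
  have h1 : (p.descFactorial j : ℝ) ≤ (p : ℝ) ^ j := by
    exact_mod_cast Nat.descFactorial_le_pow p j
  refine h1.trans (pow_le_pow_left₀ (by positivity) ?_ j)
  linarith [(Nat.cast_nonneg p : (0 : ℝ) ≤ p)]

theorem abs_iterate_derivative_one_add_X_sq_pow_eval_le {p q j : ℕ} (hpq : p = 2 * q) (hq : 2 ≤ q)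
    (hj : 1 ≤ j) (hj3 : j ≤ 3) (u : ℝ) :
    |(Polynomial.derivative^[j] ((1 + Polynomial.X ^ 2) ^ q : Polynomial ℝ)).eval u| ≤
      (2 * p) ^ j * Real.sqrt (1 + u ^ 2) ^ (p - j) := by
  obtain ⟨m, rfl⟩ : ∃ m, q = m + 2 := ⟨q - 2, by omega⟩
  subst hpq
  set w := Real.sqrt (1 + u ^ 2)
  have hsq : 1 + u ^ 2 = w ^ 2 := (Real.sq_sqrt (by positivity)).symm
  have hw : 0 ≤ w := Real.sqrt_nonneg _
  have hu : |u| ≤ w := Real.abs_le_sqrt (by linarith)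
  have hm : (0 : ℝ) ≤ m := Nat.cast_nonneg m
  interval_cases j
  · have hd : (Polynomial.derivative^[1] ((1 + Polynomial.X ^ 2) ^ (m + 2) : Polynomial ℝ)).eval u =
        2 * (m + 2) * ((w ^ 2) ^ (m + 1) * u) := by
      rw [← hsq]
      simp [Polynomial.derivative_pow]
      ring
    rw [hd, abs_mul, abs_mul _ u, abs_of_nonneg (by positivity), abs_of_nonneg (by positivity)]
    calc _ ≤ 2 * (m + 2) * ((w ^ 2) ^ (m + 1) * w) := by gcongr
      _ = 2 * (m + 2) * w ^ (2 * (m + 2) - 1) := by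
        rw [← pow_mul, ← pow_succ]; rfl
      _ ≤ _ := by
        gcongr
        push_cast
        linarith
  · have hd : (Polynomial.derivative^[2] ((1 + Polynomial.X ^ 2) ^ (m + 2) : Polynomial ℝ)).eval u =
        4 * (m + 2) * (m + 1) * ((w ^ 2) ^ m * u ^ 2) + 2 * (m + 2) * (w ^ 2) ^ (m + 1) := by
      rw [← hsq]
      simp [Polynomial.derivative_pow]
      ring
    have hu2 : u ^ 2 ≤ w ^ 2 := by linarith
    rw [hd, abs_of_nonneg (by positivity)]
    calc _ ≤ 4 * (m + 2) * (m + 1) * ((w ^ 2) ^ m * w ^ 2) + 2 * (m + 2) * (w ^ 2) ^ (m + 1) := by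
          gcongr
      _ = (4 * (m + 2) * (m + 1) + 2 * (m + 2)) * w ^ (2 * (m + 2) - 2) := by
        rw [← pow_succ, ← pow_mul, ← add_mul]; rfl
      _ ≤ _ := by
        gcongr
        push_cast
        nlinarith
  · have hd : (Polynomial.derivative^[3] ((1 + Polynomial.X ^ 2) ^ (m + 2) : Polynomial ℝ)).eval u =
        8 * (m + 2) * (m + 1) * (m * (w ^ 2) ^ (m - 1) * u ^ 3) +
          12 * (m + 2) * (m + 1) * ((w ^ 2) ^ m * u) := by
      rw [← hsq]
      simp [Polynomial.derivative_pow]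
      ring
    have h1 : |m * (w ^ 2) ^ (m - 1) * u ^ 3| ≤ m * w ^ (2 * m + 1) := by
      rw [abs_mul, abs_pow, abs_of_nonneg (by positivity)]
      rcases m with _ | m
      · simp
      · calc _ ≤ ((m + 1 : ℕ) : ℝ) * (w ^ 2) ^ (m + 1 - 1) * w ^ 3 := by gcongr
          _ = _ := by rw [← pow_mul, mul_assoc, ← pow_add]; congr 2
    have h2 : |(w ^ 2) ^ m * u| ≤ w ^ (2 * m + 1) := by
      rw [abs_mul, abs_of_nonneg (by positivity), ← pow_mul, pow_succ]
      gcongr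
    rw [hd]
    refine (abs_add_le _ _).trans ?_
    rw [abs_mul, abs_mul _ ((w ^ 2) ^ m * u), abs_of_nonneg (by positivity),
      abs_of_nonneg (by positivity : (0 : ℝ) ≤ 12 * (m + 2) * (m + 1))]
    calc _ ≤ 8 * (m + 2) * (m + 1) * (m * w ^ (2 * m + 1)) +
          12 * (m + 2) * (m + 1) * w ^ (2 * m + 1) := by gcongr
      _ = (8 * (m + 2) * (m + 1) * m + 12 * (m + 2) * (m + 1)) * w ^ (2 * (m + 2) - 3) := by
        rw [← mul_assoc, ← add_mul]; rfl
      _ ≤ _ := by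
        gcongr
        push_cast
        have : 0 ≤ (m : ℝ) ^ 2 := by positivity
        have : 0 ≤ (m : ℝ) ^ 3 := by positivity
        nlinarith

theorem integral_pow_pos {p : ℕ} (hp : Even p) {x : C01} (hx : x ≠ 0) : 0 < ∫ t, x t ^ p := by
  obtain ⟨t, ht⟩ := DFunLike.ne_iff.1 hx
  exact integral_pos_of_integrable_nonneg_nonzero (x ^ p).continuous (x ^ p).integrable
    (fun t ↦ hp.pow_nonneg _) (pow_ne_zero p ht)

theorem Lp01_eq (p : ℕ) :
    Lp01 p = fun x ↦ (∫ t, (Polynomial.X ^ p : Polynomial ℝ).eval (x t)) ^ ((1 : ℝ) / p) := by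
  ext x
  simp [Lp01]

theorem psi01_eq {p q : ℕ} (hpq : p = 2 * q) (y : C01) :
    psi01 p y = fun x ↦ (∫ t, ((1 + Polynomial.X ^ 2) ^ q : Polynomial ℝ).eval ((x - y) t)) ^
      ((1 : ℝ) / p) := by
  ext x
  unfold psi01
  congr 2
  ext t
  rw [hpq, pow_mul, Real.sq_sqrt (by positivity)]
  simp

theorem one_le_integral_one_add_sq_pow (q : ℕ) (x : C01) :
    1 ≤ ∫ t, ((1 + Polynomial.X ^ 2) ^ q : Polynomial ℝ).eval (x t) := by
  have h := integral_mono (μ := (volume : Measure unitInterval)) (integrable_const (1 : ℝ))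
    (C01.integrable ((1 + x ^ 2) ^ q)) fun t ↦ one_le_pow₀ (a := 1 + x t ^ 2) (n := q)
      (by nlinarith [sq_nonneg (x t)])
  simpa using h

theorem Lp01_smooth_and_derivative_bounds :
    -- smoothness of `L_p` away from the zero function
    (∀ p : ℕ, Even p → 4 ≤ p → ContDiffOn ℝ (⊤ : ℕ∞) (Lp01 p) {x : C01 | x ≠ 0}) ∧
    -- smoothness of `ψ_{p,y}` everywhere
    (∀ p : ℕ, Even p → 4 ≤ p → ∀ y : C01, ContDiff ℝ (⊤ : ℕ∞) (psi01 p y)) ∧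
    -- uniform derivative bounds for `k ∈ {1,2,3}`
    (∀ k : ℕ, k = 1 ∨ k = 2 ∨ k = 3 →
      ∃ C : ℝ, 0 < C ∧
        (∀ p : ℕ, Even p → 4 ≤ p → ∀ x : C01, x ≠ 0 →
          ‖iteratedFDeriv ℝ k (Lp01 p) x‖
            ≤ C * (p : ℝ) ^ (k - 1) * Lp01 p x ^ ((1 : ℝ) - (k : ℝ))) ∧
        (∀ p : ℕ, Even p → 4 ≤ p → ∀ y x : C01,
          ‖iteratedFDeriv ℝ k (psi01 p y) x‖ ≤ C * (p : ℝ) ^ (k - 1))) := by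
  refine ⟨fun p hp _ x hx ↦ ?_, fun p hp _ y ↦ ?_, fun k hk ↦ ⟨96, by norm_num, ?_, ?_⟩⟩
  · rw [Lp01_eq]
    refine ((contDiff_integral_eval _).contDiffAt.rpow_const_of_ne ?_).contDiffWithinAt
    simpa using (integral_pow_pos hp hx).ne'
  · obtain ⟨q, hq⟩ := hp.two_dvd
    rw [psi01_eq hq]
    exact ((contDiff_integral_eval _).comp (contDiff_id.sub contDiff_const)).rpow_const_of_ne
      fun x ↦ (zero_lt_one.trans_le (one_le_integral_one_add_sq_pow q (x - y))).ne'
  · intro p hp hp4 x hx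
    rw [Lp01_eq]
    refine norm_iteratedFDeriv_rpow_integral_eval_le hp4 (by omega) (by omega) _ x |x|
      (fun t ↦ abs_nonneg _) (fun t ↦ ?_) (fun j _ _ t ↦ ?_) ?_
    · simp [hp.pow_abs]
    · exact abs_iterate_derivative_X_pow_eval_le p j (x t)
    · simpa using integral_pow_pos hp hx
  · intro p hp hp4 y x
    obtain ⟨q, hq⟩ := hp.two_dvd
    have h1 := one_le_integral_one_add_sq_pow q (x - y)
    have hk1 : (1 : ℝ) ≤ k := by exact_mod_cast (by omega : 1 ≤ k)
    rw [psi01_eq hq, iteratedFDeriv_comp_sub (f := fun z : C01 ↦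
      (∫ t, ((1 + Polynomial.X ^ 2) ^ q : Polynomial ℝ).eval (z t)) ^ ((1 : ℝ) / p))]
    refine (norm_iteratedFDeriv_rpow_integral_eval_le hp4 (by omega) (by omega) _ (x - y)
      ⟨fun t ↦ Real.sqrt (1 + (x - y) t ^ 2), by fun_prop⟩
      (fun t ↦ Real.sqrt_nonneg _) (fun t ↦ ?_) (fun j hj hj3 t ↦ ?_) (by linarith)).trans ?_
    · change _ = Real.sqrt (1 + (x - y) t ^ 2) ^ p
      rw [hq, pow_mul, Real.sq_sqrt (by positivity)]
      simp
    · exact abs_iterate_derivative_one_add_X_sq_pow_eval_le hq (by omega) hj hj3 _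
    · refine mul_le_of_le_one_right (by positivity) ?_
      exact Real.rpow_le_one_of_one_le_of_nonpos (Real.one_le_rpow h1 (by positivity))
        (by linarith)

end
end

section
/- Let X = (X_t)_{t∈[0,1]} and Y = (Y_t)_{t∈[0,1]} be C[0,1]-valued random variables with laws μ = L(X) and ν = L(Y). (i) If 0 < s ≤ 1 and E[‖X‖_∞^s] < ∞ and E[‖Y‖_∞^s] < ∞, then μ ∈ M_s(ν). (ii) If 1 < s ≤ 2, the moment conditions of (i) hold, and E[X_t] = E[Y_t] for all t ∈ [0,1], then μ ∈ M_s(ν). (iii) If 2 < s ≤ 3, the conditions of (ii) hold, and Cov(X_t, X_u) = Cov(Y_t, Y_u) for all t, u ∈ [0,1], then μ ∈ M_s(ν). -/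
open MeasureTheory ProbabilityTheory Filter
open scoped ENNReal NNReal Topology unitInterval

noncomputable section

/-- The Bernstein operators are contractions for the uniform norm. -/
theorem norm_bernsteinApproximation_le (n : ℕ) (f : C01) :
    ‖bernsteinApproximation n f‖ ≤ ‖f‖ := by
  refine (ContinuousMap.norm_le _ (norm_nonneg f)).2 fun x => ?_
  rw [bernsteinApproximation.apply]
  calc ‖∑ k : Fin (n + 1), bernstein n k x • f (bernstein.z k)‖
      ≤ ∑ k : Fin (n + 1), ‖bernstein n k x • f (bernstein.z k)‖ := norm_sum_le _ _
    _ ≤ ∑ k : Fin (n + 1), bernstein n k x * ‖f‖ := by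
        refine Finset.sum_le_sum fun k _ => ?_
        rw [norm_smul, Real.norm_of_nonneg bernstein_nonneg]
        exact mul_le_mul_of_nonneg_left (f.norm_coe_le_norm _) bernstein_nonneg
    _ = ‖f‖ := by rw [← Finset.sum_mul, bernstein.probability, one_mul]

/-- The diagonal of a multilinear form at a Bernstein approximation is a linear combination of
products of point evaluations. -/
theorem multilinear_bernsteinApproximation {k : ℕ}
    (f : ContinuousMultilinearMap ℝ (fun _ : Fin k => C01) ℝ) (n : ℕ) (x : C01) :
    f (fun _ => bernsteinApproximation n x) =
      ∑ r : Fin k → Fin (n + 1),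
        (∏ i, x (bernstein.z (r i))) * f (fun i => bernstein n (r i)) := by
  have h : bernsteinApproximation n x =
      ∑ j : Fin (n + 1), x (bernstein.z j) • bernstein n j := by
    ext t
    simp [bernsteinApproximation.apply, mul_comm]
  rw [h, f.map_sum]
  refine Finset.sum_congr rfl fun r _ => ?_
  rw [f.map_smul_univ, smul_eq_mul]

theorem integrable_norm_pow_of_lintegral_rpow {Ω : Type*} [MeasurableSpace Ω] {P : Measure Ω}
    [IsFiniteMeasure P] {s : ℝ} {X : Ω → C01} (hX : Measurable X)
    (hmom : ∫⁻ ω, ENNReal.ofReal (‖X ω‖ ^ s) ∂P < ∞) {k : ℕ} (hk : (k : ℝ) ≤ s) :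
    Integrable (fun ω => ‖X ω‖ ^ k) P := by
  have hs : Integrable (fun ω => ‖X ω‖ ^ s) P :=
    (lintegral_ofReal_ne_top_iff_integrable (hX.norm.pow_const s).aestronglyMeasurable
      (.of_forall fun ω => by positivity)).1 hmom.ne
  refine ((integrable_const (1 : ℝ)).add hs).mono' (hX.norm.pow_const k).aestronglyMeasurable
    (.of_forall fun ω => ?_)
  rw [Real.norm_of_nonneg (by positivity)]
  have h0 : 0 ≤ ‖X ω‖ ^ s := by positivity
  rcases le_total ‖X ω‖ 1 with h | h
  · have := pow_le_one₀ (n := k) (norm_nonneg (X ω)) h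
    simp only [Pi.add_apply]
    linarith
  · have := Real.rpow_le_rpow_of_exponent_le h hk
    rw [Real.rpow_natCast] at this
    simp only [Pi.add_apply]
    linarith

theorem integrable_prod_eval {Ω : Type*} [MeasurableSpace Ω] {P : Measure Ω}
    {X : Ω → C01} (hX : Measurable X) {k : ℕ} (hint : Integrable (fun ω => ‖X ω‖ ^ k) P)
    (t : Fin k → unitInterval) : Integrable (fun ω => ∏ i, X ω (t i)) P := by
  have hm : Measurable fun ω => ∏ i, X ω (t i) :=
    (continuous_finsetProd _ fun i _ =>
      continuous_eval_const (F := C01) (t i)).measurable.comp hX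
  refine hint.mono' hm.aestronglyMeasurable (.of_forall fun ω => ?_)
  rw [norm_prod]
  calc ∏ i, ‖X ω (t i)‖ ≤ ∏ _i : Fin k, ‖X ω‖ :=
        Finset.prod_le_prod (fun _ _ => norm_nonneg _) fun i _ => (X ω).norm_coe_le_norm _
    _ = ‖X ω‖ ^ k := by simp

theorem tendsto_integral_multilinear_bernsteinApproximation {Ω : Type*} [MeasurableSpace Ω]
    {P : Measure Ω} {X : Ω → C01} (hX : Measurable X) {k : ℕ}
    (hint : Integrable (fun ω => ‖X ω‖ ^ k) P)
    (f : ContinuousMultilinearMap ℝ (fun _ : Fin k => C01) ℝ) :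
    Tendsto (fun n : ℕ => ∑ r : Fin k → Fin (n + 1),
        (∫ ω, ∏ i, X ω (bernstein.z (r i)) ∂P) * f (fun i => bernstein n (r i)))
      atTop (𝓝 (∫ ω, f (fun _ => X ω) ∂P)) := by
  have hsum : ∀ n : ℕ, Integrable (fun ω => f (fun _ => bernsteinApproximation n (X ω))) P ∧
      ∫ ω, f (fun _ => bernsteinApproximation n (X ω)) ∂P =
        ∑ r : Fin k → Fin (n + 1),
          (∫ ω, ∏ i, X ω (bernstein.z (r i)) ∂P) * f (fun i => bernstein n (r i)) := by
    intro n
    have hi : ∀ r : Fin k → Fin (n + 1), Integrable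
        (fun ω => (∏ i, X ω (bernstein.z (r i))) * f (fun i => bernstein n (r i))) P :=
      fun r => (integrable_prod_eval hX hint _).mul_const _
    simp only [multilinear_bernsteinApproximation]
    refine ⟨integrable_finsetSum _ fun r _ => hi r, ?_⟩
    rw [integral_finsetSum _ fun r _ => hi r]
    simp only [integral_mul_const]
  simp only [← (hsum _).2]
  refine tendsto_integral_of_dominated_convergence (fun ω => ‖f‖ * ‖X ω‖ ^ k)
    (fun n => (hsum n).1.aestronglyMeasurable) (hint.const_mul _)
    (fun n => .of_forall fun ω => ?_) (.of_forall fun ω => ?_)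
  · calc ‖f (fun _ => bernsteinApproximation n (X ω))‖
        ≤ ‖f‖ * ∏ _i : Fin k, ‖bernsteinApproximation n (X ω)‖ := f.le_opNorm _
      _ = ‖f‖ * ‖bernsteinApproximation n (X ω)‖ ^ k := by simp
      _ ≤ ‖f‖ * ‖X ω‖ ^ k := by
        gcongr
        exact norm_bernsteinApproximation_le n (X ω)
  · exact (f.cont.tendsto _).comp
      (tendsto_pi_nhds.2 fun _ => bernsteinApproximation_uniform (X ω))

/-- If all `k`-fold products of point evaluations have the same expectation under `X` and `Y`,
then so do all continuous `k`-linear forms on the diagonal. -/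
theorem integral_multilinear_eq_of_integral_prod_eval_eq {Ω : Type*} [MeasurableSpace Ω]
    {P : Measure Ω} {X Y : Ω → C01} (hX : Measurable X) (hY : Measurable Y) {k : ℕ}
    (hXint : Integrable (fun ω => ‖X ω‖ ^ k) P) (hYint : Integrable (fun ω => ‖Y ω‖ ^ k) P)
    (h : ∀ t : Fin k → unitInterval, ∫ ω, ∏ i, X ω (t i) ∂P = ∫ ω, ∏ i, Y ω (t i) ∂P)
    (f : ContinuousMultilinearMap ℝ (fun _ : Fin k => C01) ℝ) :
    ∫ ω, f (fun _ => X ω) ∂P = ∫ ω, f (fun _ => Y ω) ∂P := by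
  refine tendsto_nhds_unique
    (tendsto_integral_multilinear_bernsteinApproximation hX hXint f) ?_
  simp only [h]
  exact tendsto_integral_multilinear_bernsteinApproximation hY hYint f

theorem memMsOf_map_of_integral_prod_eval_eq {Ω : Type*} [MeasurableSpace Ω]
    {P : Measure Ω} [IsProbabilityMeasure P] {s : ℝ}
    {X Y : Ω → C01} (hX : Measurable X) (hY : Measurable Y)
    (hXmom : ∫⁻ ω, ENNReal.ofReal (‖X ω‖ ^ s) ∂P < ∞)
    (hYmom : ∫⁻ ω, ENNReal.ofReal (‖Y ω‖ ^ s) ∂P < ∞)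
    (h : ∀ k : ℕ, 1 ≤ k → k ≤ ⌈s⌉₊ - 1 → ∀ t : Fin k → unitInterval,
      ∫ ω, ∏ i, X ω (t i) ∂P = ∫ ω, ∏ i, Y ω (t i) ∂P) :
    MemMsOf s (P.map Y) (P.map X) := by
  refine ⟨⟨Measure.isProbabilityMeasure_map hX.aemeasurable, ?_⟩, fun k hk1 hk f => ?_⟩
  · rwa [lintegral_map (measurable_norm.pow_const s).ennreal_ofReal hX]
  · have hks : (k : ℝ) ≤ s := (Nat.lt_ceil.1 (by omega)).le
    have hf : Measurable fun x : C01 => f fun _ => x :=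
      (f.cont.comp (continuous_pi fun _ => continuous_id)).measurable
    rw [integral_map hX.aemeasurable hf.aestronglyMeasurable,
      integral_map hY.aemeasurable hf.aestronglyMeasurable]
    exact integral_multilinear_eq_of_integral_prod_eval_eq hX hY
      (integrable_norm_pow_of_lintegral_rpow hX hXmom hks)
      (integrable_norm_pow_of_lintegral_rpow hY hYmom hks) (h k hk1 hk) f

theorem memMsOf_of_matching_moments
    {Ω : Type*} [MeasurableSpace Ω] (P : Measure Ω) [IsProbabilityMeasure P]
    (s : ℝ)
    (X Y : Ω → C01) (hX : Measurable X) (hY : Measurable Y)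
    (hXmom : ∫⁻ ω, ENNReal.ofReal (‖X ω‖ ^ s) ∂P < ∞)
    (hYmom : ∫⁻ ω, ENNReal.ofReal (‖Y ω‖ ^ s) ∂P < ∞) :
    -- (i)
    (0 < s → s ≤ 1 → MemMsOf s (P.map Y) (P.map X)) ∧
    -- (ii)
    (1 < s → s ≤ 2 →
      (∀ t : unitInterval, ∫ ω, X ω t ∂P = ∫ ω, Y ω t ∂P) →
      MemMsOf s (P.map Y) (P.map X)) ∧
    -- (iii)
    (2 < s → s ≤ 3 →
      (∀ t : unitInterval, ∫ ω, X ω t ∂P = ∫ ω, Y ω t ∂P) →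
      (∀ t u : unitInterval,
        ∫ ω, X ω t * X ω u ∂P - (∫ ω, X ω t ∂P) * (∫ ω, X ω u ∂P)
          = ∫ ω, Y ω t * Y ω u ∂P - (∫ ω, Y ω t ∂P) * (∫ ω, Y ω u ∂P)) →
      MemMsOf s (P.map Y) (P.map X)) := by
  refine ⟨fun hs0 hs1 => ?_, fun hs1 hs2 hmean => ?_, fun hs2 hs3 hmean hcov => ?_⟩
  · refine memMsOf_map_of_integral_prod_eval_eq hX hY hXmom hYmom fun k hk1 hk => ?_
    have hc : ⌈s⌉₊ ≤ 1 := Nat.ceil_le.2 (by exact_mod_cast hs1)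
    omega
  · refine memMsOf_map_of_integral_prod_eval_eq hX hY hXmom hYmom fun k hk1 hk t => ?_
    have hc : ⌈s⌉₊ ≤ 2 := Nat.ceil_le.2 (by exact_mod_cast hs2)
    obtain rfl : k = 1 := by omega
    simpa using hmean (t 0)
  · refine memMsOf_map_of_integral_prod_eval_eq hX hY hXmom hYmom fun k hk1 hk t => ?_
    have hc : ⌈s⌉₊ ≤ 3 := Nat.ceil_le.2 (by exact_mod_cast hs3)
    obtain rfl | rfl : k = 1 ∨ k = 2 := by omega
    · simpa using hmean (t 0)
    · have h := hcov (t 0) (t 1)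
      rw [hmean (t 0), hmean (t 1)] at h
      simpa [Fin.prod_univ_two] using h

end
end
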